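/- arXiv:2212.09810 — 8 statements merged into one kernel-verified Lean document; each statement's English description precedes it below -/
import Mathlib

section
/- For each k ∈ {1, 5, 7, 11}, the Dirichlet density of the set 𝒫_k = {p ∈ 𝒫 : p ≡ k (mod 24)} equals 1/24; that is, the ratio (∑_{p ∈ 𝒫_k} p^{−s}) / (∑_{p prime} p^{−s}) tends to 1/24 as the real number s tends to 1 from the right. -/
open Filter Topology

/-- Hecke-type recursion: the coefficients of an Euler product with local factors
`1 / (1 - h p + e p)`. -/
structure HasEulerRecursion (h e : ℕ → ℝ) : Prop where
  map_zero : h 0 = 0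
  map_one : h 1 = 1
  map_prime_mul : ∀ p : ℕ, p.Prime → ∀ n : ℕ,
    h (p * n) = h p * h n - if p ∣ n then e p * h (n / p) else 0

namespace HasEulerRecursion

variable {h e : ℕ → ℝ}

theorem twist (H : HasEulerRecursion h e) (s : ℝ) :
    HasEulerRecursion (fun n => h n * (n : ℝ) ^ (-s)) (fun p => e p * ((p : ℝ) ^ (-s)) ^ 2) where
  map_zero := by simp [H.map_zero]
  map_one := by simp [H.map_one]
  map_prime_mul p hp n := by
    have hp0 : (p : ℝ) ≠ 0 := by exact_mod_cast hp.ne_zero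
    have hmul : ∀ m : ℕ, ((p * m : ℕ) : ℝ) ^ (-s) = (p : ℝ) ^ (-s) * (m : ℝ) ^ (-s) := by
      intro m
      push_cast
      exact Real.mul_rpow (by positivity) (by positivity)
    rw [H.map_prime_mul p hp n]
    split_ifs with hd
    · obtain ⟨m, rfl⟩ := hd
      rw [Nat.mul_div_cancel_left m hp.pos, hmul, hmul]
      ring
    · rw [hmul]
      ring

theorem map_mul_of_coprime (H : HasEulerRecursion h e) (m n : ℕ) (hmn : m.Coprime n) :
    h (m * n) = h m * h n := by
  induction m using Nat.strong_induction_on with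
  | _ m ih =>
    rcases Nat.eq_zero_or_pos m with rfl | hm
    · simp [H.map_zero]
    rcases eq_or_ne m 1 with rfl | h1
    · simp [H.map_one]
    obtain ⟨p, hp, k, rfl⟩ := Nat.exists_prime_and_dvd h1
    have hk : 0 < k := Nat.pos_of_mul_pos_left hm
    have hkp : k < p * k := by nlinarith [hp.two_le]
    have hpn : p.Coprime n := Nat.Coprime.coprime_mul_right hmn
    have hkn : k.Coprime n := Nat.Coprime.coprime_mul_left hmn
    have hdvd : p ∣ k * n ↔ p ∣ k :=
      ⟨fun hd => hpn.dvd_of_dvd_mul_right hd, fun hd => hd.mul_right n⟩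
    rw [mul_assoc, H.map_prime_mul p hp, H.map_prime_mul p hp, ih k hkp hkn]
    by_cases hd : p ∣ k
    · rw [if_pos (hdvd.2 hd), if_pos hd]
      obtain ⟨l, rfl⟩ := hd
      rw [mul_assoc, Nat.mul_div_cancel_left _ hp.pos, Nat.mul_div_cancel_left _ hp.pos]
      have hl : 0 < l := Nat.pos_of_mul_pos_left hk
      rw [ih l (lt_of_le_of_lt (Nat.le_mul_of_pos_left l hp.pos) hkp)
        (Nat.Coprime.coprime_mul_left hkn)]
      ring
    · rw [if_neg (fun hd' => hd (hdvd.1 hd')), if_neg hd]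
      ring

theorem tsum_prime_pow (H : HasEulerRecursion h e) {p : ℕ} (hp : p.Prime)
    (hs : Summable fun k => h (p ^ k)) : (∑' k, h (p ^ k)) * (1 - h p + e p) = 1 := by
  have hrec : ∀ k, h (p ^ (k + 2)) = h p * h (p ^ (k + 1)) - e p * h (p ^ k) := by
    intro k
    have := H.map_prime_mul p hp (p ^ (k + 1))
    rw [if_pos (dvd_pow_self p k.succ_ne_zero), ← pow_succ', pow_succ' p k,
      Nat.mul_div_cancel_left _ hp.pos, ← pow_succ'] at this
    exact this
  have h1 : Summable fun k => h (p ^ (k + 1)) := (summable_nat_add_iff 1).2 hs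
  have e0 := hs.tsum_eq_zero_add
  have e1 := h1.tsum_eq_zero_add
  have e2 : ∑' k, h (p ^ (k + 2)) = h p * ∑' k, h (p ^ (k + 1)) - e p * ∑' k, h (p ^ k) := by
    rw [← tsum_mul_left, ← tsum_mul_left, ← (h1.mul_left _).tsum_sub (hs.mul_left _)]
    exact tsum_congr hrec
  simp only [pow_zero, H.map_one, zero_add, pow_one, add_assoc, Nat.reduceAdd] at e0 e1
  rw [e2] at e1
  linear_combination (1 - h p) * e0 + e1

theorem abs_log_tsum_sub_le (H : HasEulerRecursion h e) (hs : Summable h)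
    (hh : ∀ p : ℕ, p.Prime → |h p| ≤ 2 / p) (he : ∀ p : ℕ, p.Prime → |e p| ≤ 1 / (p : ℝ) ^ 2)
    (h2 : h 2 = 0) (h3 : h 3 = 0) (e2 : e 2 = 0) (e3 : e 3 = 0)
    (hps : Summable fun p : Nat.Primes => h p) :
    0 < ∑' n, h n ∧
      |Real.log (∑' n, h n) - ∑' p : Nat.Primes, h p| ≤
        ∑' p : Nat.Primes, 20 * (1 / ((p : ℕ) : ℝ) ^ 2) := by
  have hprod := EulerProduct.eulerProduct_hasProd H.map_one (fun {m n} => H.map_mul_of_coprime m n)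
    hs.norm H.map_zero
  have hloc : ∀ p : Nat.Primes, ∃ x : ℝ, (∑' k, h ((p : ℕ) ^ k)) = Real.exp x ∧
      |x - h p| ≤ 20 * (1 / ((p : ℕ) : ℝ) ^ 2) := by
    rintro ⟨p, hp⟩
    have hsp : Summable fun k => h (p ^ k) :=
      hs.comp_injective (Nat.pow_right_injective hp.two_le)
    have key := H.tsum_prime_pow hp hsp
    simp only
    set u := h p - e p with hu
    have hp0 : (0 : ℝ) < p := by exact_mod_cast hp.pos
    have hee := he p hp
    have hb : |u| ≤ 3 / p ∧ |u| ≤ 1 / 2 := by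
      by_cases h23 : p = 2 ∨ p = 3
      · have hu0 : u = 0 := by rcases h23 with rfl | rfl <;> simp [hu, h2, h3, e2, e3]
        rw [hu0, abs_zero]
        constructor <;> positivity
      · have hp5 : (5 : ℝ) ≤ p := by
          push Not at h23
          have h4 : p ≠ 4 := by rintro rfl; revert hp; decide
          have := hp.two_le
          have : 5 ≤ p := by omega
          exact_mod_cast this
        have h1 := hh p hp
        have habs : |u| ≤ |h p| + |e p| := abs_sub _ _
        have hq : 1 / (p : ℝ) ^ 2 ≤ (1 / 5) * (1 / p) := by
          rw [one_div_mul_one_div]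
          apply one_div_le_one_div_of_le (by positivity)
          nlinarith
        have hr : 1 / (p : ℝ) ≤ 1 / 5 := one_div_le_one_div_of_le (by norm_num) hp5
        have h2' : 2 / (p : ℝ) = 2 * (1 / p) := by ring
        have h3' : 3 / (p : ℝ) = 3 * (1 / p) := by ring
        have hpos : 0 < 1 / (p : ℝ) := by positivity
        rw [h2'] at h1
        rw [h3']
        constructor <;> linarith
    have hu1 : 0 < 1 - u := by linarith [le_abs_self u]
    refine ⟨-Real.log (1 - u), ?_, ?_⟩
    · rw [Real.exp_neg, Real.exp_log hu1]
      refine eq_inv_of_mul_eq_one_left ?_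
      rw [hu, ← sub_add]
      exact key
    · have hlog := Real.abs_log_sub_add_sum_range_le (x := u) (by linarith [hb.2]) 1
      simp only [Finset.range_one, Finset.sum_singleton, zero_add, pow_one, Nat.cast_zero, div_one,
        Nat.reduceAdd] at hlog
      have hquad : |u| ^ 2 / (1 - |u|) ≤ 18 * (1 / (p : ℝ) ^ 2) := by
        rw [div_le_iff₀ (by linarith [hb.2])]
        have : |u| ^ 2 ≤ 9 * (1 / (p : ℝ) ^ 2) := by
          calc |u| ^ 2 ≤ (3 / (p : ℝ)) ^ 2 := pow_le_pow_left₀ (abs_nonneg _) hb.1 2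
            _ = _ := by rw [div_pow]; ring
        have hpos : 0 < 1 / (p : ℝ) ^ 2 := by positivity
        nlinarith [hb.2]
      have : -Real.log (1 - u) - h p = -(u + Real.log (1 - u)) - e p := by rw [hu]; ring
      rw [this]
      have h1 := abs_sub (-(u + Real.log (1 - u))) (e p)
      rw [abs_neg] at h1
      have hpos : 0 < 1 / (p : ℝ) ^ 2 := by positivity
      linarith
  choose x hx hxb using hloc
  have hsq : Summable fun p : Nat.Primes => 20 * (1 / ((p : ℕ) : ℝ) ^ 2) :=
    ((Real.summable_one_div_nat_pow.2 one_lt_two).mul_left 20).comp_injective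
      Subtype.val_injective
  have hdiff : Summable fun p : Nat.Primes => x p - h p := hsq.of_norm_bounded hxb
  have hxs : Summable x := by simpa using hdiff.add hps
  have hF : ∑' n, h n = Real.exp (∑' p, x p) := by
    refine hprod.unique ?_
    rw [funext hx]
    exact hxs.hasSum.rexp
  refine ⟨hF ▸ Real.exp_pos _, ?_⟩
  rw [hF, Real.log_exp, ← hxs.tsum_sub hps]
  have := tsum_of_norm_bounded (f := fun p => x p - h p) hsq.hasSum hxb
  rwa [Real.norm_eq_abs] at this

end HasEulerRecursion

/-- The Dirichlet series of `a` restricted to the primes. -/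
noncomputable def primeSum (a : ℕ → ℝ) (s : ℝ) : ℝ :=
  ∑' p : Nat.Primes, a p * ((p : ℕ) : ℝ) ^ (-s)

theorem summable_primes_rpow {s : ℝ} (hs : 1 < s) :
    Summable fun p : Nat.Primes => ((p : ℕ) : ℝ) ^ (-s) :=
  (Real.summable_nat_rpow.2 (by linarith)).comp_injective Subtype.val_injective

theorem summable_primeSum {a : ℕ → ℝ} {M s : ℝ} (ha : ∀ p : ℕ, p.Prime → |a p| ≤ M)
    (hs : 1 < s) : Summable fun p : Nat.Primes => a p * ((p : ℕ) : ℝ) ^ (-s) := by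
  refine ((summable_primes_rpow hs).mul_left M).of_norm_bounded fun p => ?_
  rw [norm_mul, Real.norm_of_nonneg (Real.rpow_nonneg (Nat.cast_nonneg _) _)]
  exact mul_le_mul_of_nonneg_right (ha p p.2) (Real.rpow_nonneg (Nat.cast_nonneg _) _)

theorem HasEulerRecursion.exists_abs_log_sub_primeSum_le {g e : ℕ → ℝ}
    (H : HasEulerRecursion g e)
    (hg : ∀ p : ℕ, p.Prime → |g p| ≤ 2) (he : ∀ p : ℕ, p.Prime → |e p| ≤ 1)
    (h2 : g 2 = 0) (h3 : g 3 = 0) (e2 : e 2 = 0) (e3 : e 3 = 0) :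
    ∃ C : ℝ, ∀ s : ℝ, 1 < s → Summable (fun n : ℕ => g n * (n : ℝ) ^ (-s)) →
      0 < ∑' n : ℕ, g n * (n : ℝ) ^ (-s) ∧
        |Real.log (∑' n : ℕ, g n * (n : ℝ) ^ (-s)) - primeSum g s| ≤ C := by
  refine ⟨_, fun s hs hsum => (H.twist s).abs_log_tsum_sub_le hsum ?_ ?_ (by simp [h2])
    (by simp [h3]) (by simp [e2]) (by simp [e3]) (summable_primeSum hg hs)⟩
  · intro p hp
    have hp1 : (1 : ℝ) ≤ p := by exact_mod_cast hp.one_le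
    have h1 : (p : ℝ) ^ (-s) ≤ 1 / p := by
      rw [one_div, ← Real.rpow_neg_one]
      exact Real.rpow_le_rpow_of_exponent_le hp1 (by linarith)
    rw [abs_mul, abs_of_nonneg (a := (p : ℝ) ^ (-s)) (by positivity), div_eq_mul_one_div]
    exact mul_le_mul (hg p hp) h1 (by positivity) (by norm_num)
  · intro p hp
    have hp1 : (1 : ℝ) ≤ p := by exact_mod_cast hp.one_le
    have h1 : (p : ℝ) ^ (-s) ≤ 1 / p := by
      rw [one_div, ← Real.rpow_neg_one]
      exact Real.rpow_le_rpow_of_exponent_le hp1 (by linarith)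
    rw [abs_mul, abs_of_nonneg (a := ((p : ℝ) ^ (-s)) ^ 2) (by positivity)]
    calc |e p| * ((p : ℝ) ^ (-s)) ^ 2 ≤ 1 * (1 / p) ^ 2 :=
          mul_le_mul (he p hp) (pow_le_pow_left₀ (by positivity) h1 2) (by positivity) zero_le_one
      _ = 1 / (p : ℝ) ^ 2 := by rw [one_mul, one_div_pow]

open Asymptotics

theorem isBigO_log_of_tendsto {F : ℝ → ℝ} {c : ℝ} {l : Filter ℝ} (hF : Tendsto F l (𝓝 c))
    (hc : c ≠ 0) : (fun s => Real.log (F s)) =O[l] fun _ => (1 : ℝ) :=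
  (hF.log hc).isBigO_one ℝ

theorem abs_dirichletCharacter_le_one {N : ℕ} (ψ : DirichletCharacter ℝ N) (a : ZMod N) :
    |ψ a| ≤ 1 := ψ.norm_le_one a

theorem hasEulerRecursion_dirichletCharacter {N : ℕ} (hN : N ≠ 1) (ψ : DirichletCharacter ℝ N) :
    HasEulerRecursion (fun n => ψ (n : ZMod N)) 0 where
  map_zero := by
    have : Nontrivial (ZMod N) := ZMod.nontrivial_iff.2 hN
    simp [MulChar.map_zero]
  map_one := by simp
  map_prime_mul p hp n := by simp

theorem dirichletCharacter_two (ψ : DirichletCharacter ℝ 24) : ψ ((2 : ℕ) : ZMod 24) = 0 :=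
  ψ.map_nonunit (by rw [ZMod.isUnit_iff_coprime]; decide)

theorem dirichletCharacter_three (ψ : DirichletCharacter ℝ 24) : ψ ((3 : ℕ) : ZMod 24) = 0 :=
  ψ.map_nonunit (by rw [ZMod.isUnit_iff_coprime]; decide)

theorem ofReal_tsum_dirichletCharacter (ψ : DirichletCharacter ℝ 24) {s : ℝ} (hs : 1 < s) :
    ((∑' n : ℕ, ψ (n : ZMod 24) * (n : ℝ) ^ (-s) : ℝ) : ℂ) =
      DirichletCharacter.LFunction (ψ.ringHomComp Complex.ofRealHom) (s : ℂ) := by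
  rw [DirichletCharacter.LFunction_eq_LSeries _ (by simpa using hs), LSeries, Complex.ofReal_tsum]
  refine tsum_congr fun n => ?_
  rcases eq_or_ne n 0 with rfl | hn
  · have h0 : ψ ((0 : ℕ) : ZMod 24) = 0 :=
      (hasEulerRecursion_dirichletCharacter (by norm_num) ψ).map_zero
    rw [h0]
    simp
  · rw [LSeries.term_of_ne_zero hn]
    push_cast
    rw [Complex.ofReal_cpow (Nat.cast_nonneg n)]
    simp [Complex.cpow_neg, div_eq_mul_inv]

theorem summable_dirichletCharacter (ψ : DirichletCharacter ℝ 24) {s : ℝ} (hs : 1 < s) :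
    Summable fun n : ℕ => ψ (n : ZMod 24) * (n : ℝ) ^ (-s) := by
  refine (Real.summable_nat_rpow.2 (show -s < -1 by linarith)).of_norm_bounded fun n => ?_
  rw [norm_mul, Real.norm_of_nonneg (Real.rpow_nonneg (Nat.cast_nonneg n) (-s))]
  exact mul_le_of_le_one_left (Real.rpow_nonneg (Nat.cast_nonneg _) _)
    (abs_dirichletCharacter_le_one ψ _)

theorem isBigO_primeSum_sub_log (ψ : DirichletCharacter ℝ 24) :
    (fun s => Real.log (∑' n : ℕ, ψ (n : ZMod 24) * (n : ℝ) ^ (-s)) -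
      primeSum (fun n => ψ (n : ZMod 24)) s) =O[𝓝[>] 1] fun _ => (1 : ℝ) := by
  obtain ⟨C, hC⟩ := (hasEulerRecursion_dirichletCharacter (by norm_num)
    ψ).exists_abs_log_sub_primeSum_le
    (fun p _ => (abs_dirichletCharacter_le_one ψ p).trans one_le_two) (by simp)
    (dirichletCharacter_two ψ) (dirichletCharacter_three ψ) rfl rfl
  refine IsBigO.of_bound C ?_
  filter_upwards [self_mem_nhdsWithin] with s hs
  simpa using (hC s hs (summable_dirichletCharacter ψ hs)).2

theorem isBigO_primeSum_of_ne_one {ψ : DirichletCharacter ℝ 24} (hψ : ψ ≠ 1) :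
    primeSum (fun n => ψ (n : ZMod 24)) =O[𝓝[>] 1] fun _ => (1 : ℝ) := by
  have hχ : ψ.ringHomComp Complex.ofRealHom ≠ 1 :=
    (MulChar.ringHomComp_ne_one_iff Complex.ofRealHom.injective).2 hψ
  have hL : Tendsto (fun s : ℝ => DirichletCharacter.LFunction (ψ.ringHomComp Complex.ofRealHom)
      (s : ℂ)) (𝓝[>] 1) (𝓝 (DirichletCharacter.LFunction (ψ.ringHomComp Complex.ofRealHom) 1)) := by
    have h1 := (DirichletCharacter.differentiable_LFunction hχ).continuous.tendsto ((1 : ℝ) : ℂ)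
    rw [Complex.ofReal_one] at h1
    have h2 : Tendsto (fun s : ℝ => (s : ℂ)) (𝓝[>] 1) (𝓝 1) :=
      (Complex.continuous_ofReal.tendsto' 1 1 (by simp)).mono_left nhdsWithin_le_nhds
    exact h1.comp h2
  have hF : Tendsto (fun s : ℝ => ‖∑' n : ℕ, ψ (n : ZMod 24) * (n : ℝ) ^ (-s)‖) (𝓝[>] 1)
      (𝓝 ‖DirichletCharacter.LFunction (ψ.ringHomComp Complex.ofRealHom) 1‖) := by
    refine hL.norm.congr' ?_
    filter_upwards [self_mem_nhdsWithin] with s hs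
    rw [← ofReal_tsum_dirichletCharacter ψ hs, Complex.norm_real]
  have := isBigO_log_of_tendsto hF
    (norm_ne_zero_iff.2 (DirichletCharacter.LFunction_apply_one_ne_zero hχ))
  simp only [Real.norm_eq_abs, Real.log_abs] at this
  simpa using this.sub (isBigO_primeSum_sub_log ψ)

theorem isBigO_primeSum_one :
    (fun s => primeSum (fun n => (1 : DirichletCharacter ℝ 24) (n : ZMod 24)) s + Real.log (s - 1))
      =O[𝓝[>] 1] fun _ => (1 : ℝ) := by
  set ψ : DirichletCharacter ℝ 24 := 1 with hψ
  have hχ : ψ.ringHomComp Complex.ofRealHom = 1 := MulChar.ringHomComp_one _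
  have h2 : Tendsto (fun s : ℝ => (s : ℂ)) (𝓝[>] 1) (𝓝[≠] 1) := by
    refine tendsto_nhdsWithin_iff.2 ⟨(Complex.continuous_ofReal.tendsto' 1 1 (by simp)).mono_left
      nhdsWithin_le_nhds, ?_⟩
    filter_upwards [self_mem_nhdsWithin] with s hs
    have : s ≠ 1 := ne_of_gt hs
    simpa using this
  have hL := (DirichletCharacter.LFunctionTrivChar_residue_one (N := 24)).comp h2
  have hF := hL.norm
  have hc : ‖∏ p ∈ Nat.primeFactors 24, (1 - (p : ℂ)⁻¹)‖ ≠ 0 := by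
    rw [norm_ne_zero_iff, Finset.prod_ne_zero_iff]
    intro p hp
    have h1 : (p : ℂ) ≠ 1 := by exact_mod_cast (Nat.prime_of_mem_primeFactors hp).ne_one
    rw [sub_ne_zero]
    intro h
    exact h1 (inv_eq_one.1 h.symm)
  have hlog := isBigO_log_of_tendsto hF hc
  have heq : (fun s : ℝ => Real.log ((fun x => ‖((fun s => (s - 1) *
      DirichletCharacter.LFunctionTrivChar 24 s) ∘ fun s : ℝ => (s : ℂ)) x‖) s)) =ᶠ[𝓝[>] 1]
      fun s => Real.log (s - 1) + Real.log (∑' n : ℕ, ψ (n : ZMod 24) * (n : ℝ) ^ (-s)) := by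
    obtain ⟨C, hC⟩ := (hasEulerRecursion_dirichletCharacter (by norm_num)
      ψ).exists_abs_log_sub_primeSum_le
      (fun p _ => (abs_dirichletCharacter_le_one ψ p).trans one_le_two) (by simp)
      (dirichletCharacter_two ψ) (dirichletCharacter_three ψ) rfl rfl
    filter_upwards [self_mem_nhdsWithin] with s hs
    have hpos := (hC s hs (summable_dirichletCharacter ψ hs)).1
    have hs1 : 0 < s - 1 := sub_pos.2 hs
    rw [← Real.log_mul hs1.ne' hpos.ne']
    simp only [Function.comp_apply]
    rw [DirichletCharacter.LFunctionTrivChar, ← hχ, ← ofReal_tsum_dirichletCharacter ψ hs,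
      ← Complex.ofReal_one, ← Complex.ofReal_sub, ← Complex.ofReal_mul, Complex.norm_real,
      Real.norm_eq_abs, Real.log_abs]
  refine ((hlog.congr' heq EventuallyEq.rfl).sub (isBigO_primeSum_sub_log ψ)).congr_left ?_
  intro s
  ring

theorem isUnit_natCast_of_prime {p : ℕ} (hp : p.Prime) (h2 : p ≠ 2) (h3 : p ≠ 3) :
    IsUnit (p : ZMod 24) := by
  rw [ZMod.isUnit_iff_coprime, hp.coprime_iff_not_dvd, show 24 = 2 ^ 3 * 3 by norm_num, hp.dvd_mul]
  rintro (h | h)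
  · exact h2 ((Nat.prime_dvd_prime_iff_eq hp Nat.prime_two).1 (hp.dvd_of_dvd_pow h))
  · exact h3 ((Nat.prime_dvd_prime_iff_eq hp Nat.prime_three).1 h)

instance hasEnoughRootsOfUnity_real_two : HasEnoughRootsOfUnity ℝ 2 where
  prim := ⟨-1, IsPrimitiveRoot.neg_one 0 (by norm_num)⟩
  cyc := inferInstance

instance hasEnoughRootsOfUnity_real_exponent :
    HasEnoughRootsOfUnity ℝ (Monoid.exponent (ZMod 24)ˣ) :=
  HasEnoughRootsOfUnity.of_dvd ℝ (Monoid.exponent_dvd_of_forall_pow_eq_one (n := 2) (by decide))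

theorem primeSum_ite_eq {f : ℕ → ℝ} {M s : ℝ} (hf : ∀ p : ℕ, p.Prime → |f p| ≤ M) (hs : 1 < s)
    {a : ZMod 24} (ha : IsUnit a) :
    primeSum (fun n => if a = n then f n else 0) s =
      (1 / 8) * ∑ ψ : DirichletCharacter ℝ 24, ψ a⁻¹ * primeSum (fun n => ψ n * f n) s := by
  simp only [primeSum]
  simp_rw [← tsum_mul_left]
  have hbd : ∀ ψ : DirichletCharacter ℝ 24, ∀ p : ℕ, p.Prime → |ψ p * f p| ≤ M := by
    intro ψ p hp
    rw [abs_mul]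
    exact (mul_le_of_le_one_left (abs_nonneg _) (abs_dirichletCharacter_le_one ψ p)).trans (hf p hp)
  rw [← Summable.tsum_finsetSum fun ψ _ => (summable_primeSum (hbd ψ) hs).mul_left _,
    ← tsum_mul_left]
  refine tsum_congr fun p => ?_
  have horth := DirichletCharacter.sum_char_inv_mul_char_eq ℝ ha ((p : ℕ) : ZMod 24)
  have htot : Nat.totient 24 = 8 := by decide
  have : ∑ ψ : DirichletCharacter ℝ 24,
      ψ a⁻¹ * (ψ ((p : ℕ) : ZMod 24) * f p * ((p : ℕ) : ℝ) ^ (-s)) =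
      (∑ ψ : DirichletCharacter ℝ 24, ψ a⁻¹ * ψ ((p : ℕ) : ZMod 24)) *
        (f p * ((p : ℕ) : ℝ) ^ (-s)) := by
    rw [Finset.sum_mul]
    exact Finset.sum_congr rfl fun ψ _ => by ring
  rw [this, horth, htot]
  split_ifs
  · push_cast
    ring
  · ring

theorem isBigO_primeSum_residueClass {a : ZMod 24} (ha : IsUnit a) :
    (fun s => primeSum (fun n => if a = n then 1 else 0) s + (1 / 8) * Real.log (s - 1))
      =O[𝓝[>] 1] fun _ => (1 : ℝ) := by
  classical
  have hO : (fun s => (1 / 8 : ℝ) * ∑ ψ : DirichletCharacter ℝ 24, ψ a⁻¹ *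
      (primeSum (fun n => ψ n) s + if ψ = 1 then Real.log (s - 1) else 0))
      =O[𝓝[>] 1] fun _ => (1 : ℝ) := by
    refine (IsBigO.fun_sum fun ψ _ => ?_).const_mul_left _
    refine IsBigO.const_mul_left ?_ _
    by_cases hψ : ψ = 1
    · simpa [hψ] using isBigO_primeSum_one
    · simpa [hψ] using isBigO_primeSum_of_ne_one hψ
  refine hO.congr' ?_ EventuallyEq.rfl
  filter_upwards [self_mem_nhdsWithin] with s hs
  have := primeSum_ite_eq (f := fun _ => 1) (M := 1) (by simp) hs ha
  rw [this]
  have ha' : IsUnit a⁻¹ := by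
    obtain ⟨u, rfl⟩ := ha
    rw [ZMod.inv_coe_unit]
    exact u⁻¹.isUnit
  simp only [mul_add, Finset.sum_add_distrib, mul_one, mul_ite, mul_zero, Finset.sum_ite_eq',
    Finset.mem_univ, if_true, MulChar.one_apply ha', one_mul]

theorem isBigO_primeSum_const_one :
    (fun s => primeSum (fun _ => 1) s + Real.log (s - 1)) =O[𝓝[>] 1] fun _ => (1 : ℝ) := by
  have hfin : (fun s : ℝ => (2 : ℝ) ^ (-s) + (3 : ℝ) ^ (-s)) =O[𝓝[>] 1] fun _ => (1 : ℝ) := by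
    have hc : Continuous fun s : ℝ => (2 : ℝ) ^ (-s) + (3 : ℝ) ^ (-s) := by
      fun_prop (disch := norm_num)
    exact ((hc.tendsto 1).mono_left nhdsWithin_le_nhds).isBigO_one ℝ
  refine (isBigO_primeSum_one.add hfin).congr' ?_ EventuallyEq.rfl
  filter_upwards [self_mem_nhdsWithin] with s hs
  suffices h : primeSum (fun _ => 1) s =
      primeSum (fun n => (1 : DirichletCharacter ℝ 24) (n : ZMod 24)) s +
        ((2 : ℝ) ^ (-s) + (3 : ℝ) ^ (-s)) by rw [h]; ring
  have h1 := summable_primeSum (a := fun _ => 1) (M := 1) (by simp) hs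
  have h2 := summable_primeSum (a := fun n => (1 : DirichletCharacter ℝ 24) (n : ZMod 24))
    (fun p _ => abs_dirichletCharacter_le_one _ _) hs
  obtain ⟨q₂, hq₂⟩ : ∃ q : Nat.Primes, (q : ℕ) = 2 := ⟨⟨2, Nat.prime_two⟩, rfl⟩
  obtain ⟨q₃, hq₃⟩ : ∃ q : Nat.Primes, (q : ℕ) = 3 := ⟨⟨3, Nat.prime_three⟩, rfl⟩
  rw [← sub_eq_iff_eq_add', primeSum, primeSum, ← h1.tsum_sub h2]
  rw [tsum_eq_sum (s := {q₂, q₃})]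
  · rw [Finset.sum_pair (by rintro rfl; omega)]
    simp only [hq₂, hq₃, dirichletCharacter_two, dirichletCharacter_three]
    norm_num
  · intro p hmem
    have hp : (p : ℕ).Prime := p.2
    rw [Finset.mem_insert, Finset.mem_singleton, not_or] at hmem
    have hu := isUnit_natCast_of_prime hp (fun h => hmem.1 (Subtype.ext (h.trans hq₂.symm)))
      fun h => hmem.2 (Subtype.ext (h.trans hq₃.symm))
    simp [MulChar.one_apply hu]

/-- The trace `ω ^ z + ω ^ (-z)` for a primitive cube root of unity `ω`. -/
def cubicTrace (z : ZMod 3) : ℤ := if z = 0 then 2 else -1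

/-- The representations of `n` by the form `x ^ 2 + 6 * y ^ 2`. -/
noncomputable def formReps (n : ℤ) : Finset (ℤ × ℤ) :=
  (Finset.Icc (-n) n ×ˢ Finset.Icc (-n) n).filter fun v => v.1 ^ 2 + 6 * v.2 ^ 2 = n

/-- The number of representations of `n` by `x ^ 2 + 6 * y ^ 2`, weighted by the cubic
character `x + y √-6 ↦ ω ^ (x * y)` plus its conjugate. -/
noncomputable def cubicCount (n : ℤ) : ℤ :=
  ∑ v ∈ formReps n, cubicTrace ((v.1 : ZMod 3) * (v.2 : ZMod 3))

theorem mem_formReps {n : ℤ} {v : ℤ × ℤ} : v ∈ formReps n ↔ v.1 ^ 2 + 6 * v.2 ^ 2 = n := by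
  simp only [formReps, Finset.mem_filter, Finset.mem_product, Finset.mem_Icc, and_iff_right_iff_imp]
  intro h
  have h1 : |v.1| ≤ v.1 ^ 2 := by rw [← sq_abs]; exact Int.le_self_sq _
  have h2 : |v.2| ≤ v.2 ^ 2 := by rw [← sq_abs]; exact Int.le_self_sq _
  refine ⟨abs_le.1 ?_, abs_le.1 ?_⟩ <;> nlinarith [sq_nonneg v.1, sq_nonneg v.2]

theorem cubicTrace_add_cubicTrace (u v a b : ZMod 3) (hu : u ≠ 0) (ha : a ≠ 0) :
    cubicTrace ((u * a - 6 * v * b) * (u * b + v * a)) +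
      cubicTrace ((u * a + 6 * v * b) * (u * b - v * a)) =
      cubicTrace (u * v) * cubicTrace (a * b) := by
  revert u v a b
  decide

theorem cubicTrace_sq_mul (u a b : ZMod 3) (hu : u ≠ 0) :
    cubicTrace ((u * a) * (u * b)) = cubicTrace (a * b) := by
  revert u a b
  decide

section Hecke

variable {p : ℕ} (hp : p.Prime) (h2 : p ≠ 2) (h3 : p ≠ 3)

include hp h2 h3

theorem int_prime_not_dvd_six : ¬ (p : ℤ) ∣ 6 := by
  intro h
  have h' : p ∣ 2 * 3 := by exact_mod_cast h
  rcases hp.dvd_mul.1 h' with h | h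
  · exact h2 ((Nat.prime_dvd_prime_iff_eq hp Nat.prime_two).1 h)
  · exact h3 ((Nat.prime_dvd_prime_iff_eq hp Nat.prime_three).1 h)

theorem int_prime_not_dvd_two : ¬ (p : ℤ) ∣ 2 := fun h =>
  int_prime_not_dvd_six hp h2 h3 (h.trans (by norm_num))

variable {c : ℤ} (hc : c = 1 ∨ c = 2) {u v : ℤ} (huv : u ^ 2 + 6 * v ^ 2 = c * p)

include hc huv

theorem not_dvd_of_norm_eq : ¬ (p : ℤ) ∣ u ∧ ¬ (p : ℤ) ∣ v := by
  have hpp : Prime (p : ℤ) := Nat.prime_iff_prime_int.1 hp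
  have h6 := int_prime_not_dvd_six hp h2 h3
  have hcd : ¬ (p : ℤ) ∣ c := by
    rcases hc with rfl | rfl
    · exact hpp.not_dvd_one
    · exact int_prime_not_dvd_two hp h2 h3
  have key : ¬ ((p : ℤ) ∣ u ∧ (p : ℤ) ∣ v) := by
    rintro ⟨⟨a, rfl⟩, b, rfl⟩
    apply hcd
    refine ⟨a ^ 2 + 6 * b ^ 2, mul_right_cancel₀ hpp.ne_zero ?_⟩
    linear_combination -huv
  have huv' : (p : ℤ) ∣ u ↔ (p : ℤ) ∣ v := by
    constructor
    · intro h
      have : (p : ℤ) ∣ 6 * v ^ 2 := by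
        rw [show 6 * v ^ 2 = c * p - u ^ 2 by linear_combination huv]
        exact dvd_sub (dvd_mul_left _ _) (dvd_pow h two_ne_zero)
      exact hpp.dvd_of_dvd_pow ((hpp.dvd_or_dvd this).resolve_left h6)
    · intro h
      have : (p : ℤ) ∣ u ^ 2 := by
        rw [show u ^ 2 = c * p - 6 * v ^ 2 by linear_combination huv]
        exact dvd_sub (dvd_mul_left _ _) ((dvd_pow h two_ne_zero).mul_left 6)
      exact hpp.dvd_of_dvd_pow this
  tauto

theorem exists_mul_eq_of_dvd {m x y : ℤ} (hxy : x ^ 2 + 6 * y ^ 2 = c * p * m)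
    (hd : (p : ℤ) ∣ u * y - v * x) :
    ∃ a b : ℤ, a ^ 2 + 6 * b ^ 2 = m ∧ u * a - 6 * v * b = x ∧ u * b + v * a = y := by
  have hpp : Prime (p : ℤ) := Nat.prime_iff_prime_int.1 hp
  obtain ⟨hu, -⟩ := not_dvd_of_norm_eq hp h2 h3 hc huv
  have hd' : (p : ℤ) ∣ u * x + 6 * v * y := by
    have : (p : ℤ) ∣ u * (u * x + 6 * v * y) := by
      rw [show u * (u * x + 6 * v * y) = p * (c * x) + 6 * v * (u * y - v * x) by
        linear_combination x * huv]
      exact dvd_add (dvd_mul_right _ _) (hd.mul_left _)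
    exact (hpp.dvd_or_dvd this).resolve_left hu
  have hq : c * p ∣ u * y - v * x ∧ c * p ∣ u * x + 6 * v * y := by
    rcases hc with rfl | rfl
    · simpa using ⟨hd, hd'⟩
    · have hcop : IsCoprime (2 : ℤ) p := by
        rw [isCoprime_comm]
        exact (hpp.coprime_iff_not_dvd).2 (int_prime_not_dvd_two hp h2 h3)
      have hu2 : (2 : ℤ) ∣ u := Int.prime_two.dvd_of_dvd_pow (n := 2)
        ⟨p - 3 * v ^ 2, by linear_combination huv⟩
      have hx2 : (2 : ℤ) ∣ x := Int.prime_two.dvd_of_dvd_pow (n := 2)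
        ⟨p * m - 3 * y ^ 2, by linear_combination hxy⟩
      exact ⟨hcop.mul_dvd (dvd_sub (hu2.mul_right _) (hx2.mul_left _)) hd,
        hcop.mul_dvd (dvd_add (hu2.mul_right _) (⟨3 * v * y, by ring⟩)) hd'⟩
  obtain ⟨⟨b, hb⟩, a, ha⟩ := hq
  have hc0 : c ≠ 0 := by rcases hc with rfl | rfl <;> norm_num
  have hq0 : c * p ≠ 0 := mul_ne_zero hc0 hpp.ne_zero
  refine ⟨a, b, ?_, ?_, ?_⟩
  · refine mul_left_cancel₀ (mul_ne_zero hq0 hq0) ?_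
    linear_combination (-(u * x + 6 * v * y) - c * p * a) * ha +
      6 * (-(u * y - v * x) - c * p * b) * hb + (x ^ 2 + 6 * y ^ 2) * huv + c * p * hxy
  · refine mul_left_cancel₀ hq0 ?_
    linear_combination -u * ha + 6 * v * hb + x * huv
  · refine mul_left_cancel₀ hq0 ?_
    linear_combination -u * hb - v * ha + y * huv

theorem sum_filter_dvd {m : ℤ} :
    ∑ w ∈ (formReps (c * p * m)).filter (fun w => (p : ℤ) ∣ u * w.2 - v * w.1),
      cubicTrace ((w.1 : ZMod 3) * (w.2 : ZMod 3)) =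
    ∑ w ∈ formReps m, cubicTrace (((u : ZMod 3) * w.1 - 6 * v * w.2) * (u * w.2 + v * w.1)) := by
  have hc0 : c ≠ 0 := by rcases hc with rfl | rfl <;> norm_num
  have hq0 : c * p ≠ 0 := mul_ne_zero hc0 (by exact_mod_cast hp.ne_zero)
  symm
  refine Finset.sum_nbij (fun w => (u * w.1 - 6 * v * w.2, u * w.2 + v * w.1)) ?_ ?_ ?_ ?_
  · rintro ⟨a, b⟩ hw
    rw [mem_formReps] at hw
    rw [Finset.mem_filter, mem_formReps]
    simp only at hw ⊢
    refine ⟨by linear_combination (a ^ 2 + 6 * b ^ 2) * huv + c * p * hw, c * b, ?_⟩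
    linear_combination b * huv
  · rintro ⟨a, b⟩ - ⟨a', b'⟩ - h
    simp only [Prod.mk.injEq] at h ⊢
    constructor
    · refine mul_left_cancel₀ hq0 ?_
      linear_combination u * h.1 + 6 * v * h.2 - (a - a') * huv
    · refine mul_left_cancel₀ hq0 ?_
      linear_combination u * h.2 - v * h.1 - (b - b') * huv
  · rintro ⟨x, y⟩ hw
    rw [Finset.mem_coe, Finset.mem_filter, mem_formReps] at hw
    obtain ⟨a, b, hab, h1, h2'⟩ := exists_mul_eq_of_dvd hp h2 h3 hc huv hw.1 hw.2
    exact ⟨(a, b), mem_formReps.2 hab, Prod.ext h1 h2'⟩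
  · rintro ⟨a, b⟩ -
    push_cast
    rfl

theorem sum_filter_dvd_and_dvd {m : ℤ} :
    ∑ w ∈ (formReps (c * p * m)).filter
        (fun w => (p : ℤ) ∣ u * w.2 - v * w.1 ∧ (p : ℤ) ∣ u * w.2 + v * w.1),
      cubicTrace ((w.1 : ZMod 3) * (w.2 : ZMod 3)) =
    if (p : ℤ) ∣ m then cubicCount (c * (m / p)) else 0 := by
  have hpp : Prime (p : ℤ) := Nat.prime_iff_prime_int.1 hp
  obtain ⟨hu, hv⟩ := not_dvd_of_norm_eq hp h2 h3 hc huv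
  have hp2 := int_prime_not_dvd_two hp h2 h3
  have hcd : ¬ (p : ℤ) ∣ c := by
    rcases hc with rfl | rfl
    · exact hpp.not_dvd_one
    · exact hp2
  have hboth : ∀ w ∈ (formReps (c * p * m)).filter
        (fun w => (p : ℤ) ∣ u * w.2 - v * w.1 ∧ (p : ℤ) ∣ u * w.2 + v * w.1),
      ∃ a b : ℤ, w = (p * a, p * b) ∧ p * (a ^ 2 + 6 * b ^ 2) = c * m := by
    rintro ⟨x, y⟩ hw
    rw [Finset.mem_filter, mem_formReps] at hw
    obtain ⟨hxy, hd1, hd2⟩ := hw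
    simp only at hxy hd1 hd2
    have hy : (p : ℤ) ∣ y := by
      have : (p : ℤ) ∣ 2 * (u * y) := by
        rw [show 2 * (u * y) = (u * y - v * x) + (u * y + v * x) by ring]
        exact dvd_add hd1 hd2
      exact (hpp.dvd_or_dvd ((hpp.dvd_or_dvd this).resolve_left hp2)).resolve_left hu
    have hx : (p : ℤ) ∣ x := by
      have : (p : ℤ) ∣ 2 * (v * x) := by
        rw [show 2 * (v * x) = (u * y + v * x) - (u * y - v * x) by ring]
        exact dvd_sub hd2 hd1
      exact (hpp.dvd_or_dvd ((hpp.dvd_or_dvd this).resolve_left hp2)).resolve_left hv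
    obtain ⟨a, rfl⟩ := hx
    obtain ⟨b, rfl⟩ := hy
    refine ⟨a, b, rfl, mul_left_cancel₀ hpp.ne_zero ?_⟩
    linear_combination hxy
  split_ifs with hd
  · obtain ⟨k, rfl⟩ := hd
    rw [Int.mul_ediv_cancel_left _ hpp.ne_zero, cubicCount]
    symm
    refine Finset.sum_nbij (fun w => (p * w.1, p * w.2)) ?_ ?_ ?_ ?_
    · rintro ⟨a, b⟩ hw
      rw [mem_formReps] at hw
      rw [Finset.mem_filter, mem_formReps]
      simp only at hw ⊢
      exact ⟨by linear_combination p ^ 2 * hw, ⟨u * b - v * a, by ring⟩, ⟨u * b + v * a, by ring⟩⟩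
    · rintro ⟨a, b⟩ - ⟨a', b'⟩ - h
      simp only [Prod.mk.injEq] at h ⊢
      exact ⟨mul_left_cancel₀ hpp.ne_zero h.1, mul_left_cancel₀ hpp.ne_zero h.2⟩
    · intro w hw
      obtain ⟨a, b, rfl, hab⟩ := hboth w hw
      refine ⟨(a, b), mem_formReps.2 (mul_left_cancel₀ hpp.ne_zero ?_), rfl⟩
      linear_combination hab
    · rintro ⟨a, b⟩ -
      have : ((p : ℤ) : ZMod 3) ≠ 0 := by
        intro h
        rw [ZMod.intCast_zmod_eq_zero_iff_dvd] at h
        exact h3 ((Nat.prime_dvd_prime_iff_eq Nat.prime_three hp).1 (by exact_mod_cast h)).symm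
      simp only [Int.cast_mul]
      rw [cubicTrace_sq_mul _ _ _ this]
  · refine Finset.sum_eq_zero fun w hw => absurd ?_ hd
    obtain ⟨a, b, -, hab⟩ := hboth w hw
    exact (hpp.dvd_or_dvd ⟨_, hab.symm⟩).resolve_left hcd

theorem cubicCount_mul {m : ℤ} (hm : ¬ (3 : ℤ) ∣ m) :
    cubicCount (c * p * m) = cubicTrace ((u : ZMod 3) * v) * cubicCount m -
      if (p : ℤ) ∣ m then cubicCount (c * (m / p)) else 0 := by
  have hpp : Prime (p : ℤ) := Nat.prime_iff_prime_int.1 hp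
  have huv' : u ^ 2 + 6 * (-v) ^ 2 = c * p := by linear_combination huv
  have hsum := sum_filter_dvd hp h2 h3 hc huv (m := m)
  have hsum' := sum_filter_dvd hp h2 h3 hc huv' (m := m)
  have hboth := sum_filter_dvd_and_dvd hp h2 h3 hc huv (m := m)
  have hsub : ∀ w : ℤ × ℤ, u * w.2 - -v * w.1 = u * w.2 + v * w.1 := fun w => by ring
  simp only [hsub] at hsum'
  have hunion : (formReps (c * p * m)).filter (fun w => (p : ℤ) ∣ u * w.2 - v * w.1) ∪
      (formReps (c * p * m)).filter (fun w => (p : ℤ) ∣ u * w.2 + v * w.1) =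
      formReps (c * p * m) := by
    rw [← Finset.filter_or, Finset.filter_eq_self]
    rintro ⟨x, y⟩ hw
    rw [mem_formReps] at hw
    simp only at hw ⊢
    refine hpp.dvd_or_dvd ⟨c * (y ^ 2 - v ^ 2 * m), ?_⟩
    linear_combination y ^ 2 * huv - v ^ 2 * hw
  have h := Finset.sum_union_inter
    (s₁ := (formReps (c * p * m)).filter (fun w => (p : ℤ) ∣ u * w.2 - v * w.1))
    (s₂ := (formReps (c * p * m)).filter (fun w => (p : ℤ) ∣ u * w.2 + v * w.1))
    (f := fun w => cubicTrace ((w.1 : ZMod 3) * (w.2 : ZMod 3)))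
  rw [hunion, ← Finset.filter_and, hboth, hsum, hsum'] at h
  rw [cubicCount, eq_sub_iff_add_eq, h, cubicCount, Finset.mul_sum, ← Finset.sum_add_distrib]
  refine Finset.sum_congr rfl ?_
  rintro ⟨a, b⟩ hw
  rw [mem_formReps] at hw
  have ha : (a : ZMod 3) ≠ 0 := by
    intro h
    rw [ZMod.intCast_zmod_eq_zero_iff_dvd] at h
    apply hm
    rw [← hw]
    exact dvd_add (dvd_pow h two_ne_zero) ⟨2 * b ^ 2, by push_cast; ring⟩
  have hu : (u : ZMod 3) ≠ 0 := by
    intro h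
    rw [ZMod.intCast_zmod_eq_zero_iff_dvd] at h
    have h3' : (3 : ℤ) ∣ c * p := by
      rw [← huv]
      exact dvd_add (dvd_pow h two_ne_zero) ⟨2 * v ^ 2, by ring⟩
    rcases Int.prime_three.dvd_or_dvd h3' with h | h
    · rcases hc with rfl | rfl <;> revert h <;> decide
    · exact h3 ((Nat.prime_dvd_prime_iff_eq Nat.prime_three hp).1 (by exact_mod_cast h)).symm
  rw [← cubicTrace_add_cubicTrace _ _ _ _ hu ha]
  push_cast
  congr 2
  ring

end Hecke

theorem cubicCount_four_mul (m : ℤ) : cubicCount (4 * m) = cubicCount m := by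
  rw [cubicCount, cubicCount]
  symm
  refine Finset.sum_nbij (fun w => (2 * w.1, 2 * w.2)) ?_ ?_ ?_ ?_
  · rintro ⟨a, b⟩ hw
    rw [mem_formReps] at hw ⊢
    simp only at hw ⊢
    linear_combination 4 * hw
  · rintro ⟨a, b⟩ - ⟨a', b'⟩ - h
    simpa using h
  · rintro ⟨x, y⟩ hw
    rw [Finset.mem_coe, mem_formReps] at hw
    simp only at hw
    obtain ⟨a, rfl⟩ : (2 : ℤ) ∣ x := Int.prime_two.dvd_of_dvd_pow (n := 2)
      ⟨2 * m - 3 * y ^ 2, by linear_combination hw⟩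
    obtain ⟨b, rfl⟩ : (2 : ℤ) ∣ y := by
      have : (2 : ℤ) ∣ 3 * y ^ 2 := ⟨m - a ^ 2, by linarith⟩
      exact Int.prime_two.dvd_of_dvd_pow
        ((Int.prime_two.dvd_or_dvd this).resolve_left (by decide))
    exact ⟨(a, b), mem_formReps.2 (by linarith), rfl⟩
  · rintro ⟨a, b⟩ -
    simp only [Int.cast_mul]
    rw [cubicTrace_sq_mul _ _ _ (by decide)]

/-- **Thue's lemma**. -/
theorem exists_sq_lt_and_intCast_eq_mul {p : ℕ} (hp : p.Prime) (z : ZMod p) :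
    ∃ x y : ℤ, (x ≠ 0 ∨ y ≠ 0) ∧ x ^ 2 < p ∧ y ^ 2 < p ∧ (x : ZMod p) = z * y := by
  have : Fact p.Prime := ⟨hp⟩
  set m := Nat.sqrt p with hm
  have hmsq : (m : ℤ) ^ 2 < p := by
    have h1 : m ^ 2 ≤ p := Nat.sqrt_le' p
    have h2 : m ^ 2 ≠ p := by
      intro h
      exact hp.prime.irreducible.not_isSquare ⟨m, by rw [← h, sq]⟩
    exact_mod_cast lt_of_le_of_ne h1 h2
  have hcard : Fintype.card (ZMod p) < Fintype.card (Fin (m + 1) × Fin (m + 1)) := by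
    rw [ZMod.card, Fintype.card_prod, Fintype.card_fin]
    exact Nat.lt_succ_sqrt p
  obtain ⟨⟨i, j⟩, ⟨i', j'⟩, hne, heq⟩ := Fintype.exists_ne_map_eq_of_card_lt
    (fun v : Fin (m + 1) × Fin (m + 1) => ((v.1 : ℕ) : ZMod p) - z * ((v.2 : ℕ) : ZMod p)) hcard
  have hbd : ∀ a b : Fin (m + 1), (((a : ℕ) : ℤ) - ((b : ℕ) : ℤ)) ^ 2 < p := by
    intro a b
    refine lt_of_le_of_lt (sq_le_sq' ?_ ?_) hmsq <;> omega
  refine ⟨((i : ℕ) : ℤ) - ((i' : ℕ) : ℤ), ((j : ℕ) : ℤ) - ((j' : ℕ) : ℤ), ?_, hbd _ _, hbd _ _, ?_⟩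
  · by_contra! h
    apply hne
    ext <;> simp only <;> omega
  · simp only at heq
    push_cast
    linear_combination heq

/-- If `-6` is a square modulo `p`, then `p` or `2 * p` is of the form `x ^ 2 + 6 * y ^ 2`. -/
theorem exists_norm_eq_of_isSquare {p : ℕ} (hp : p.Prime) {z : ZMod p} (hz : z ^ 2 = -6) :
    ∃ c u v : ℤ, (c = 1 ∨ c = 2) ∧ u ^ 2 + 6 * v ^ 2 = c * p := by
  obtain ⟨x, y, hne, hx, hy, hxy⟩ := exists_sq_lt_and_intCast_eq_mul hp z
  have hdvd : (p : ℤ) ∣ x ^ 2 + 6 * y ^ 2 := by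
    rw [← ZMod.intCast_zmod_eq_zero_iff_dvd]
    push_cast
    rw [hxy]
    linear_combination (y : ZMod p) ^ 2 * hz
  obtain ⟨k, hk⟩ := hdvd
  have hp0 : (0 : ℤ) < p := by exact_mod_cast hp.pos
  have hpos : 0 < x ^ 2 + 6 * y ^ 2 := by
    rcases hne with h | h
    · have := pow_pos (abs_pos.2 h) 2
      rw [sq_abs] at this
      nlinarith [sq_nonneg y]
    · have := pow_pos (abs_pos.2 h) 2
      rw [sq_abs] at this
      nlinarith [sq_nonneg x]
  have hk0 : 0 < k := by
    rw [hk] at hpos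
    exact pos_of_mul_pos_right hpos hp0.le
  have hk7 : k < 7 := by nlinarith
  have even_of : ∀ a b : ℤ, a ^ 2 = 2 * b → ∃ t, a = 2 * t := fun a b h =>
    Int.prime_two.dvd_of_dvd_pow ⟨b, h⟩
  have three_of : ∀ a b : ℤ, a ^ 2 = 3 * b → ∃ t, a = 3 * t := fun a b h =>
    Int.prime_three.dvd_of_dvd_pow ⟨b, h⟩
  interval_cases k
  · exact ⟨1, x, y, Or.inl rfl, by linarith⟩
  · exact ⟨2, x, y, Or.inr rfl, by linarith⟩
  · obtain ⟨t, rfl⟩ := three_of x (p - 2 * y ^ 2) (by linarith)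
    exact ⟨2, 2 * y, t, Or.inr rfl, by linarith⟩
  · obtain ⟨t, rfl⟩ := even_of x (2 * p - 3 * y ^ 2) (by linarith)
    obtain ⟨w, rfl⟩ := even_of y (p - t ^ 2 - y ^ 2) (by linarith)
    exact ⟨1, t, w, Or.inl rfl, by linarith⟩
  · have h5 : (5 : ℤ) ∣ (x - 2 * y) * (x + 2 * y) := ⟨p - 2 * y ^ 2, by linear_combination hk⟩
    have hp5 : Prime (5 : ℤ) := by norm_num
    rcases hp5.dvd_or_dvd h5 with ⟨t, ht⟩ | ⟨t, ht⟩
    · obtain rfl : x = 2 * y + 5 * t := by linarith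
      exact ⟨2, 2 * y + 2 * t, -t, Or.inr rfl, by linarith⟩
    · obtain rfl : x = -2 * y + 5 * t := by linarith
      exact ⟨2, -2 * y + 2 * t, t, Or.inr rfl, by linarith⟩
  · obtain ⟨t, rfl⟩ := even_of x (3 * p - 3 * y ^ 2) (by linarith)
    obtain ⟨w, rfl⟩ := three_of t (2 * p - 2 * y ^ 2 - t ^ 2) (by linarith)
    exact ⟨1, y, w, Or.inl rfl, by linarith⟩

theorem cubicCount_mul_of_forall_ne {p : ℕ} (hp : p.Prime)
    (hno : ∀ c u v : ℤ, c = 1 ∨ c = 2 → u ^ 2 + 6 * v ^ 2 ≠ c * p) (h3 : p ≠ 3) (m : ℤ) :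
    cubicCount (p * m) = if (p : ℤ) ∣ m then cubicCount (m / p) else 0 := by
  have : Fact p.Prime := ⟨hp⟩
  have hpp : Prime (p : ℤ) := Nat.prime_iff_prime_int.1 hp
  have hboth : ∀ w ∈ formReps (p * m),
      ∃ a b : ℤ, w = (p * a, p * b) ∧ p * (a ^ 2 + 6 * b ^ 2) = m := by
    rintro ⟨x, y⟩ hw
    rw [mem_formReps] at hw
    simp only at hw
    have hy : (p : ℤ) ∣ y := by
      by_contra hy
      have hy0 : (y : ZMod p) ≠ 0 := by rwa [Ne, ZMod.intCast_zmod_eq_zero_iff_dvd]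
      have hz : ((x : ZMod p) / y) ^ 2 = -6 := by
        have := congrArg (Int.cast : ℤ → ZMod p) hw
        push_cast at this
        rw [ZMod.natCast_self, zero_mul] at this
        field_simp
        linear_combination this
      obtain ⟨c, u, v, hc, huv⟩ := exists_norm_eq_of_isSquare hp hz
      exact hno c u v hc huv
    have hx : (p : ℤ) ∣ x := by
      have : (p : ℤ) ∣ x ^ 2 := by
        rw [show x ^ 2 = p * m - 6 * y ^ 2 by linear_combination hw]
        exact dvd_sub (dvd_mul_right _ _) ((dvd_pow hy two_ne_zero).mul_left 6)
      exact hpp.dvd_of_dvd_pow this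
    obtain ⟨a, rfl⟩ := hx
    obtain ⟨b, rfl⟩ := hy
    refine ⟨a, b, rfl, mul_left_cancel₀ hpp.ne_zero ?_⟩
    linear_combination hw
  rw [cubicCount]
  split_ifs with hd
  · obtain ⟨k, rfl⟩ := hd
    rw [Int.mul_ediv_cancel_left _ hpp.ne_zero, cubicCount]
    symm
    refine Finset.sum_nbij (fun w => (p * w.1, p * w.2)) ?_ ?_ ?_ ?_
    · rintro ⟨a, b⟩ hw
      rw [mem_formReps] at hw ⊢
      simp only at hw ⊢
      linear_combination p ^ 2 * hw
    · rintro ⟨a, b⟩ - ⟨a', b'⟩ - h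
      simp only [Prod.mk.injEq] at h ⊢
      exact ⟨mul_left_cancel₀ hpp.ne_zero h.1, mul_left_cancel₀ hpp.ne_zero h.2⟩
    · intro w hw
      obtain ⟨a, b, rfl, hab⟩ := hboth w hw
      exact ⟨(a, b), mem_formReps.2 (mul_left_cancel₀ hpp.ne_zero hab), rfl⟩
    · rintro ⟨a, b⟩ -
      have : ((p : ℤ) : ZMod 3) ≠ 0 := by
        intro h
        rw [ZMod.intCast_zmod_eq_zero_iff_dvd] at h
        exact h3 ((Nat.prime_dvd_prime_iff_eq Nat.prime_three hp).1 (by exact_mod_cast h)).symm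
      simp only [Int.cast_mul]
      rw [cubicTrace_sq_mul _ _ _ this]
  · refine Finset.sum_eq_zero fun w hw => absurd ?_ hd
    obtain ⟨a, b, -, hab⟩ := hboth w hw
    exact ⟨_, hab.symm⟩

/-- The coefficients of the `L`-function of the cubic class group character of the order of
discriminant `-216`. -/
noncomputable def cubicCoeff (n : ℕ) : ℝ := ((cubicCount n + cubicCount (2 * n) : ℤ) : ℝ) / 4

theorem cubicCoeff_one : cubicCoeff 1 = 1 := by
  have h1 : cubicCount 1 = 4 := by decide
  have h2 : cubicCount 2 = 0 := by decide
  simp [cubicCoeff, h1, h2]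

theorem natCast_dvd_two_mul_iff {p : ℕ} (hp : p.Prime) (h2 : p ≠ 2) (n : ℕ) :
    (p : ℤ) ∣ 2 * (n : ℤ) ↔ p ∣ n := by
  rw [show (2 : ℤ) * n = ((2 * n : ℕ) : ℤ) by push_cast; ring, Int.natCast_dvd_natCast]
  refine ⟨fun h => (hp.dvd_mul.1 h).resolve_left fun h' => h2 ?_, fun h => h.mul_left 2⟩
  exact (Nat.prime_dvd_prime_iff_eq hp Nat.prime_two).1 h'

theorem cubicCoeff_prime_mul_of_norm_eq {p : ℕ} (hp : p.Prime) (h2 : p ≠ 2) (h3 : p ≠ 3)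
    {c u v : ℤ} (hc : c = 1 ∨ c = 2) (huv : u ^ 2 + 6 * v ^ 2 = c * p) {n : ℕ} (hn : ¬ 3 ∣ n) :
    cubicCoeff (p * n) = cubicTrace ((u : ZMod 3) * v) * cubicCoeff n -
      if p ∣ n then cubicCoeff (n / p) else 0 := by
  have hn1 : ¬ (3 : ℤ) ∣ n := by exact_mod_cast hn
  have hn2 : ¬ (3 : ℤ) ∣ 2 * n := by omega
  have k1 := cubicCount_mul hp h2 h3 hc huv hn1
  have k2 := cubicCount_mul hp h2 h3 hc huv hn2
  have hp0 : (p : ℤ) ≠ 0 := by exact_mod_cast hp.ne_zero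
  simp only [natCast_dvd_two_mul_iff hp h2, Int.natCast_dvd_natCast] at k1 k2
  have key : cubicCount (p * n) + cubicCount (2 * (p * n)) =
      cubicTrace ((u : ZMod 3) * v) * (cubicCount n + cubicCount (2 * n)) -
      if p ∣ n then cubicCount ((n / p : ℕ) : ℤ) + cubicCount (2 * ((n / p : ℕ) : ℤ)) else 0 := by
    split_ifs at k1 k2 ⊢ with hd
    · obtain ⟨k, rfl⟩ := hd
      rw [Nat.mul_div_cancel_left _ hp.pos]
      push_cast at k1 k2 ⊢
      rw [Int.mul_ediv_cancel_left _ hp0] at k1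
      rw [mul_left_comm (2 : ℤ) (p : ℤ) (k : ℤ), Int.mul_ediv_cancel_left _ hp0] at k2
      rw [mul_left_comm (2 : ℤ) (p : ℤ) (k : ℤ)]
      rcases hc with rfl | rfl
      · simp only [one_mul] at k1 k2
        rw [show (2 : ℤ) * (p * (p * k)) = p * (p * (2 * k)) by ring]
        linear_combination k1 + k2
      · rw [show (2 : ℤ) * p * (p * (2 * k)) = 4 * (p * (p * k)) by ring,
          cubicCount_four_mul, show (2 : ℤ) * (2 * k) = 4 * k by ring, cubicCount_four_mul] at k2
        rw [show (2 : ℤ) * (p * (p * k)) = 2 * p * (p * k) by ring]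
        linear_combination k1 + k2
    · rcases hc with rfl | rfl
      · simp only [one_mul] at k1 k2
        rw [show (2 : ℤ) * (p * n) = p * (2 * n) by ring]
        linear_combination k1 + k2
      · rw [show (2 : ℤ) * p * (2 * n) = 4 * (p * n) by ring, cubicCount_four_mul] at k2
        rw [show (2 : ℤ) * (p * n) = 2 * p * n by ring]
        linear_combination k1 + k2
  have key' := congrArg (Int.cast : ℤ → ℝ) key
  simp only [cubicCoeff]
  push_cast at key' ⊢
  rw [key']
  split_ifs <;> ring

theorem cubicCoeff_prime_mul_of_forall_ne {p : ℕ} (hp : p.Prime) (h2 : p ≠ 2) (h3 : p ≠ 3)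
    (hno : ∀ c u v : ℤ, c = 1 ∨ c = 2 → u ^ 2 + 6 * v ^ 2 ≠ c * p) (n : ℕ) :
    cubicCoeff (p * n) = if p ∣ n then cubicCoeff (n / p) else 0 := by
  have k1 := cubicCount_mul_of_forall_ne hp hno h3 n
  have k2 := cubicCount_mul_of_forall_ne hp hno h3 (2 * n)
  have hp0 : (p : ℤ) ≠ 0 := by exact_mod_cast hp.ne_zero
  simp only [natCast_dvd_two_mul_iff hp h2, Int.natCast_dvd_natCast] at k1 k2
  simp only [cubicCoeff]
  split_ifs at k1 k2 ⊢ with hd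
  · obtain ⟨k, rfl⟩ := hd
    rw [Nat.mul_div_cancel_left _ hp.pos]
    push_cast at k1 k2 ⊢
    rw [Int.mul_ediv_cancel_left _ hp0] at k1
    rw [show (2 : ℤ) * (p * k) = p * (2 * k) by ring, Int.mul_ediv_cancel_left _ hp0] at k2
    rw [k1, show (2 : ℤ) * (p * (p * k)) = p * (p * (2 * k)) by ring, k2]
  · push_cast
    rw [k1, show (2 : ℤ) * (p * n) = p * (2 * n) by ring, k2]
    simp

theorem cubicCoeff_prime_of_norm_eq {p : ℕ} (hp : p.Prime) (h2 : p ≠ 2) (h3 : p ≠ 3)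
    {c u v : ℤ} (hc : c = 1 ∨ c = 2) (huv : u ^ 2 + 6 * v ^ 2 = c * p) :
    cubicCoeff p = cubicTrace ((u : ZMod 3) * v) := by
  have := cubicCoeff_prime_mul_of_norm_eq hp h2 h3 hc huv (n := 1) (by norm_num)
  rwa [if_neg hp.prime.not_dvd_one, mul_one, cubicCoeff_one, mul_one, sub_zero] at this

theorem cubicCoeff_prime_of_forall_ne {p : ℕ} (hp : p.Prime) (h2 : p ≠ 2) (h3 : p ≠ 3)
    (hno : ∀ c u v : ℤ, c = 1 ∨ c = 2 → u ^ 2 + 6 * v ^ 2 ≠ c * p) : cubicCoeff p = 0 := by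
  have := cubicCoeff_prime_mul_of_forall_ne hp h2 h3 hno 1
  rwa [if_neg hp.prime.not_dvd_one, mul_one] at this

theorem abs_cubicCoeff_prime_le {p : ℕ} (hp : p.Prime) (h2 : p ≠ 2) (h3 : p ≠ 3) :
    |cubicCoeff p| ≤ 2 := by
  by_cases h : ∃ c u v : ℤ, (c = 1 ∨ c = 2) ∧ u ^ 2 + 6 * v ^ 2 = c * p
  · obtain ⟨c, u, v, hc, huv⟩ := h
    rw [cubicCoeff_prime_of_norm_eq hp h2 h3 hc huv, cubicTrace]
    split_ifs <;> norm_num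
  · push Not at h
    rw [cubicCoeff_prime_of_forall_ne hp h2 h3 h]
    norm_num

theorem dirichletCharacter_ofNat_two (ψ : DirichletCharacter ℝ 24) : ψ 2 = 0 := by
  simpa using dirichletCharacter_two ψ

theorem dirichletCharacter_ofNat_three (ψ : DirichletCharacter ℝ 24) : ψ 3 = 0 := by
  simpa using dirichletCharacter_three ψ

open Classical in
/-- `1` if `p` splits in `ℚ(√-6)` and `-1` otherwise, for primes `p ≠ 2, 3`. -/
noncomputable def splitSign (p : ℕ) : ℝ :=
  if ∃ c u v : ℤ, (c = 1 ∨ c = 2) ∧ u ^ 2 + 6 * v ^ 2 = c * p then 1 else -1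

theorem hasEulerRecursion_twisted_cubicCoeff (ψ : DirichletCharacter ℝ 24) :
    HasEulerRecursion (fun n => ψ n * cubicCoeff n) (fun p => ψ p ^ 2 * splitSign p) where
  map_zero := by simp [MulChar.map_nonunit ψ (show ¬ IsUnit (0 : ZMod 24) by decide)]
  map_one := by simp [cubicCoeff_one]
  map_prime_mul p hp n := by
    rcases eq_or_ne p 2 with rfl | h2
    · simp [dirichletCharacter_ofNat_two]
    rcases eq_or_ne p 3 with rfl | h3
    · simp [dirichletCharacter_ofNat_three]
    by_cases hn : 3 ∣ n
    · have hz : ∀ m : ℕ, 3 ∣ m → ψ m = 0 := by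
        rintro m ⟨l, rfl⟩
        rw [Nat.cast_mul, map_mul, dirichletCharacter_three, zero_mul]
      rw [hz _ (hn.mul_left p), hz _ hn]
      split_ifs with hd
      · obtain ⟨m, rfl⟩ := hd
        have : 3 ∣ m := (Nat.Coprime.dvd_mul_left
          ((Nat.coprime_primes Nat.prime_three hp).2 h3.symm)).1 hn
        rw [Nat.mul_div_cancel_left _ hp.pos, hz _ this]
        simp
      · simp
    · by_cases h : ∃ c u v : ℤ, (c = 1 ∨ c = 2) ∧ u ^ 2 + 6 * v ^ 2 = c * p
      · rw [splitSign, if_pos h]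
        obtain ⟨c, u, v, hc, huv⟩ := h
        rw [cubicCoeff_prime_mul_of_norm_eq hp h2 h3 hc huv hn,
          cubicCoeff_prime_of_norm_eq hp h2 h3 hc huv]
        split_ifs with hd
        · obtain ⟨m, rfl⟩ := hd
          rw [Nat.mul_div_cancel_left _ hp.pos]
          push_cast
          simp only [map_mul]
          ring
        · push_cast
          simp only [map_mul]
          ring
      · rw [splitSign, if_neg h]
        push Not at h
        rw [cubicCoeff_prime_mul_of_forall_ne hp h2 h3 h, cubicCoeff_prime_of_forall_ne hp h2 h3 h]
        split_ifs with hd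
        · obtain ⟨m, rfl⟩ := hd
          rw [Nat.mul_div_cancel_left _ hp.pos]
          push_cast
          simp only [map_mul]
          ring
        · simp

theorem abs_splitSign (p : ℕ) : |splitSign p| = 1 := by
  rw [splitSign]
  split_ifs <;> norm_num

theorem abs_twisted_cubicCoeff_prime_le (ψ : DirichletCharacter ℝ 24) {p : ℕ} (hp : p.Prime) :
    |ψ p * cubicCoeff p| ≤ 2 := by
  rcases eq_or_ne p 2 with rfl | h2
  · simp [dirichletCharacter_ofNat_two]
  rcases eq_or_ne p 3 with rfl | h3
  · simp [dirichletCharacter_ofNat_three]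
  rw [abs_mul]
  have h1 := abs_dirichletCharacter_le_one ψ p
  have h4 := abs_cubicCoeff_prime_le hp h2 h3
  nlinarith [abs_nonneg (ψ p), abs_nonneg (cubicCoeff p)]


theorem summable_norm_int_prod_rpow {k : ℝ} (hk : 2 < k) :
    Summable fun v : ℤ × ℤ => ‖v‖ ^ (-k) := by
  rw [← (finTwoArrowEquiv ℤ).summable_iff]
  refine (EisensteinSeries.summable_one_div_norm_rpow hk).congr fun v => ?_
  congr 1
  simp [EisensteinSeries.norm_eq_max_natAbs, Prod.norm_def, Int.norm_eq_abs]

section DiagonalForm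

variable {A B : ℝ} (hA : 1 ≤ A) (hB : 1 ≤ B)

include hA hB

theorem sq_norm_le_diagonalForm (v : ℤ × ℤ) : ‖v‖ ^ 2 ≤ A * v.1 ^ 2 + B * v.2 ^ 2 := by
  rw [Prod.norm_def, Int.norm_eq_abs, Int.norm_eq_abs]
  rcases max_cases |(v.1 : ℝ)| |(v.2 : ℝ)| with ⟨h, -⟩ | ⟨h, -⟩ <;> rw [h, sq_abs] <;>
    nlinarith [sq_nonneg (v.1 : ℝ), sq_nonneg (v.2 : ℝ)]

theorem norm_cpow_diagonalForm_sub_le {s : ℂ} (hs : 3 / 4 < s.re) (hs' : ‖s‖ < 3) {a b d : ℤ}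
    (ha : a ≠ 0) (hd : |d| ≤ 8) :
    ‖((A * a ^ 2 + B * b ^ 2 : ℝ) : ℂ) ^ (-s) -
      ((A * a ^ 2 + B * (b + d : ℤ) ^ 2 : ℝ) : ℂ) ^ (-s)‖ ≤
      48 * B * 81 ^ (5 / 4 : ℝ) * ‖(a, b)‖ ^ (-(5 / 2) : ℝ) := by
  have ha1 : (1 : ℝ) ≤ (a : ℝ) ^ 2 := by
    have : (1 : ℤ) ≤ a ^ 2 := Int.add_one_le_iff.2 (sq_pos_iff.2 ha)
    exact_mod_cast this
  set Q : ℝ → ℝ := fun t => A * a ^ 2 + B * t ^ 2 with hQ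
  have hQa : ∀ t, (a : ℝ) ^ 2 + t ^ 2 ≤ Q t := fun t => by
    simp only [hQ]
    nlinarith [sq_nonneg t]
  have hQ0 : ∀ t, 0 < Q t := fun t => by nlinarith [hQa t, sq_nonneg t]
  have hderiv : ∀ t : ℝ, HasDerivAt (fun t : ℝ => (Q t : ℂ) ^ (-s))
      (-s * (Q t : ℂ) ^ (-s - 1) * ((B * (2 * t) : ℝ) : ℂ)) t := by
    intro t
    have h1 : HasDerivAt (fun t : ℝ => (Q t : ℂ)) ((B * (2 * t) : ℝ) : ℂ) t := by
      refine HasDerivAt.ofReal_comp ?_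
      have := ((hasDerivAt_pow 2 t).const_mul B).const_add (A * a ^ 2)
      simpa [hQ] using this
    have h2 := (hasDerivAt_id (Q t : ℂ)).cpow_const (c := -s) (Or.inl (by exact_mod_cast hQ0 t))
    rw [mul_one] at h2
    exact h2.comp t h1
  have hnorm0 : 0 < ‖(a, b)‖ := norm_pos_iff.2 (by simp [ha])
  have hbound : ∀ t ∈ Metric.closedBall (b : ℝ) 8,
      ‖-s * (Q t : ℂ) ^ (-s - 1) * ((B * (2 * t) : ℝ) : ℂ)‖ ≤
        6 * B * 81 ^ (5 / 4 : ℝ) * ‖(a, b)‖ ^ (-(5 / 2) : ℝ) := by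
    intro t ht
    rw [Metric.mem_closedBall, Real.dist_eq, abs_le] at ht
    have hle : ‖(a, b)‖ ^ 2 / 81 ≤ Q t := by
      have hm : (b : ℝ) ^ 2 ≤ 81 * ((a : ℝ) ^ 2 + t ^ 2) := by
        nlinarith [sq_nonneg (8 * t - (b - t)), sq_nonneg (b - t)]
      rw [Prod.norm_def, Int.norm_eq_abs, Int.norm_eq_abs]
      rcases max_cases |(a : ℝ)| |(b : ℝ)| with ⟨h, -⟩ | ⟨h, -⟩ <;> rw [h, sq_abs] <;>
        nlinarith [hQa t, sq_nonneg t]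
    have hQ1 : 1 ≤ Q t := by nlinarith [hQa t, sq_nonneg t]
    rw [norm_mul, norm_mul, norm_neg, Complex.norm_cpow_eq_rpow_re_of_pos (hQ0 t),
      Complex.norm_real, Real.norm_eq_abs, abs_mul, abs_mul, abs_two,
      abs_of_nonneg (show 0 ≤ B by linarith)]
    have ht' : |t| ≤ Q t ^ (1 / 2 : ℝ) := by
      rw [← Real.sqrt_eq_rpow]
      refine Real.abs_le_sqrt ?_
      nlinarith [hQa t, sq_nonneg t]
    have hQs : Q t ^ (-s - 1).re ≤ Q t ^ (-(7 / 4) : ℝ) := by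
      refine Real.rpow_le_rpow_of_exponent_le hQ1 ?_
      simp only [Complex.sub_re, Complex.neg_re, Complex.one_re]
      linarith
    have hQe : Q t ^ (-(7 / 4) : ℝ) * Q t ^ (1 / 2 : ℝ) ≤
        81 ^ (5 / 4 : ℝ) * ‖(a, b)‖ ^ (-(5 / 2) : ℝ) := by
      rw [← Real.rpow_add (hQ0 t)]
      refine (Real.rpow_le_rpow_of_nonpos (by positivity) hle (by norm_num)).trans_eq ?_
      rw [Real.div_rpow (by positivity) (by norm_num), ← Real.rpow_natCast_mul hnorm0.le,
        show (-(7 / 4) + 1 / 2 : ℝ) = -(5 / 4) by norm_num,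
        Real.rpow_neg (show (0 : ℝ) ≤ 81 by norm_num), div_inv_eq_mul, mul_comm]
      norm_num
    have h1 : Q t ^ (-s - 1).re * |t| ≤ Q t ^ (-(7 / 4) : ℝ) * Q t ^ (1 / 2 : ℝ) :=
      mul_le_mul hQs ht' (abs_nonneg t) (Real.rpow_nonneg (hQ0 t).le _)
    calc ‖s‖ * Q t ^ (-s - 1).re * (B * (2 * |t|))
        = ‖s‖ * (2 * B * (Q t ^ (-s - 1).re * |t|)) := by ring
      _ ≤ 3 * (2 * B * (81 ^ (5 / 4 : ℝ) * ‖(a, b)‖ ^ (-(5 / 2) : ℝ))) := by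
          have := h1.trans hQe
          gcongr
      _ = _ := by ring
  have hmem : ((b + d : ℤ) : ℝ) ∈ Metric.closedBall (b : ℝ) 8 := by
    rw [Metric.mem_closedBall, Real.dist_eq]
    push_cast
    rw [add_sub_cancel_left]
    exact_mod_cast hd
  have h := (convex_closedBall (b : ℝ) 8).norm_image_sub_le_of_norm_hasDerivWithin_le
    (fun t _ => (hderiv t).hasDerivWithinAt) hbound hmem (Metric.mem_closedBall_self (by norm_num))
  refine h.trans ?_
  have hdist : ‖(b : ℝ) - ((b + d : ℤ) : ℝ)‖ ≤ 8 := by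
    rw [← dist_eq_norm, dist_comm]
    exact hmem
  refine (mul_le_mul_of_nonneg_left hdist (by positivity)).trans_eq ?_
  ring

theorem summable_mul_diagonalForm_rpow {s : ℝ} (hs : 1 < s) {w : ℤ × ℤ → ℝ} {M : ℝ}
    (hM : ∀ v, |w v| ≤ M) (hw0 : ∀ b, w (0, b) = 0) :
    Summable fun v : ℤ × ℤ => w v * (A * v.1 ^ 2 + B * v.2 ^ 2) ^ (-s) := by
  have hM0 : 0 ≤ M := (abs_nonneg _).trans (hM 0)
  refine Summable.of_norm_bounded
    ((summable_norm_int_prod_rpow (k := 2 * s) (by linarith)).mul_left M) fun v => ?_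
  rw [norm_mul, Real.norm_eq_abs]
  rcases eq_or_ne v 0 with rfl | hv
  · rw [show w 0 = 0 from hw0 0, abs_zero, zero_mul]
    positivity
  · have hv' : 0 < ‖v‖ := norm_pos_iff.2 hv
    have hq := sq_norm_le_diagonalForm hA hB v
    refine mul_le_mul (hM v) ?_ (norm_nonneg _) hM0
    rw [Real.norm_of_nonneg (Real.rpow_nonneg ((sq_nonneg _).trans hq) _),
      show -(2 * s) = (2 : ℕ) * (-s) by push_cast; ring, Real.rpow_natCast_mul hv'.le]
    exact Real.rpow_le_rpow_of_nonpos (by positivity) hq (by linarith)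

end DiagonalForm

theorem exists_differentiableAt_hasSum_diagonalForm {A B : ℝ} (hA : 1 ≤ A) (hB : 1 ≤ B)
    {w : ℤ × ℤ → ℝ} {M : ℝ} (hM : ∀ v, |w v| ≤ M) (hw0 : ∀ b, w (0, b) = 0)
    (hw : ∀ a b, w (a, b) + w (a, b + 8) + w (a, b - 8) = 0) :
    ∃ Φ : ℝ → ℝ, DifferentiableAt ℝ Φ 1 ∧ ∀ s : ℝ, 1 < s →
      HasSum (fun v : ℤ × ℤ => w v * (A * v.1 ^ 2 + B * v.2 ^ 2) ^ (-s)) (Φ s) := by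
  set q : ℤ × ℤ → ℝ := fun v => A * v.1 ^ 2 + B * v.2 ^ 2 with hq
  have hM0 : 0 ≤ M := (abs_nonneg _).trans (hM 0)
  set U : Set ℂ := {s | 3 / 4 < s.re} ∩ Metric.ball 0 3 with hU
  have hUo : IsOpen U := (isOpen_lt continuous_const Complex.continuous_re).inter Metric.isOpen_ball
  have h1U : (1 : ℂ) ∈ U := by
    constructor <;> norm_num
  set T : ℤ × ℤ → ℂ → ℂ := fun v s => w v / 3 *
    (((q v : ℂ) ^ (-s) - (q (v.1, v.2 + 8) : ℂ) ^ (-s)) +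
      ((q v : ℂ) ^ (-s) - (q (v.1, v.2 + -8) : ℂ) ^ (-s))) with hT
  set C : ℝ := 48 * B * 81 ^ (5 / 4 : ℝ) with hC
  have hC0 : 0 ≤ C := by positivity
  have hTbound : ∀ v, ∀ s ∈ U, ‖T v s‖ ≤ M * C * ‖v‖ ^ (-(5 / 2) : ℝ) := by
    rintro ⟨a, b⟩ s ⟨hs, hs'⟩
    rcases eq_or_ne a 0 with rfl | ha
    · simp only [hT, hw0]
      simp only [Complex.ofReal_zero, zero_div, zero_mul, norm_zero]
      positivity
    · rw [mem_ball_zero_iff] at hs'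
      have e1 := norm_cpow_diagonalForm_sub_le hA hB hs hs' (b := b) (d := 8) ha (by norm_num)
      have e2 := norm_cpow_diagonalForm_sub_le hA hB hs hs' (b := b) (d := -8) ha (by norm_num)
      have e3 := (norm_add_le _ _).trans (add_le_add e1 e2)
      have hwv : ‖(w (a, b) : ℂ) / 3‖ ≤ M / 3 := by
        rw [norm_div, Complex.norm_real, Real.norm_eq_abs]
        norm_num
        linarith [hM (a, b)]
      simp only [hT, norm_mul]
      refine (mul_le_mul hwv e3 (norm_nonneg _) (by positivity)).trans ?_
      have : 0 ≤ M * C * ‖(a, b)‖ ^ (-(5 / 2) : ℝ) := by positivity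
      rw [← hC]
      linarith
  have hTdiff : ∀ v, DifferentiableOn ℂ (T v) U := by
    rintro ⟨a, b⟩
    rcases eq_or_ne a 0 with rfl | ha
    · simp only [hT, hw0]
      simp
    · have hpos : ∀ b : ℤ, (q (a, b) : ℂ) ≠ 0 := by
        intro b
        have : 0 < (a : ℝ) ^ 2 := by positivity
        have : 0 < q (a, b) := by
          simp only [hq]
          nlinarith [sq_nonneg (b : ℝ)]
        exact_mod_cast this.ne'
      have hd : ∀ b : ℤ, DifferentiableOn ℂ (fun s : ℂ => (q (a, b) : ℂ) ^ (-s)) U := fun b s _ =>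
        ((differentiableAt_id.neg).const_cpow (Or.inl (hpos b))).differentiableWithinAt
      exact (((hd b).sub (hd _)).add ((hd b).sub (hd _))).const_mul _
  have hΦ := Complex.differentiableOn_tsum_of_summable_norm
    ((summable_norm_int_prod_rpow (k := 5 / 2) (by norm_num)).mul_left (M * C))
    hTdiff hUo hTbound
  refine ⟨fun s => (∑' v, T v s).re,
    ((hΦ.differentiableAt (hUo.mem_nhds h1U)).hasDerivAt.real_of_complex).differentiableAt, ?_⟩
  intro s hs
  have hsum : ∀ w' : ℤ × ℤ → ℝ, (∀ v, |w' v| ≤ M) → (∀ b, w' (0, b) = 0) →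
      Summable fun v => w' v * q v ^ (-s) := fun w' h1 h2 =>
    summable_mul_diagonalForm_rpow hA hB hs h1 h2
  have h0 := (hsum w hM hw0).hasSum
  have h1 := (hsum (fun v => w (v.1, v.2 - 8)) (fun v => hM _) (fun b => hw0 _)).hasSum
  have h2 := (hsum (fun v => w (v.1, v.2 + 8)) (fun v => hM _) (fun b => hw0 _)).hasSum
  have hS := ((h0.add h2).add h1).unique (a₂ := 0) (by
    convert hasSum_zero using 2 with v
    linear_combination q v ^ (-s) * hw v.1 v.2)
  rw [← (Equiv.addRight ((0, 8) : ℤ × ℤ)).hasSum_iff] at h1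
  rw [← (Equiv.addRight ((0, -8) : ℤ × ℤ)).hasSum_iff] at h2
  have h3 := (((h0.mul_left 2).sub h1).sub h2).mul_left (1 / 3)
  have hTs : (∑' v, T v s) = ((∑' v, w v * q v ^ (-s) : ℝ) : ℂ) := by
    refine HasSum.tsum_eq ?_
    convert Complex.hasSum_ofReal.2 h3 using 1
    · funext v
      have hcast : ∀ v, (q v : ℂ) ^ (-(s : ℂ)) = ((q v ^ (-s) : ℝ) : ℂ) := by
        intro v
        have hqv : 0 ≤ q v := (sq_nonneg _).trans (sq_norm_le_diagonalForm hA hB v)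
        rw [Complex.ofReal_cpow hqv, Complex.ofReal_neg]
      simp only [hT, hcast, Function.comp_apply, Equiv.coe_addRight, Prod.fst_add, Prod.snd_add,
        add_zero, add_sub_cancel_right, neg_add_cancel_right]
      rw [← Prod.mk.eta (p := v)]
      simp only [Prod.mk_add_mk, add_zero]
      push_cast
      ring
    · congr 1
      linear_combination (1 / 3 : ℝ) * hS
  simp only [hTs, Complex.ofReal_re]
  exact h0

theorem HasSum.finset_fiberwise {ι : Type*} {F : ι → ℝ} {S : ℝ} (hF : HasSum F S) {f : ι → ℕ}
    {t : ℕ → Finset ι} (ht : ∀ n v, v ∈ t n ↔ f v = n) :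
    HasSum (fun n => ∑ v ∈ t n, F v) S := by
  refine ((Equiv.sigmaFiberEquiv f).hasSum_iff.2 hF).sigma fun n => ?_
  exact (Equiv.subtypeEquivRight (ht n)).symm.hasSum_iff.2 ((t n).hasSum F)

theorem cubicTrace_add_add_eq_zero (a b : ZMod 3) (ha : a ≠ 0) :
    cubicTrace (a * b) + cubicTrace (a * (b + 8)) + cubicTrace (a * (b - 8)) = 0 := by
  revert a b
  decide

theorem cubicTrace_two_mul (z : ZMod 3) : cubicTrace (2 * z) = cubicTrace z := by
  revert z
  decide

theorem exists_differentiableAt_hasSum_twisted (ψ : DirichletCharacter ℝ 24) {A B : ℤ}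
    (hA : 1 ≤ A) (hB : 1 ≤ B) (hB3 : 3 ∣ B) (hB24 : 24 ∣ 16 * B) :
    ∃ Φ : ℝ → ℝ, DifferentiableAt ℝ Φ 1 ∧ ∀ s : ℝ, 1 < s →
      HasSum (fun v : ℤ × ℤ => ψ ((A * v.1 ^ 2 + B * v.2 ^ 2 : ℤ) : ZMod 24) *
        cubicTrace (v.1 * v.2) * ((A * v.1 ^ 2 + B * v.2 ^ 2 : ℤ) : ℝ) ^ (-s)) (Φ s) := by
  have hψ : ∀ m : ℤ, 3 ∣ m → ψ m = 0 := by
    rintro m ⟨k, rfl⟩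
    simp [dirichletCharacter_ofNat_three]
  have hdvd : ∀ a b : ℤ, 3 ∣ a → 3 ∣ A * a ^ 2 + B * b ^ 2 := fun a b h =>
    dvd_add ((dvd_pow h two_ne_zero).mul_left A) (hB3.mul_right _)
  have hshift : ∀ a b d : ℤ, d = 1 ∨ d = -1 →
      ((A * a ^ 2 + B * (b + 8 * d) ^ 2 : ℤ) : ZMod 24) =
        ((A * a ^ 2 + B * b ^ 2 : ℤ) : ZMod 24) := by
    intro a b d hd
    rw [← sub_eq_zero, ← Int.cast_sub, ZMod.intCast_zmod_eq_zero_iff_dvd,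
      show A * a ^ 2 + B * (b + 8 * d) ^ 2 - (A * a ^ 2 + B * b ^ 2) =
        16 * B * (b * d + 4 * d ^ 2) by ring]
    exact hB24.mul_right _
  have key := exists_differentiableAt_hasSum_diagonalForm (A := A) (B := B)
    (w := fun v => ψ ((A * v.1 ^ 2 + B * v.2 ^ 2 : ℤ) : ZMod 24) * cubicTrace (v.1 * v.2)) (M := 2)
    (by exact_mod_cast hA) (by exact_mod_cast hB) ?_ ?_ ?_
  · exact_mod_cast key
  · intro v
    have h1 := abs_dirichletCharacter_le_one ψ ((A * v.1 ^ 2 + B * v.2 ^ 2 : ℤ) : ZMod 24)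
    have h2 : |(cubicTrace (v.1 * v.2) : ℝ)| ≤ 2 := by
      rw [cubicTrace]
      split_ifs <;> norm_num
    rw [abs_mul]
    nlinarith [abs_nonneg (ψ ((A * v.1 ^ 2 + B * v.2 ^ 2 : ℤ) : ZMod 24))]
  · intro b
    simp only
    rw [hψ _ (hdvd 0 b (dvd_zero 3)), zero_mul]
  · intro a b
    simp only
    have h1 := hshift a b 1 (Or.inl rfl)
    have h2 := hshift a b (-1) (Or.inr rfl)
    rw [mul_one] at h1
    rw [mul_neg_one, ← sub_eq_add_neg] at h2
    rw [h1, h2]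
    by_cases ha : 3 ∣ a
    · rw [hψ _ (hdvd a b ha)]
      ring
    · have ha' : (a : ZMod 3) ≠ 0 := by rwa [Ne, ZMod.intCast_zmod_eq_zero_iff_dvd]
      have := cubicTrace_add_add_eq_zero a b ha'
      rw [← mul_add, ← mul_add]
      push_cast
      rw [← Int.cast_add, ← Int.cast_add, this, Int.cast_zero, mul_zero]

theorem two_dvd_of_norm_eq {x y n : ℤ} (h : x ^ 2 + 6 * y ^ 2 = 2 * n) : 2 ∣ x :=
  Int.prime_two.dvd_of_dvd_pow (n := 2) ⟨n - 3 * y ^ 2, by linarith⟩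

theorem exists_differentiableAt_hasSum_cubicCoeff (ψ : DirichletCharacter ℝ 24) :
    ∃ Φ : ℝ → ℝ, DifferentiableAt ℝ Φ 1 ∧ ∀ s : ℝ, 1 < s →
      HasSum (fun n : ℕ => ψ n * cubicCoeff n * (n : ℝ) ^ (-s)) (Φ s) := by
  obtain ⟨Φ₁, hd₁, hs₁⟩ := exists_differentiableAt_hasSum_twisted ψ (A := 1) (B := 6)
    (by norm_num) (by norm_num) (by norm_num) (by norm_num)
  obtain ⟨Φ₂, hd₂, hs₂⟩ := exists_differentiableAt_hasSum_twisted ψ (A := 2) (B := 3)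
    (by norm_num) (by norm_num) (by norm_num) (by norm_num)
  refine ⟨fun s => 1 / 4 * (Φ₁ s + Φ₂ s), (hd₁.add hd₂).const_mul _, fun s hs => ?_⟩
  have h₁ := (hs₁ s hs).finset_fiberwise (f := fun v => (1 * v.1 ^ 2 + 6 * v.2 ^ 2).toNat)
    (t := fun n => formReps n) (fun n v => by
      rw [mem_formReps]
      have : 0 ≤ v.1 ^ 2 + 6 * v.2 ^ 2 := by positivity
      omega)
  have h₂ := (hs₂ s hs).finset_fiberwise (f := fun v => (2 * v.1 ^ 2 + 3 * v.2 ^ 2).toNat)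
    (t := fun n => (formReps (2 * n)).image fun v => (v.1 / 2, v.2)) (fun n v => by
      have : 0 ≤ 2 * v.1 ^ 2 + 3 * v.2 ^ 2 := by positivity
      rw [Finset.mem_image]
      constructor
      · rintro ⟨⟨x, y⟩, h, rfl⟩
        rw [mem_formReps] at h
        simp only at h this ⊢
        obtain ⟨a, rfl⟩ := two_dvd_of_norm_eq h
        rw [Int.mul_ediv_cancel_left _ two_ne_zero] at this ⊢
        have : 2 * a ^ 2 + 3 * y ^ 2 = n := by linarith
        omega
      · intro h
        refine ⟨(2 * v.1, v.2), mem_formReps.2 ?_, ?_⟩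
        · have : 2 * v.1 ^ 2 + 3 * v.2 ^ 2 = n := by omega
          simp only
          linear_combination 2 * this
        · rw [Int.mul_ediv_cancel_left _ two_ne_zero])
  have h := (h₁.add h₂).mul_left (1 / 4)
  refine h.congr_fun fun n => ?_
  have e₁ : ∑ v ∈ formReps n, ψ ((1 * v.1 ^ 2 + 6 * v.2 ^ 2 : ℤ) : ZMod 24) *
      cubicTrace (v.1 * v.2) * ((1 * v.1 ^ 2 + 6 * v.2 ^ 2 : ℤ) : ℝ) ^ (-s) =
      ψ n * cubicCount n * (n : ℝ) ^ (-s) := by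
    rw [cubicCount, Int.cast_sum, Finset.mul_sum, Finset.sum_mul]
    refine Finset.sum_congr rfl fun v hv => ?_
    rw [mem_formReps] at hv
    rw [one_mul, hv]
    push_cast
    rfl
  have e₂ : ∑ v ∈ (formReps (2 * n)).image fun v => (v.1 / 2, v.2),
      ψ ((2 * v.1 ^ 2 + 3 * v.2 ^ 2 : ℤ) : ZMod 24) *
      cubicTrace (v.1 * v.2) * ((2 * v.1 ^ 2 + 3 * v.2 ^ 2 : ℤ) : ℝ) ^ (-s) =
      ψ n * cubicCount (2 * n) * (n : ℝ) ^ (-s) := by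
    rw [Finset.sum_image, cubicCount, Int.cast_sum, Finset.mul_sum, Finset.sum_mul]
    · refine Finset.sum_congr rfl ?_
      rintro ⟨x, y⟩ h
      rw [mem_formReps] at h
      simp only at h ⊢
      obtain ⟨a, rfl⟩ := two_dvd_of_norm_eq h
      rw [Int.mul_ediv_cancel_left _ two_ne_zero, show 2 * a ^ 2 + 3 * y ^ 2 = n by linarith]
      push_cast
      rw [mul_assoc (2 : ZMod 3), cubicTrace_two_mul]
    · rintro ⟨x, y⟩ h ⟨x', y'⟩ h' he
      rw [Finset.mem_coe, mem_formReps] at h h'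
      obtain ⟨a, rfl⟩ := two_dvd_of_norm_eq h
      obtain ⟨a', rfl⟩ := two_dvd_of_norm_eq h'
      simpa using he
  rw [e₁, e₂, cubicCoeff]
  push_cast
  ring

theorem cubicCoeff_prime_eq_zero {p : ℕ} (hp : p.Prime) (h2 : p ≠ 2) (h3 : p ≠ 3)
    (h : (p : ZMod 24) ∉ ({1, 5, 7, 11} : Finset (ZMod 24))) : cubicCoeff p = 0 := by
  refine cubicCoeff_prime_of_forall_ne hp h2 h3 fun c u v hc huv => h ?_
  have hsq : (p : ZMod 24) * p = 1 := by
    have : ∀ r : ZMod 24, IsUnit r → r * r = 1 := by decide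
    exact this _ (isUnit_natCast_of_prime hp h2 h3)
  rcases hc with rfl | rfl
  · have hr : ((p : ℤ) : ZMod 24) = u ^ 2 + 6 * v ^ 2 := by
      rw [← one_mul (p : ℤ), ← huv]
      push_cast
      rfl
    rw [Int.cast_natCast] at hr
    rw [hr] at hsq ⊢
    generalize (u : ZMod 24) = a at *
    generalize (v : ZMod 24) = b at *
    clear hr huv h
    revert a b
    decide
  · obtain ⟨a, rfl⟩ := two_dvd_of_norm_eq huv
    have hr : ((p : ℤ) : ZMod 24) = 2 * a ^ 2 + 3 * v ^ 2 := by
      rw [show (p : ℤ) = 2 * a ^ 2 + 3 * v ^ 2 by linarith]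
      push_cast
      rfl
    rw [Int.cast_natCast] at hr
    rw [hr] at hsq ⊢
    generalize (a : ZMod 24) = a at *
    generalize (v : ZMod 24) = b at *
    clear hr huv h
    revert a b
    decide

theorem neg_one_le_cubicCoeff_prime {p : ℕ} (hp : p.Prime) (h2 : p ≠ 2) (h3 : p ≠ 3) :
    -1 ≤ cubicCoeff p := by
  by_cases h : ∃ c u v : ℤ, (c = 1 ∨ c = 2) ∧ u ^ 2 + 6 * v ^ 2 = c * p
  · obtain ⟨c, u, v, hc, huv⟩ := h
    rw [cubicCoeff_prime_of_norm_eq hp h2 h3 hc huv, cubicTrace]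
    split_ifs <;> norm_num
  · push Not at h
    rw [cubicCoeff_prime_of_forall_ne hp h2 h3 h]
    norm_num

theorem exists_abs_cubicCoeff_prime_le : ∃ M, ∀ p : ℕ, p.Prime → |cubicCoeff p| ≤ M := by
  refine ⟨2 + |cubicCoeff 2| + |cubicCoeff 3|, fun p hp => ?_⟩
  have e2 := abs_nonneg (cubicCoeff 2)
  have e3 := abs_nonneg (cubicCoeff 3)
  rcases eq_or_ne p 2 with rfl | h2
  · linarith
  rcases eq_or_ne p 3 with rfl | h3
  · linarith
  linarith [abs_cubicCoeff_prime_le hp h2 h3]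

/-- The sum of `cubicCoeff p * p ^ (-s)` over the primes `p ≡ a` modulo `24`. -/
noncomputable def classSum (a : ZMod 24) (s : ℝ) : ℝ :=
  primeSum (fun n => if a = n then cubicCoeff n else 0) s

theorem summable_classSum (a : ZMod 24) {s : ℝ} (hs : 1 < s) :
    Summable fun p : Nat.Primes =>
      (if a = ((p : ℕ) : ZMod 24) then cubicCoeff p else 0) * ((p : ℕ) : ℝ) ^ (-s) := by
  obtain ⟨M, hM⟩ := exists_abs_cubicCoeff_prime_le
  refine summable_primeSum (a := fun n => if a = n then cubicCoeff n else 0) (M := M)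
    (fun p hp => ?_) hs
  split_ifs
  · exact hM p hp
  · rw [abs_zero]
    exact (abs_nonneg _).trans (hM p hp)

theorem primeSum_twisted_eq_sum_classSum (ψ : DirichletCharacter ℝ 24) {s : ℝ} (hs : 1 < s) :
    primeSum (fun n => ψ n * cubicCoeff n) s =
      ∑ a ∈ ({1, 5, 7, 11} : Finset (ZMod 24)), ψ a * classSum a s := by
  simp only [classSum, primeSum, ← tsum_mul_left]
  rw [← Summable.tsum_finsetSum fun a _ => (summable_classSum a hs).mul_left (ψ a)]
  congr 1
  funext p
  have hp := p.2
  have hsum : ∑ a ∈ ({1, 5, 7, 11} : Finset (ZMod 24)),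
      ψ a * ((if a = ((p : ℕ) : ZMod 24) then cubicCoeff p else 0) * ((p : ℕ) : ℝ) ^ (-s)) =
      if ((p : ℕ) : ZMod 24) ∈ ({1, 5, 7, 11} : Finset (ZMod 24)) then
        ψ (p : ℕ) * (cubicCoeff p * ((p : ℕ) : ℝ) ^ (-s)) else 0 := by
    rw [← Finset.sum_ite_eq' _ ((p : ℕ) : ZMod 24)
      (fun a => ψ a * (cubicCoeff p * ((p : ℕ) : ℝ) ^ (-s)))]
    refine Finset.sum_congr rfl fun a _ => ?_
    split_ifs with h <;> simp
  rw [hsum]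
  split_ifs with h
  · ring
  rcases eq_or_ne (p : ℕ) 2 with h2 | h2
  · rw [h2, dirichletCharacter_two]
    ring
  rcases eq_or_ne (p : ℕ) 3 with h3 | h3
  · rw [h3, dirichletCharacter_three]
    ring
  rw [cubicCoeff_prime_eq_zero hp h2 h3 h]
  ring

theorem neg_le_classSum {a : ZMod 24} (ha : IsUnit a) {s : ℝ} (hs : 1 < s) :
    -primeSum (fun n => if a = n then 1 else 0) s ≤ classSum a s := by
  rw [classSum, primeSum, primeSum, ← tsum_neg]
  refine Summable.tsum_le_tsum (fun p => ?_) ?_ (summable_classSum a hs)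
  · rw [← neg_mul]
    refine mul_le_mul_of_nonneg_right ?_ (by positivity)
    split_ifs with h
    · refine neg_one_le_cubicCoeff_prime p.2 ?_ ?_ <;> intro h' <;> rw [h, h'] at ha <;>
        revert ha <;> decide
    · rw [neg_zero]
  · refine (summable_primeSum (a := fun n => if a = n then 1 else 0) (M := 1)
      (fun p _ => ?_) hs).neg
    split_ifs <;> norm_num

theorem tendsto_log_sub_one : Tendsto (fun s : ℝ => Real.log (s - 1)) (𝓝[>] 1) atBot := by
  refine Real.tendsto_log_nhdsGT_zero.comp ?_
  refine tendsto_nhdsWithin_iff.2 ⟨?_, ?_⟩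
  · have : Tendsto (fun s : ℝ => s - 1) (𝓝 1) (𝓝 (1 - 1)) := tendsto_id.sub_const 1
    rw [sub_self] at this
    exact this.mono_left nhdsWithin_le_nhds
  · filter_upwards [self_mem_nhdsWithin] with s hs
    exact sub_pos.2 (Set.mem_Ioi.1 hs)

theorem exists_le_classSum {a : ZMod 24} (ha : IsUnit a) :
    ∃ C, ∀ᶠ s in 𝓝[>] (1 : ℝ), 1 / 8 * Real.log (s - 1) - C ≤ classSum a s := by
  obtain ⟨C, hC⟩ := (isBigO_primeSum_residueClass ha).bound
  refine ⟨C, ?_⟩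
  filter_upwards [hC, self_mem_nhdsWithin] with s h hs
  rw [norm_one, mul_one, Real.norm_eq_abs] at h
  linarith [neg_le_classSum ha hs, le_abs_self
    (primeSum (fun n => if a = n then 1 else 0) s + 1 / 8 * Real.log (s - 1))]

theorem isBigO_or_eventually_le (ψ : DirichletCharacter ℝ 24) :
    (primeSum fun n => ψ n * cubicCoeff n) =O[𝓝[>] 1] (fun _ => (1 : ℝ)) ∨
      ∃ C, ∀ᶠ s in 𝓝[>] (1 : ℝ), primeSum (fun n => ψ n * cubicCoeff n) s ≤
        Real.log (s - 1) + C := by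
  obtain ⟨Φ, hd, hsum⟩ := exists_differentiableAt_hasSum_cubicCoeff ψ
  obtain ⟨C, hC⟩ := (hasEulerRecursion_twisted_cubicCoeff ψ).exists_abs_log_sub_primeSum_le
    (fun p hp => abs_twisted_cubicCoeff_prime_le ψ hp)
    (fun p _ => by
      rw [abs_mul, abs_splitSign, mul_one, abs_pow]
      exact pow_le_one₀ (abs_nonneg _) (abs_dirichletCharacter_le_one ψ _))
    (by simp [dirichletCharacter_ofNat_two]) (by simp [dirichletCharacter_ofNat_three])
    (by simp [dirichletCharacter_ofNat_two]) (by simp [dirichletCharacter_ofNat_three])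
  have hΦ : ∀ s : ℝ, 1 < s → 0 < Φ s ∧
      |Real.log (Φ s) - primeSum (fun n => ψ n * cubicCoeff n) s| ≤ C := by
    intro s hs
    rw [← (hsum s hs).tsum_eq]
    exact hC s hs (hsum s hs).summable
  rcases eq_or_ne (Φ 1) 0 with h0 | h0
  · right
    obtain ⟨K, hK, hb⟩ := hd.isBigO_sub.exists_pos
    refine ⟨Real.log K + C, ?_⟩
    filter_upwards [hb.bound.filter_mono nhdsWithin_le_nhds, self_mem_nhdsWithin] with s h hs
    have hs' : 0 < s - 1 := sub_pos.2 hs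
    obtain ⟨hpos, hlog⟩ := hΦ s hs
    rw [h0, sub_zero, Real.norm_of_nonneg hpos.le, Real.norm_of_nonneg hs'.le] at h
    have := Real.log_le_log hpos h
    rw [Real.log_mul hK.ne' hs'.ne'] at this
    linarith [(abs_le.1 hlog).1]
  · left
    have h1 := isBigO_log_of_tendsto
      (hd.continuousAt.tendsto.mono_left (nhdsWithin_le_nhds (s := Set.Ioi 1))) h0
    have h2 : (fun s => Real.log (Φ s) - primeSum (fun n => ψ n * cubicCoeff n) s)
        =O[𝓝[>] 1] (fun _ => (1 : ℝ)) := by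
      refine IsBigO.of_bound C ?_
      filter_upwards [self_mem_nhdsWithin] with s hs
      rw [norm_one, mul_one]
      exact (hΦ s hs).2
    simpa using h1.sub h2

theorem not_eventually_mul_log_le {c C : ℝ} (hc : c < 0) :
    ¬ ∀ᶠ s in 𝓝[>] (1 : ℝ), c * Real.log (s - 1) ≤ C := by
  intro h
  have h2 := (tendsto_log_sub_one.const_mul_atBot_of_neg hc).eventually_gt_atTop C
  obtain ⟨s, h1, h2⟩ := (h.and h2).exists
  exact absurd h2 (not_lt.2 h1)

theorem isBigO_primeSum_twisted_cubicCoeff (ψ : DirichletCharacter ℝ 24) :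
    (primeSum fun n => ψ n * cubicCoeff n) =O[𝓝[>] 1] (fun _ => (1 : ℝ)) := by
  obtain ⟨C₁, h₁⟩ := exists_le_classSum (a := 1) (by decide)
  obtain ⟨C₅, h₅⟩ := exists_le_classSum (a := 5) (by decide)
  obtain ⟨C₇, h₇⟩ := exists_le_classSum (a := 7) (by decide)
  obtain ⟨C₁₁, h₁₁⟩ := exists_le_classSum (a := 11) (by decide)
  have hG : ∀ (ψ : DirichletCharacter ℝ 24) (s : ℝ), 1 < s →
      primeSum (fun n => ψ n * cubicCoeff n) s = classSum 1 s + ψ 5 * classSum 5 s +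
        ψ 7 * classSum 7 s + ψ 5 * ψ 7 * classSum 11 s := by
    intro ψ s hs
    rw [primeSum_twisted_eq_sum_classSum ψ hs, Finset.sum_insert (by decide),
      Finset.sum_insert (by decide), Finset.sum_insert (by decide), Finset.sum_singleton,
      map_one, ← map_mul, show (5 * 7 : ZMod 24) = 11 by decide]
    ring
  have htriv : ∀ ψ : DirichletCharacter ℝ 24, ψ 5 = 1 → ψ 7 = 1 →
      (primeSum fun n => ψ n * cubicCoeff n) =O[𝓝[>] 1] (fun _ => (1 : ℝ)) := by
    intro ψ h5 h7
    refine (isBigO_or_eventually_le ψ).resolve_right ?_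
    rintro ⟨C, hC⟩
    refine not_eventually_mul_log_le (c := -(1 / 2)) (C := C + C₁ + C₅ + C₇ + C₁₁) (by norm_num) ?_
    filter_upwards [hC, h₁, h₅, h₇, h₁₁, self_mem_nhdsWithin] with s k k₁ k₅ k₇ k₁₁ hs
    rw [hG ψ s hs, h5, h7] at k
    linarith
  have hsign : ∀ a : ZMod 24, a * a = 1 → ψ a = 1 ∨ ψ a = -1 := by
    intro a ha
    rw [← mul_self_eq_one_iff, ← map_mul, ha, map_one]
  have h15 : (1 : DirichletCharacter ℝ 24) 5 = 1 := MulChar.one_apply (by decide)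
  have h17 : (1 : DirichletCharacter ℝ 24) 7 = 1 := MulChar.one_apply (by decide)
  obtain ⟨C', hC'⟩ := (htriv 1 h15 h17).bound
  have hlower : ∃ D, ∀ᶠ s in 𝓝[>] (1 : ℝ), 1 / 2 * Real.log (s - 1) - D ≤
      primeSum (fun n => ψ n * cubicCoeff n) s := by
    rcases hsign 5 (by decide) with h5 | h5 <;> rcases hsign 7 (by decide) with h7 | h7
    · refine ⟨C₁ + C₅ + C₇ + C₁₁, ?_⟩
      filter_upwards [h₁, h₅, h₇, h₁₁, self_mem_nhdsWithin] with s k₁ k₅ k₇ k₁₁ hs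
      rw [hG ψ s hs, h5, h7]
      linarith
    · refine ⟨C' + 2 * (C₁ + C₅), ?_⟩
      filter_upwards [hC', h₁, h₅, h₇, h₁₁, self_mem_nhdsWithin] with s k k₁ k₅ k₇ k₁₁ hs
      rw [Real.norm_eq_abs, norm_one, mul_one, hG 1 s hs, h15, h17] at k
      rw [hG ψ s hs, h5, h7]
      linarith [le_abs_self (classSum 1 s + 1 * classSum 5 s + 1 * classSum 7 s +
        1 * 1 * classSum 11 s)]
    · refine ⟨C' + 2 * (C₁ + C₇), ?_⟩
      filter_upwards [hC', h₁, h₅, h₇, h₁₁, self_mem_nhdsWithin] with s k k₁ k₅ k₇ k₁₁ hs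
      rw [Real.norm_eq_abs, norm_one, mul_one, hG 1 s hs, h15, h17] at k
      rw [hG ψ s hs, h5, h7]
      linarith [le_abs_self (classSum 1 s + 1 * classSum 5 s + 1 * classSum 7 s +
        1 * 1 * classSum 11 s)]
    · refine ⟨C' + 2 * (C₁ + C₁₁), ?_⟩
      filter_upwards [hC', h₁, h₅, h₇, h₁₁, self_mem_nhdsWithin] with s k k₁ k₅ k₇ k₁₁ hs
      rw [Real.norm_eq_abs, norm_one, mul_one, hG 1 s hs, h15, h17] at k
      rw [hG ψ s hs, h5, h7]
      linarith [le_abs_self (classSum 1 s + 1 * classSum 5 s + 1 * classSum 7 s +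
        1 * 1 * classSum 11 s)]
  refine (isBigO_or_eventually_le ψ).resolve_right ?_
  rintro ⟨C, hC⟩
  obtain ⟨D, hD⟩ := hlower
  refine not_eventually_mul_log_le (c := -(1 / 2)) (C := C + D) (by norm_num) ?_
  filter_upwards [hC, hD] with s k k'
  linarith

theorem isBigO_classSum {a : ZMod 24} (ha : IsUnit a) :
    classSum a =O[𝓝[>] 1] (fun _ => (1 : ℝ)) := by
  obtain ⟨M, hM⟩ := exists_abs_cubicCoeff_prime_le
  have h : (fun s => 1 / 8 * ∑ ψ : DirichletCharacter ℝ 24,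
      ψ a⁻¹ * primeSum (fun n => ψ n * cubicCoeff n) s) =O[𝓝[>] 1] (fun _ => (1 : ℝ)) :=
    (IsBigO.fun_sum fun ψ _ =>
      (isBigO_primeSum_twisted_cubicCoeff ψ).const_mul_left _).const_mul_left _
  refine h.congr' ?_ EventuallyEq.rfl
  filter_upwards [self_mem_nhdsWithin] with s hs
  exact (primeSum_ite_eq hM hs ha).symm

theorem isCoprime_of_eq_prime {p : ℕ} (hp : p.Prime) {A B u v : ℤ}
    (h : A * u ^ 2 + B * v ^ 2 = p) : IsCoprime u v := by
  rw [Int.isCoprime_iff_gcd_eq_one]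
  have hd : ((Int.gcd u v : ℤ)) * (Int.gcd u v : ℤ) ∣ p := by
    rw [← h, ← sq]
    exact dvd_add ((pow_dvd_pow_of_dvd (Int.gcd_dvd_left _ _) 2).mul_left A)
      ((pow_dvd_pow_of_dvd (Int.gcd_dvd_right _ _) 2).mul_left B)
  have hu := (Nat.prime_iff_prime_int.1 hp).irreducible.squarefree _ hd
  rwa [Int.ofNat_isUnit, Nat.isUnit_iff] at hu

theorem exists_norm_eq_of_mod {p : ℕ} (hp : p.Prime)
    (hk : p % 24 ∈ ({1, 5, 7, 11} : Set ℕ)) :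
    ∃ c u v : ℤ, (c = 1 ∨ c = 2) ∧ u ^ 2 + 6 * v ^ 2 = c * p := by
  have : Fact p.Prime := ⟨hp⟩
  simp only [Set.mem_insert_iff, Set.mem_singleton_iff] at hk
  have hodd : Odd p := by
    rw [Nat.odd_iff]
    omega
  have hJ : jacobiSym (-6) p = 1 := by
    rw [jacobiSym.mod_right _ hodd]
    change jacobiSym (-6) (p % 24) = 1
    rcases hk with h | h | h | h <;> rw [h] <;> norm_num
  rw [← jacobiSym.legendreSym.to_jacobiSym] at hJ
  have hne : ((-6 : ℤ) : ZMod p) ≠ 0 := by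
    intro h
    rw [(legendreSym.eq_zero_iff p (-6)).2 h] at hJ
    exact zero_ne_one hJ
  obtain ⟨z, hz⟩ := (legendreSym.eq_one_iff p hne).1 hJ
  refine exists_norm_eq_of_isSquare hp (z := z) ?_
  rw [sq, ← hz]
  push_cast
  rfl

theorem cubicCoeff_prime_eq_two_of_exists {p : ℕ} (hp : p.Prime) (h2 : p ≠ 2) (h3 : p ≠ 3)
    (h : ∃ j ∈ ({1, 4, 8} : Set ℤ), ∃ x y : ℤ, Int.gcd x y = 1 ∧ x ^ 2 + 216 * y ^ 2 = j * p) :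
    cubicCoeff p = 2 := by
  obtain ⟨c, u, v, hc, huv⟩ : ∃ c u v : ℤ, (c = 1 ∨ c = 2) ∧ u ^ 2 + 6 * (3 * v) ^ 2 = c * p := by
    obtain ⟨j, hj, x, y, -, hxy⟩ := h
    rcases hj with rfl | rfl | rfl
    · exact ⟨1, x, 2 * y, Or.inl rfl, by linarith⟩
    · obtain ⟨a, rfl⟩ : 2 ∣ x := Int.prime_two.dvd_of_dvd_pow (n := 2)
        ⟨2 * p - 108 * y ^ 2, by linarith⟩
      exact ⟨1, a, y, Or.inl rfl, by linarith⟩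
    · obtain ⟨a, rfl⟩ : 2 ∣ x := Int.prime_two.dvd_of_dvd_pow (n := 2)
        ⟨4 * p - 108 * y ^ 2, by linarith⟩
      exact ⟨2, a, y, Or.inr rfl, by linarith⟩
  rw [cubicCoeff_prime_of_norm_eq hp h2 h3 hc huv]
  have : ((3 * v : ℤ) : ZMod 3) = 0 := by
    rw [ZMod.intCast_zmod_eq_zero_iff_dvd]
    exact dvd_mul_right _ _
  rw [this, mul_zero, cubicTrace, if_pos rfl]
  norm_num

theorem exists_of_norm_eq {p : ℕ} (hp : p.Prime) (h2 : p ≠ 2) {c u v : ℤ} (hc : c = 1 ∨ c = 2)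
    (huv : u ^ 2 + 6 * (3 * v) ^ 2 = c * p) :
    ∃ j ∈ ({1, 4, 8} : Set ℤ), ∃ x y : ℤ, Int.gcd x y = 1 ∧ x ^ 2 + 216 * y ^ 2 = j * p := by
  have hodd : (p : ℤ) % 2 = 1 := by
    have := hp.eq_two_or_odd
    omega
  simp only [← Int.isCoprime_iff_gcd_eq_one]
  have h2v : ¬ 2 ∣ v → IsCoprime 2 v := fun h => (Int.prime_two.coprime_iff_not_dvd).2 h
  rcases hc with rfl | rfl
  · by_cases hv : 2 ∣ v
    · obtain ⟨b, rfl⟩ := hv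
      exact ⟨1, by simp, u, b, isCoprime_of_eq_prime hp (A := 1) (B := 216) (by linarith),
        by linarith⟩
    · exact ⟨4, by simp, 2 * u, v, (h2v hv).mul_left
        (isCoprime_of_eq_prime hp (A := 1) (B := 54) (by linarith)), by linarith⟩
  · obtain ⟨a, rfl⟩ := two_dvd_of_norm_eq huv
    have hp' : 2 * a ^ 2 + 27 * v ^ 2 = p := by linarith
    have hv : ¬ 2 ∣ v := by
      rintro ⟨b, rfl⟩
      have : (p : ℤ) = 2 * (a ^ 2 + 54 * b ^ 2) := by linarith
      omega
    exact ⟨8, by simp, 2 * (2 * a), v, (h2v hv).mul_left ((h2v hv).mul_left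
      (isCoprime_of_eq_prime hp hp')), by linarith⟩

open Classical in
theorem ite_exists_eq {p : ℕ} (hp : p.Prime) (hk : p % 24 ∈ ({1, 5, 7, 11} : Set ℕ)) :
    (if ∃ j ∈ ({1, 4, 8} : Set ℤ), ∃ x y : ℤ,
      Int.gcd x y = 1 ∧ x ^ 2 + 216 * y ^ 2 = j * p then (1 : ℝ) else 0) =
      (1 + cubicCoeff p) / 3 := by
  obtain ⟨c, u, v, hc, huv⟩ := exists_norm_eq_of_mod hp hk
  simp only [Set.mem_insert_iff, Set.mem_singleton_iff] at hk
  have h2 : p ≠ 2 := by omega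
  have h3 : p ≠ 3 := by omega
  split_ifs with h
  · rw [cubicCoeff_prime_eq_two_of_exists hp h2 h3 h]
    norm_num
  · rw [cubicCoeff_prime_of_norm_eq hp h2 h3 hc huv, cubicTrace, if_neg]
    · norm_num
    intro h0
    apply h
    rw [← Int.cast_mul, ZMod.intCast_zmod_eq_zero_iff_dvd] at h0
    rcases Int.prime_three.dvd_or_dvd h0 with h0 | ⟨b, rfl⟩
    · have h3' : (3 : ℤ) ∣ c * p := by
        rw [← huv]
        exact dvd_add (dvd_pow h0 two_ne_zero) ⟨2 * v ^ 2, by ring⟩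
      exfalso
      rcases hc with rfl | rfl <;> omega
    · exact exists_of_norm_eq hp h2 hc huv

theorem tsum_eq_primeSum {P : ℕ → Prop} {a : ℕ → ℝ} (hP : ∀ n, P n → n.Prime)
    (h1 : ∀ p : ℕ, p.Prime → P p → a p = 1) (h0 : ∀ p : ℕ, p.Prime → ¬ P p → a p = 0) (s : ℝ) :
    ∑' p : {p : ℕ // P p}, ((p : ℕ) : ℝ) ^ (-s) = primeSum a s := by
  refine (tsum_subtype {p : ℕ | P p} fun p => (p : ℝ) ^ (-s)).trans
    (Eq.trans ?_ (tsum_subtype {p : ℕ | p.Prime} fun p => a p * (p : ℝ) ^ (-s)).symm)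
  congr 1
  funext n
  by_cases hn : n.Prime
  · by_cases hPn : P n
    · rw [Set.indicator_of_mem (by exact hPn), Set.indicator_of_mem (by exact hn), h1 n hn hPn,
        one_mul]
    · rw [Set.indicator_of_notMem (by exact hPn), Set.indicator_of_mem (by exact hn), h0 n hn hPn,
        zero_mul]
  · rw [Set.indicator_of_notMem (by exact fun h => hn (hP n h)),
      Set.indicator_of_notMem (by exact hn)]

theorem tendsto_div_log_of_isBigO {N : ℝ → ℝ} {c : ℝ}
    (h : (fun s => N s + c * Real.log (s - 1)) =O[𝓝[>] 1] (fun _ => (1 : ℝ))) :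
    Tendsto (fun s => N s / Real.log (s - 1)) (𝓝[>] 1) (𝓝 (-c)) := by
  have hlog : (fun _ => (1 : ℝ)) =o[𝓝[>] 1] fun s : ℝ => Real.log (s - 1) :=
    (isLittleO_const_left.2 (Or.inr (tendsto_abs_atBot_atTop.comp tendsto_log_sub_one)))
  have h1 := ((h.trans_isLittleO hlog).tendsto_div_nhds_zero).sub_const c
  rw [zero_sub] at h1
  refine h1.congr' ?_
  filter_upwards [tendsto_log_sub_one.eventually_lt_atBot 0] with s hs
  field_simp [hs.ne]
  ring

theorem stmt12 (k : ℕ) (hk : k ∈ ({1, 5, 7, 11} : Set ℕ)) :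
    Filter.Tendsto (fun s : ℝ =>
      (∑' p : {p : ℕ // (p.Prime ∧ ∃ j ∈ ({1, 4, 8} : Set ℤ), ∃ x y : ℤ,
          Int.gcd x y = 1 ∧ x ^ 2 + 216 * y ^ 2 = j * p) ∧ p % 24 = k},
          ((p : ℕ) : ℝ) ^ (-s)) /
      (∑' p : {p : ℕ // p.Prime}, ((p : ℕ) : ℝ) ^ (-s)))
      (nhdsWithin 1 (Set.Ioi 1)) (nhds (1 / 24)) := by
  have hk24 : k < 24 := by
    simp only [Set.mem_insert_iff, Set.mem_singleton_iff] at hk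
    omega
  have hunit : IsUnit (k : ZMod 24) := by
    rcases hk with rfl | rfl | rfl | rfl <;> decide
  have hmod : ∀ n : ℕ, (k : ZMod 24) = n ↔ n % 24 = k := by
    intro n
    rw [eq_comm, ZMod.natCast_eq_natCast_iff, Nat.ModEq, Nat.mod_eq_of_lt hk24]
  have hnum : ∀ s : ℝ, ∑' p : {p : ℕ // (p.Prime ∧ ∃ j ∈ ({1, 4, 8} : Set ℤ), ∃ x y : ℤ,
      Int.gcd x y = 1 ∧ x ^ 2 + 216 * y ^ 2 = j * p) ∧ p % 24 = k}, ((p : ℕ) : ℝ) ^ (-s) =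
      primeSum (fun n => if (k : ZMod 24) = n then (1 + cubicCoeff n) / 3 else 0) s := by
    refine tsum_eq_primeSum (fun n h => h.1.1) (fun p hp h => ?_) (fun p hp h => ?_)
    · rw [if_pos ((hmod p).2 h.2), ← ite_exists_eq hp (by rwa [h.2]), if_pos h.1.2]
    · split_ifs with hc
      · have hpk := (hmod p).1 hc
        rw [← ite_exists_eq hp (by rwa [hpk]), if_neg fun h' => h ⟨⟨hp, h'⟩, hpk⟩]
      · rfl
  have hden : ∀ s : ℝ, ∑' p : {p : ℕ // p.Prime}, ((p : ℕ) : ℝ) ^ (-s) =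
      primeSum (fun _ => 1) s :=
    tsum_eq_primeSum (fun _ h => h) (fun _ _ _ => rfl) fun _ h h' => absurd h h'
  simp only [hnum, hden]
  have hN : (fun s =>
      primeSum (fun n => if (k : ZMod 24) = n then (1 + cubicCoeff n) / 3 else 0) s +
      1 / 24 * Real.log (s - 1)) =O[𝓝[>] 1] (fun _ => (1 : ℝ)) := by
    refine (((isBigO_primeSum_residueClass hunit).add (isBigO_classSum hunit)).const_mul_left
      (1 / 3)).congr' ?_ EventuallyEq.rfl
    filter_upwards [self_mem_nhdsWithin] with s hs
    have h1 : Summable fun p : Nat.Primes =>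
        (if (k : ZMod 24) = ((p : ℕ) : ZMod 24) then (1 : ℝ) else 0) * ((p : ℕ) : ℝ) ^ (-s) :=
      summable_primeSum (a := fun n => if (k : ZMod 24) = n then 1 else 0) (M := 1)
        (fun p _ => by split_ifs <;> norm_num) hs
    have h2 : primeSum (fun n => if (k : ZMod 24) = n then (1 + cubicCoeff n) / 3 else 0) s =
        1 / 3 * (primeSum (fun n => if (k : ZMod 24) = n then 1 else 0) s + classSum k s) := by
      rw [classSum, primeSum, primeSum, primeSum, ← h1.tsum_add (summable_classSum _ hs),
        ← tsum_mul_left]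
      congr 1
      funext p
      split_ifs <;> ring
    rw [h2]
    ring
  have hD : (fun s => primeSum (fun _ => 1) s + 1 * Real.log (s - 1)) =O[𝓝[>] 1]
      (fun _ => (1 : ℝ)) := by
    simpa only [one_mul] using isBigO_primeSum_const_one
  have h := (tendsto_div_log_of_isBigO hN).div (tendsto_div_log_of_isBigO hD) (by norm_num)
  rw [show (-(1 / 24) / -1 : ℝ) = 1 / 24 by norm_num] at h
  refine h.congr' ?_
  filter_upwards [tendsto_log_sub_one.eventually_lt_atBot 0] with s hs
  exact div_div_div_cancel_right₀ hs.ne _ _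
end

section
/- A prime p ≥ 5 belongs to 𝒫 if and only if the Diophantine equation x² + 216y² = p² has a primitive solution, i.e., integers x, y with gcd(x,y) = 1 and x² + 216y² = p². -/
/-- A factorisation of `54 v²` into coprime factors splits up to squares as
`1 · 54` or `2 · 27`. -/
theorem exists_add_eq_of_mul_eq_fiftyFour_mul_sq {s t v : ℕ} (hst : s.Coprime t)
    (h : s * t = 54 * v ^ 2) :
    ∃ a b : ℕ, s + t = a ^ 2 + 54 * b ^ 2 ∨ s + t = 2 * a ^ 2 + 27 * b ^ 2 := by
  have sq_of_mul : ∀ {a b : ℕ}, a.Coprime b → a * b = v ^ 2 →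
      ∃ c d : ℕ, a = c ^ 2 ∧ b = d ^ 2 := by
    intro a b hab hv
    obtain ⟨c, hc⟩ := exists_eq_pow_of_mul_eq_pow (Nat.isUnit_iff.2 hab) hv
    obtain ⟨d, hd⟩ := exists_eq_pow_of_mul_eq_pow (Nat.isUnit_iff.2 hab.symm)
      ((mul_comm b a).trans hv)
    exact ⟨c, d, hc, hd⟩
  wlog h2 : 2 ∣ s generalizing s t
  · have h2t : 2 ∣ t :=
      ((Nat.prime_two.dvd_mul).1 (h ▸ ⟨27 * v ^ 2, by ring⟩)).resolve_left h2
    obtain ⟨a, b, hab⟩ := this hst.symm (by rw [mul_comm, h]) h2t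
    exact ⟨a, b, by rwa [add_comm s t]⟩
  obtain ⟨r, rfl⟩ := h2
  have hrt : r.Coprime t := hst.coprime_mul_left
  have hr : r * t = 27 * v ^ 2 := by linarith
  have h27 : IsPrimePow 27 := Nat.prime_three.isPrimePow.pow (k := 3) (by norm_num)
  rcases (hrt.isPrimePow_dvd_mul h27).1 ⟨_, hr⟩ with ⟨w, rfl⟩ | ⟨w, rfl⟩
  · obtain ⟨c, d, rfl, rfl⟩ := sq_of_mul hrt.coprime_mul_left (by linarith)
    exact ⟨d, c, Or.inl (by ring)⟩
  · obtain ⟨c, d, rfl, rfl⟩ := sq_of_mul hrt.coprime_mul_left_right (by linarith)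
    exact ⟨c, d, Or.inr rfl⟩

/-- A solution of `x² + 216y² = p²` with `y ≠ 0` is primitive. -/
theorem gcd_eq_one_of_sq_add_eq_prime_sq {p : ℕ} (hp : p.Prime) {x y : ℤ} (hy : y ≠ 0)
    (h : x ^ 2 + 216 * y ^ 2 = (p : ℤ) ^ 2) : Int.gcd x y = 1 := by
  have hgp : ((Int.gcd x y : ℕ) : ℤ) ∣ p := by
    rw [← Int.pow_dvd_pow_iff two_ne_zero, ← h]
    exact dvd_add (pow_dvd_pow_of_dvd (Int.gcd_dvd_left x y) 2)
      (Dvd.dvd.mul_left (pow_dvd_pow_of_dvd (Int.gcd_dvd_right x y) 2) _)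
  refine (hp.eq_one_or_self_of_dvd _ (Int.natCast_dvd_natCast.1 hgp)).resolve_right fun hg => ?_
  obtain ⟨z, rfl⟩ : (p : ℤ) ∣ y := hg ▸ Int.gcd_dvd_right x y
  have hp2 : 0 < (p : ℤ) ^ 2 := pow_pos (by exact_mod_cast hp.pos) 2
  have hz : z ≠ 0 := right_ne_zero_of_mul hy
  have hz2 : 0 < z ^ 2 := by positivity
  nlinarith [sq_nonneg x, mul_le_mul_of_nonneg_left (Int.add_one_le_iff.2 hz2) hp2.le]

/-- Squaring a prime value of `m a² + n b²` with `mn = 54` gives a primitive solution. -/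
theorem exists_primitive_of_eq_add {p : ℕ} (hp : p.Prime) {m n a b : ℤ} (hmn : m * n = 54)
    (ha : a ≠ 0) (hb : b ≠ 0) (h : m * a ^ 2 + n * b ^ 2 = p) :
    ∃ x y : ℤ, Int.gcd x y = 1 ∧ x ^ 2 + 216 * y ^ 2 = (p : ℤ) ^ 2 := by
  have key : (m * a ^ 2 - n * b ^ 2) ^ 2 + 216 * (a * b) ^ 2 = (p : ℤ) ^ 2 := by
    rw [← h]
    linear_combination (-4 * (a * b) ^ 2) * hmn
  exact ⟨_, _, gcd_eq_one_of_sq_add_eq_prime_sq hp (mul_ne_zero ha hb) key, key⟩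

/-- A primitive solution of `x² + 216y² = p²` yields `p = a² + 54b²` or `p = 2a² + 27b²`. -/
theorem exists_eq_of_primitive {p u v : ℕ} (hp : p.Prime) (hp5 : 5 ≤ p) (huv : u.Coprime v)
    (h : u ^ 2 + 216 * v ^ 2 = p ^ 2) :
    ∃ a b : ℕ, p = a ^ 2 + 54 * b ^ 2 ∨ p = 2 * a ^ 2 + 27 * b ^ 2 := by
  have hup : u ≤ p := by nlinarith
  have hpodd : Odd p := hp.odd_of_ne_two (by omega)
  have huodd : Odd u := by
    by_contra hu
    rw [Nat.not_odd_iff_even] at hu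
    have : Even (p ^ 2) := h ▸ (hu.pow_of_ne_zero two_ne_zero).add
      (Even.mul_right (by decide) _)
    exact (Nat.not_even_iff_odd.2 hpodd.pow) this
  obtain ⟨s, hs⟩ : ∃ s, p = u + 2 * s := by
    obtain ⟨c, hc⟩ := hpodd
    obtain ⟨d, hd⟩ := huodd
    exact ⟨c - d, by omega⟩
  have hsu : s.Coprime u := by
    have hg : Nat.gcd s u ∣ p := by
      rw [hs]
      exact dvd_add (Nat.gcd_dvd_right s u) (Dvd.dvd.mul_left (Nat.gcd_dvd_left s u) _)
    refine (hp.eq_one_or_self_of_dvd _ hg).resolve_right fun hgp => ?_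
    have hpu : p ≤ u := Nat.le_of_dvd huodd.pos (hgp ▸ Nat.gcd_dvd_right s u)
    obtain rfl : u = p := le_antisymm hup hpu
    obtain rfl : v = 0 := by simpa using h
    rw [Nat.coprime_zero_right] at huv
    omega
  have hmul : s * (s + u) = 54 * v ^ 2 := by
    rw [hs] at h
    linarith
  obtain ⟨a, b, hab⟩ := exists_add_eq_of_mul_eq_fiftyFour_mul_sq
    (by simpa using hsu : s.Coprime (s + u)) hmul
  exact ⟨a, b, by rwa [show p = s + (s + u) by omega]⟩

/-- If a prime is a value of a diagonal binary form, the arguments are coprime. -/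
theorem coprime_of_prime_eq_add {p m n a b : ℕ} (hp : p.Prime)
    (h : p = m * a ^ 2 + n * b ^ 2) : a.Coprime b := by
  have hg : Nat.gcd a b ^ 2 ∣ p := by
    rw [h]
    exact dvd_add (Dvd.dvd.mul_left (pow_dvd_pow_of_dvd (Nat.gcd_dvd_left a b) 2) _)
      (Dvd.dvd.mul_left (pow_dvd_pow_of_dvd (Nat.gcd_dvd_right a b) 2) _)
  exact Nat.isUnit_iff.1 (hp.prime.squarefree _ (sq (Nat.gcd a b) ▸ hg))

theorem stmt13 (p : ℕ) (hp : p.Prime) (hp5 : 5 ≤ p) :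
    (∃ j ∈ ({1, 4, 8} : Set ℤ), ∃ x y : ℤ,
      Int.gcd x y = 1 ∧ x ^ 2 + 216 * y ^ 2 = j * p) ↔
    (∃ x y : ℤ, Int.gcd x y = 1 ∧ x ^ 2 + 216 * y ^ 2 = (p : ℤ) ^ 2) := by
  constructor
  · rintro ⟨j, hj, x, y, hxy, h⟩
    have hx : x ≠ 0 := by
      rintro rfl
      have hy : y.natAbs = 1 := by simpa using hxy
      have hy2 : y ^ 2 = 1 := by rw [← Int.natAbs_sq, hy]; norm_num
      have hp27 : ¬ p = 27 := fun h' => by rw [h'] at hp; norm_num at hp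
      have hp54 : ¬ p = 54 := fun h' => by rw [h'] at hp; norm_num at hp
      have hp216 : ¬ p = 216 := fun h' => by rw [h'] at hp; norm_num at hp
      rcases hj with rfl | rfl | rfl <;> omega
    have hy : y ≠ 0 := by
      rintro rfl
      have hx1 : x.natAbs = 1 := by simpa using hxy
      have hx2 : x ^ 2 = 1 := by rw [← Int.natAbs_sq, hx1]; norm_num
      rcases hj with rfl | rfl | rfl <;> omega
    rcases hj with rfl | rfl | rfl
    · exact exists_primitive_of_eq_add hp (m := 1) (n := 54) (a := x) (b := 2 * y)
        (by norm_num) hx (by omega) (by linarith)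
    · obtain ⟨z, rfl⟩ : (2 : ℤ) ∣ x :=
        Int.prime_two.dvd_of_dvd_pow (n := 2) (by omega)
      exact exists_primitive_of_eq_add hp (m := 1) (n := 54) (a := z) (b := y)
        (by norm_num) (by omega) hy (by linarith)
    · obtain ⟨z, rfl⟩ : (2 : ℤ) ∣ x :=
        Int.prime_two.dvd_of_dvd_pow (n := 2) (by omega)
      obtain ⟨w, rfl⟩ : (2 : ℤ) ∣ z :=
        Int.prime_two.dvd_of_dvd_pow (n := 2) (by rw [mul_pow] at h; omega)
      exact exists_primitive_of_eq_add hp (m := 2) (n := 27) (a := w) (b := y)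
        (by norm_num) (by omega) hy (by linarith)
  · rintro ⟨x, y, hxy, h⟩
    have hN : x.natAbs ^ 2 + 216 * y.natAbs ^ 2 = p ^ 2 := by
      zify
      simpa using h
    have hpodd : ¬ 2 ∣ p := fun h2 => by
      have := (Nat.prime_dvd_prime_iff_eq Nat.prime_two hp).1 h2
      omega
    obtain ⟨a, b, hab | hab⟩ := exists_eq_of_primitive hp hp5 hxy hN
    · have hcop : a.Coprime b := coprime_of_prime_eq_add (m := 1) hp (by rw [hab, one_mul])
      by_cases hb : 2 ∣ b
      · obtain ⟨c, rfl⟩ := hb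
        refine ⟨1, by simp, a, c, hcop.coprime_mul_left_right, ?_⟩
        rw [hab]
        push_cast
        ring
      · refine ⟨4, by simp, (2 * a : ℕ), b, ?_, ?_⟩
        · exact (Nat.prime_two.coprime_iff_not_dvd.2 hb).mul_left hcop
        · rw [hab]
          push_cast
          ring
    · have hcop : a.Coprime b := coprime_of_prime_eq_add hp hab
      have hb : ¬ 2 ∣ b := fun hb => hpodd (hab ▸ dvd_add (dvd_mul_right _ _)
        (Dvd.dvd.mul_left (dvd_pow hb two_ne_zero) _))
      refine ⟨8, by simp, (4 * a : ℕ), b, ?_, ?_⟩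
      · exact (Nat.Coprime.pow_left 2 (Nat.prime_two.coprime_iff_not_dvd.2 hb)).mul_left
          hcop
      · rw [hab]
        push_cast
        ring
end

section
/- If p is a prime in 𝒫, then b₃((p² − 1)/12) is odd. -/
/-- The number of 3-regular partitions of `n`, i.e. partitions with no part divisible by 3. -/
noncomputable def b3 (n : ℕ) : ℕ := Nat.card {p : Nat.Partition n // ∀ i ∈ p.parts, ¬ (3 ∣ i)}

open PowerSeries Finset

theorem coeff_mul_expand {R : Type*} [CommRing R] (d : ℕ) (hd : d ≠ 0) (f g : R⟦X⟧) (n : ℕ) :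
    coeff n (f * expand d hd g) =
      ∑ p ∈ range (n + 1) ×ˢ range (n + 1) with p.1 + d * p.2 = n, coeff p.1 f * coeff p.2 g := by
  rw [coeff_mul]
  symm
  apply sum_of_injOn (fun p ↦ (p.1, d * p.2))
  · rintro ⟨a, b⟩ - ⟨a', b'⟩ - h
    simp only [Prod.mk.injEq] at h
    simp only [Prod.mk.injEq]
    exact ⟨h.1, Nat.eq_of_mul_eq_mul_left (Nat.pos_of_ne_zero hd) h.2⟩
  · rintro ⟨a, b⟩ h
    simpa using (mem_filter.mp h).2
  · rintro ⟨a, b⟩ h h'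
    rw [HasAntidiagonal.mem_antidiagonal] at h
    simp only at h ⊢
    rw [coeff_expand_of_not_dvd, mul_zero]
    rintro ⟨c, rfl⟩
    refine h' ⟨(a, c), ?_, rfl⟩
    have : c ≤ d * c := Nat.le_mul_of_pos_left c (Nat.pos_of_ne_zero hd)
    simp
    omega
  · intro p _
    simp

/-- The series `∑ a₂ₙ Xⁿ` obtained from `∑ aₙ Xⁿ`. -/
noncomputable def evenPart {R : Type*} [CommRing R] (f : R⟦X⟧) : R⟦X⟧ := .mk fun n ↦ coeff (2 * n) f

theorem evenPart_mul_expand {R : Type*} [CommRing R] (f g : R⟦X⟧) :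
    evenPart (f * expand 2 two_ne_zero g) = evenPart f * g := by
  ext n
  rw [evenPart, coeff_mk, coeff_mul_expand, coeff_mul]
  symm
  apply sum_bij (fun p _ ↦ (2 * p.1, p.2))
  · rintro ⟨a, b⟩ h
    rw [HasAntidiagonal.mem_antidiagonal] at h
    simp at h ⊢
    omega
  · rintro ⟨a, b⟩ - ⟨a', b'⟩ - h
    simp at h ⊢
    omega
  · rintro ⟨a, b⟩ h
    simp only [mem_filter, mem_product, mem_range] at h
    exact ⟨(n - b, b), by simp; omega, by simp; omega⟩
  · intro p _
    simp [evenPart]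

theorem expand_two_eq_sq (f : (ZMod 2)⟦X⟧) : expand 2 two_ne_zero f = f ^ 2 := by
  have h := MvPowerSeries.map_frobenius_expand 2 two_ne_zero (f := f)
  rw [ZMod.frobenius_zmod] at h
  simpa [expand] using h

open scoped PowerSeries.WithPiTopology in
theorem continuous_expand {R : Type*} [CommRing R] [TopologicalSpace R] (d : ℕ) (hd : d ≠ 0) :
    Continuous (expand d hd : R⟦X⟧ → R⟦X⟧) := by
  rw [continuous_iff_continuousAt]
  intro f
  rw [ContinuousAt, WithPiTopology.tendsto_iff_coeff_tendsto]
  intro n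
  simp_rw [coeff_expand]
  split_ifs
  · exact (WithPiTopology.continuous_coeff R _).continuousAt
  · exact tendsto_const_nhds

open scoped PowerSeries.WithPiTopology in
theorem mk_card_restricted_mul_pentagonalSeries (R : Type*) [CommRing R] (m : ℕ) (hm : m ≠ 0) :
    (PowerSeries.mk fun n ↦ (#(Nat.Partition.restricted n (¬ m ∣ ·)) : R)) * pentagonalSeries R =
      expand m hm (pentagonalSeries R) := by
  let _ : TopologicalSpace R := ⊥
  have _ : DiscreteTopology R := ⟨rfl⟩
  have h₁ := (Nat.Partition.hasProd_powerSeriesMk_card_restricted R (¬ m ∣ ·)).mul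
    (WithPiTopology.hasProd_one_sub_X_pow R)
  have h₂ := (WithPiTopology.hasProd_one_sub_X_pow R).map (expand m hm) (continuous_expand m hm)
  refine h₁.unique ?_
  have inj : Function.Injective fun i ↦ (i + 1) * m - 1 := by
    intro a b h
    have ha : 0 < (a + 1) * m := by positivity
    have hb : 0 < (b + 1) * m := by positivity
    have : (a + 1) * m = (b + 1) * m := by simp only at h; omega
    simpa [hm] using this
  rw [← inj.hasProd_iff]
  · convert! h₂ using 1
    ext1 i
    have : (i + 1) * m - 1 + 1 = (i + 1) * m := by
      have : 0 < (i + 1) * m := by positivity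
      omega
    simp [this, ← pow_mul, mul_comm m]
  · intro i hi
    have : ¬ m ∣ i + 1 := by
      rintro ⟨c, hc⟩
      apply hi
      obtain ⟨c, rfl⟩ : ∃ k, c = k + 1 := Nat.exists_eq_succ_of_ne_zero (by rintro rfl; simp at hc)
      exact ⟨c, by simp only; rw [mul_comm, ← hc]; rfl⟩
    rw [if_pos this]
    simp_rw [pow_mul]
    exact WithPiTopology.tsum_pow_mul_one_sub_of_constantCoeff_eq_zero (by simp)

theorem b3_eq (n : ℕ) : b3 n = #(Nat.Partition.restricted n (¬ 3 ∣ ·)) := by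
  simp [b3, Nat.Partition.restricted, Fintype.card_subtype]

theorem exists_pentagonal_eq_iff (n : ℕ) : (∃ k, pentagonal k = n) ↔ IsSquare (24 * n + 1) := by
  constructor
  · rintro ⟨k, rfl⟩
    refine ⟨(6 * k - 1).natAbs, ?_⟩
    zify
    rw [abs_mul_abs_self]
    linear_combination 12 * two_mul_natCast_pentagonal k
  · rintro ⟨r, hr⟩
    have h : r % 6 = 1 ∨ r % 6 = 5 := by
      have h1 : r * r % 24 = 1 := by omega
      rw [Nat.mul_mod] at h1
      have : r % 24 < 24 := Nat.mod_lt _ (by norm_num)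
      have h2 : r % 24 % 6 = r % 6 := by omega
      rw [← h2]
      generalize r % 24 = s at *
      interval_cases s <;> simp_all
    obtain ⟨k, hk⟩ : ∃ k : ℤ, (6 * k - 1) ^ 2 = r ^ 2 := by
      rcases h with h | h
      · exact ⟨-(r / 6 : ℕ), by rw [← neg_sq]; congr 1; omega⟩
      · exact ⟨(r / 6 : ℕ) + 1, by congr 1; omega⟩
    refine ⟨k, ?_⟩
    have := two_mul_natCast_pentagonal k
    zify at hr ⊢
    linarith

theorem coeff_pentagonalSeries_zmod_two (n : ℕ) [Decidable (IsSquare (24 * n + 1))] :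
    coeff n (pentagonalSeries (ZMod 2)) = if IsSquare (24 * n + 1) then 1 else 0 := by
  split_ifs with h
  · obtain ⟨k, rfl⟩ := (exists_pentagonal_eq_iff n).mpr h
    rw [coeff_pentagonalSeries_pentagonal]
    rcases Int.units_eq_one_or k.negOnePow with h | h <;> rw [h] <;> decide
  · exact coeff_pentagonalSeries_eq_zero _ fun hn ↦ h ((exists_pentagonal_eq_iff n).mp hn)

theorem emod_three_of_dvd_sq_sub_one {x : ℤ} (h : x ^ 2 % 24 = 1) : x % 3 = 1 ∨ x % 3 = 2 := by
  rcases (by omega : x % 3 = 0 ∨ x % 3 = 1 ∨ x % 3 = 2) with h0 | h0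
  · obtain ⟨y, rfl⟩ := Int.dvd_of_emod_eq_zero h0
    have : (3 * y) ^ 2 = 3 * (3 * y ^ 2) := by ring
    omega
  · exact h0

theorem sq_emod_twenty_four {x : ℤ} (h2 : x % 2 = 1) (h3 : x % 3 ≠ 0) : x ^ 2 % 24 = 1 := by
  have : x % 24 = 1 ∨ x % 24 = 5 ∨ x % 24 = 7 ∨ x % 24 = 11 ∨ x % 24 = 13 ∨ x % 24 = 17 ∨
      x % 24 = 19 ∨ x % 24 = 23 := by omega
  rcases this with h | h | h | h | h | h | h | h <;> simp [pow_two, Int.mul_emod, h]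

theorem exists_emod_three_eq_one_of_isSquare {i : ℕ} (h : IsSquare (24 * i + 1)) :
    ∃ x : ℤ, x % 3 = 1 ∧ x ^ 2 = 24 * i + 1 := by
  obtain ⟨r, hr⟩ := h
  have hr' : (r : ℤ) ^ 2 = 24 * i + 1 := by rw [pow_two]; exact_mod_cast hr.symm
  rcases emod_three_of_dvd_sq_sub_one (x := r) (by omega) with h | h
  · exact ⟨r, h, hr'⟩
  · exact ⟨-r, by omega, by rw [neg_sq, hr']⟩

theorem isSquare_of_sq_eq {i : ℕ} {x : ℤ} (h : x ^ 2 = 24 * i + 1) : IsSquare (24 * i + 1) :=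
  ⟨x.natAbs, by zify; rw [abs_mul_abs_self, ← pow_two, h]⟩

theorem emod_two_of_sq_add_eight_mul_sq {a k : ℤ} {n : ℕ} (h : a ^ 2 + 8 * k ^ 2 = 8 * n + 1) :
    a % 2 = 1 := by
  by_contra h0
  obtain ⟨y, rfl⟩ := Int.dvd_of_emod_eq_zero (by omega : a % 2 = 0)
  have : (2 * y) ^ 2 = 2 * (2 * y ^ 2) := by ring
  omega

theorem eq_of_sq_eq_of_emod_three {x y : ℤ} (h : x ^ 2 = y ^ 2) (hx : x % 3 = 1)
    (hy : y % 3 = 1) : x = y := by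
  rcases sq_eq_sq_iff_eq_or_eq_neg.mp h with h | h <;> omega

/-- The integral solutions of `a² + 8k² = 8n + 1`. -/
noncomputable def normSolutions (n : ℕ) : Finset (ℤ × ℤ) :=
  {p ∈ Icc (-(8 * n + 1 : ℤ)) (8 * n + 1) ×ˢ Icc (-(8 * n + 1 : ℤ)) (8 * n + 1) |
    p.1 ^ 2 + 8 * p.2 ^ 2 = 8 * n + 1}

theorem mem_normSolutions {n : ℕ} {p : ℤ × ℤ} :
    p ∈ normSolutions n ↔ p.1 ^ 2 + 8 * p.2 ^ 2 = 8 * n + 1 := by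
  rw [normSolutions, mem_filter, and_iff_right_iff_imp]
  intro h
  simp only [mem_product, mem_Icc]
  refine ⟨⟨?_, ?_⟩, ?_, ?_⟩ <;> nlinarith [sq_nonneg p.1, sq_nonneg p.2,
    sq_nonneg (p.1 - 1), sq_nonneg (p.1 + 1), sq_nonneg (p.2 - 1), sq_nonneg (p.2 + 1)]

theorem sum_normSolutions_eq (n : ℕ) :
    (#{p ∈ normSolutions n | (p.1 - p.2) % 3 = 1} : ZMod 2) =
      #{p ∈ normSolutions n | p.1 % 3 = 1 ∧ (p.2 = 0 ∨ p.2 % 3 = 1)} := by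
  rw [← CharTwo.add_eq_zero, card_filter, card_filter]
  push_cast
  rw [← sum_add_distrib]
  apply sum_involution (fun p _ ↦ if p.2 % 3 = 0 then (p.1, -p.2) else (-p.1, p.2))
  · rintro ⟨a, k⟩ -
    by_cases hk : k % 3 = 0 <;> simp only [hk, if_true, if_false] <;>
    split_ifs <;> first | rfl | omega
  · rintro ⟨a, k⟩ h hne
    have := emod_two_of_sq_add_eight_mul_sq (mem_normSolutions.mp h)
    simp only at hne this ⊢
    split_ifs with hk
    · intro heq
      obtain rfl : k = 0 := by
        have := congrArg Prod.snd heq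
        simp only at this
        omega
      by_cases ha : a % 3 = 1 <;> simp [ha, CharTwo.add_self_eq_zero] at hne
    · intro heq
      have := congrArg Prod.fst heq
      simp only at this
      omega
  · rintro ⟨a, k⟩ h
    by_cases hk : k % 3 = 0
    · have hk' : -k % 3 = 0 := by omega
      simp only [hk, hk', if_true, neg_neg]
    · simp only [hk, if_false, neg_neg]
  · rintro ⟨a, k⟩ h
    rw [mem_normSolutions] at h ⊢
    split_ifs <;> simpa using h

open Classical in
theorem card_sq_add_two_mul_sq (n : ℕ) :
    #{p ∈ range (n + 1) ×ˢ range (n + 1) |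
      p.1 + 2 * p.2 = n ∧ IsSquare (24 * p.1 + 1) ∧ IsSquare (24 * p.2 + 1)} =
    #{p ∈ normSolutions n | (p.1 - p.2) % 3 = 1} := by
  symm
  have key {a k : ℤ} (h : a ^ 2 + 8 * k ^ 2 = 8 * n + 1) (h3 : (a - k) % 3 = 1) :
      ((((a - 4 * k) ^ 2 - 1) / 24).toNat * 24 + 1 : ℤ) = (a - 4 * k) ^ 2 ∧
      ((((a + 2 * k) ^ 2 - 1) / 24).toNat * 24 + 1 : ℤ) = (a + 2 * k) ^ 2 := by
    have h2 := emod_two_of_sq_add_eight_mul_sq h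
    have hx := sq_emod_twenty_four (x := a - 4 * k) (by omega) (by omega)
    have hy := sq_emod_twenty_four (x := a + 2 * k) (by omega) (by omega)
    have := sq_nonneg (a - 4 * k)
    have := sq_nonneg (a + 2 * k)
    omega
  apply card_bij (fun p _ ↦
    ((((p.1 - 4 * p.2) ^ 2 - 1) / 24).toNat, (((p.1 + 2 * p.2) ^ 2 - 1) / 24).toNat))
  · rintro ⟨a, k⟩ h
    rw [mem_filter, mem_normSolutions] at h
    obtain ⟨h, h3⟩ := h
    simp only at h h3
    obtain ⟨hx, hy⟩ := key h h3
    simp only [mem_filter, mem_product, mem_range]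
    have : (a - 4 * k) ^ 2 + 2 * (a + 2 * k) ^ 2 = 24 * n + 3 := by linear_combination 3 * h
    exact ⟨by omega, by omega, isSquare_of_sq_eq (x := a - 4 * k) (by omega),
      isSquare_of_sq_eq (x := a + 2 * k) (by omega)⟩
  · rintro ⟨a, k⟩ h ⟨a', k'⟩ h' heq
    rw [mem_filter, mem_normSolutions] at h h'
    obtain ⟨h, h3⟩ := h
    obtain ⟨h', h3'⟩ := h'
    simp only at h h3 h' h3'
    obtain ⟨hx, hy⟩ := key h h3
    obtain ⟨hx', hy'⟩ := key h' h3'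
    simp only [Prod.mk.injEq] at heq ⊢
    rw [heq.1, hx'] at hx
    rw [heq.2, hy'] at hy
    have := eq_of_sq_eq_of_emod_three hx (by omega) (by omega)
    have := eq_of_sq_eq_of_emod_three hy (by omega) (by omega)
    omega
  · rintro ⟨i, j⟩ h
    simp only [mem_filter, mem_product, mem_range] at h
    obtain ⟨-, h, hi, hj⟩ := h
    obtain ⟨x, hx3, hx⟩ := exists_emod_three_eq_one_of_isSquare hi
    obtain ⟨y, hy3, hy⟩ := exists_emod_three_eq_one_of_isSquare hj
    have hx2 := emod_two_of_sq_add_eight_mul_sq (a := x) (k := 0) (n := 3 * i)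
      (by push_cast; linarith)
    have hy2 := emod_two_of_sq_add_eight_mul_sq (a := y) (k := 0) (n := 3 * j)
      (by push_cast; linarith)
    obtain ⟨a, k, rfl, rfl⟩ : ∃ a k : ℤ, x = a - 4 * k ∧ y = a + 2 * k :=
      ⟨(x + 2 * y) / 3, (y - x) / 6, by omega, by omega⟩
    refine ⟨(a, k), ?_, ?_⟩
    · rw [mem_filter, mem_normSolutions]
      zify at h
      exact ⟨by linarith, by omega⟩
    · simp only [Prod.mk.injEq]
      omega

open Classical in
theorem card_sq_add_three_mul (n : ℕ) :
    #{p ∈ range (n + 1) ×ˢ range (n + 1) |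
      p.1 + 3 * p.2 = n ∧ (p.1 = 0 ∨ IsSquare p.1 ∧ ¬ 3 ∣ p.1) ∧ IsSquare (24 * p.2 + 1)} =
    #{p ∈ normSolutions n | p.1 % 3 = 1 ∧ (p.2 = 0 ∨ p.2 % 3 = 1)} := by
  symm
  have key {a k : ℤ} (h : a ^ 2 + 8 * k ^ 2 = 8 * n + 1) (h3 : a % 3 = 1) :
      ((k ^ 2).toNat : ℤ) = k ^ 2 ∧ (((a ^ 2 - 1) / 24).toNat * 24 + 1 : ℤ) = a ^ 2 := by
    have h2 := emod_two_of_sq_add_eight_mul_sq h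
    have hx := sq_emod_twenty_four (x := a) (by omega) (by omega)
    have := sq_nonneg a
    have := sq_nonneg k
    omega
  apply card_bij (fun p _ ↦ ((p.2 ^ 2).toNat, ((p.1 ^ 2 - 1) / 24).toNat))
  · rintro ⟨a, k⟩ h
    rw [mem_filter, mem_normSolutions] at h
    obtain ⟨h, h3, hk⟩ := h
    simp only at h h3 hk
    obtain ⟨hx, hy⟩ := key h h3
    simp only [mem_filter, mem_product, mem_range]
    refine ⟨by omega, by omega, ?_, isSquare_of_sq_eq (x := a) (by omega)⟩
    rcases hk with rfl | hk
    · simp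
    · right
      constructor
      · exact ⟨k.natAbs, by zify; rw [abs_mul_abs_self, hx, pow_two]⟩
      · zify
        rw [hx]
        intro h
        have := Int.prime_three.dvd_of_dvd_pow h
        omega
  · rintro ⟨a, k⟩ h ⟨a', k'⟩ h' heq
    rw [mem_filter, mem_normSolutions] at h h'
    obtain ⟨h, h3, hk⟩ := h
    obtain ⟨h', h3', hk'⟩ := h'
    simp only at h h3 h' h3' hk hk'
    obtain ⟨hx, hy⟩ := key h h3
    obtain ⟨hx', hy'⟩ := key h' h3'
    simp only [Prod.mk.injEq] at heq ⊢
    rw [heq.1, hx'] at hx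
    rw [heq.2, hy'] at hy
    have := eq_of_sq_eq_of_emod_three hy (by omega) (by omega)
    rcases sq_eq_sq_iff_eq_or_eq_neg.mp hx with h | h <;> omega
  · rintro ⟨i, j⟩ h
    simp only [mem_filter, mem_product, mem_range] at h
    obtain ⟨-, h, hi, hj⟩ := h
    obtain ⟨y, hy3, hy⟩ := exists_emod_three_eq_one_of_isSquare hj
    obtain ⟨k, hk, hki⟩ : ∃ k : ℤ, (k = 0 ∨ k % 3 = 1) ∧ k ^ 2 = i := by
      rcases hi with rfl | ⟨⟨r, rfl⟩, hr⟩
      · exact ⟨0, by simp⟩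
      · have : ¬ 3 ∣ r := fun h ↦ hr (h.mul_right r)
        rcases (by omega : r % 3 = 1 ∨ r % 3 = 2) with h | h
        · exact ⟨r, by omega, by push_cast; ring⟩
        · exact ⟨-r, by omega, by push_cast; ring⟩
    refine ⟨(y, k), ?_, ?_⟩
    · rw [mem_filter, mem_normSolutions]
      zify at h
      exact ⟨by simp only; linarith, hy3, hk⟩
    · simp only [Prod.mk.injEq]
      omega

open Classical in
/-- The series `1 + ∑ X ^ k²`, the sum being over the `k ≥ 1` not divisible by 3. -/
noncomputable def squareSeries : (ZMod 2)⟦X⟧ :=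
  .mk fun n ↦ if n = 0 ∨ IsSquare n ∧ ¬ 3 ∣ n then 1 else 0

theorem pentagonalSeries_pow_three :
    pentagonalSeries (ZMod 2) ^ 3 =
      squareSeries * expand 3 three_ne_zero (pentagonalSeries (ZMod 2)) := by
  classical
  rw [pow_succ', ← expand_two_eq_sq]
  ext n
  rw [coeff_mul_expand, coeff_mul_expand]
  simp_rw [coeff_pentagonalSeries_zmod_two, squareSeries, coeff_mk, ite_zero_mul_ite_zero, mul_one]
  rw [sum_boole, sum_boole, filter_filter, filter_filter, card_sq_add_two_mul_sq,
    card_sq_add_three_mul, sum_normSolutions_eq]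

theorem evenPart_squareSeries : evenPart squareSeries = squareSeries ^ 2 := by
  classical
  rw [← expand_two_eq_sq]
  ext n
  rw [evenPart, coeff_mk, coeff_expand]
  simp only [squareSeries, coeff_mk]
  rw [← ite_and]
  congr 1
  rw [eq_iff_iff]
  constructor
  · rintro (h | ⟨⟨r, hr⟩, h⟩)
    · obtain rfl : n = 0 := by omega
      simp
    · obtain ⟨s, rfl⟩ : 2 ∣ r := by
        have : 2 ∣ r * r := ⟨n, hr.symm⟩
        simpa [Nat.prime_two.dvd_mul] using this
      obtain rfl : n = 2 * (s * s) := by linarith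
      refine ⟨⟨_, rfl⟩, .inr ⟨⟨s, by simp⟩, ?_⟩⟩
      omega
  · rintro ⟨⟨m, rfl⟩, h⟩
    rw [Nat.mul_div_cancel_left _ two_pos] at h
    rcases h with rfl | ⟨⟨s, rfl⟩, h⟩
    · simp
    · exact .inr ⟨⟨2 * s, by ring⟩, by omega⟩

theorem squareSeries_ne_zero : squareSeries ≠ 0 := by
  intro h
  simpa [squareSeries] using congrArg (coeff 0) h

theorem evenPart_mk_card_restricted :
    evenPart (PowerSeries.mk fun n ↦ (#(Nat.Partition.restricted n (¬ 3 ∣ ·)) : ZMod 2)) =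
      squareSeries * pentagonalSeries (ZMod 2) := by
  set F := PowerSeries.mk fun n ↦ (#(Nat.Partition.restricted n (¬ 3 ∣ ·)) : ZMod 2)
  have hF : F * pentagonalSeries (ZMod 2) = expand 3 three_ne_zero (pentagonalSeries (ZMod 2)) :=
    mk_card_restricted_mul_pentagonalSeries (ZMod 2) 3 three_ne_zero
  have hP : pentagonalSeries (ZMod 2) ≠ 0 := by
    intro h
    simpa [coeff_pentagonalSeries_zmod_two] using congrArg (coeff 0) h
  have h₁ : F * squareSeries = pentagonalSeries (ZMod 2) ^ 2 := by
    apply mul_right_cancel₀ hP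
    rw [← pow_succ, pentagonalSeries_pow_three, ← hF]
    ring
  have h₂ : F * expand 2 two_ne_zero squareSeries =
      squareSeries * expand 2 two_ne_zero (pentagonalSeries (ZMod 2)) := by
    rw [expand_two_eq_sq, expand_two_eq_sq, ← h₁]
    ring
  apply mul_right_cancel₀ squareSeries_ne_zero
  rw [← evenPart_mul_expand, h₂, evenPart_mul_expand, evenPart_squareSeries]
  ring

theorem eq_of_sq_add_mul_sq_eq {p d a b x y : ℤ} (hp : Prime p) (hp2 : ¬ p ∣ 2) (hp0 : 0 < p)
    (hd : 2 ≤ d) (ha : 0 < a) (hb : 0 < b) (hx : 0 < x) (hy : 0 < y)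
    (h : a ^ 2 + d * b ^ 2 = p ^ 2) (h' : x ^ 2 + d * y ^ 2 = p ^ 2) : b = y := by
  have hprod : (a * y - b * x) * (a * y + b * x) = p ^ 2 * (y ^ 2 - b ^ 2) := by
    linear_combination y ^ 2 * h - b ^ 2 * h'
  have hdvd : p ^ 2 ∣ (a * y - b * x) * (a * y + b * x) := ⟨_, hprod⟩
  have hap : a < p := by
    have : 0 < d * b ^ 2 := by positivity
    exact lt_of_pow_lt_pow_left₀ 2 hp0.le (by linarith)
  have hyp : y < p := by
    have : 0 < x ^ 2 := by positivity
    exact lt_of_pow_lt_pow_left₀ 2 hp0.le (by nlinarith [sq_nonneg y])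
  have hlt : a * y + b * x < p ^ 2 := by
    have h4 : (a * x - d * b * y) ^ 2 + d * (a * y + b * x) ^ 2 = (p ^ 2) ^ 2 := by
      linear_combination (x ^ 2 + d * y ^ 2) * h + p ^ 2 * h'
    have : 0 < (a * y + b * x) ^ 2 := by positivity
    exact lt_of_pow_lt_pow_left₀ 2 (by positivity) (by nlinarith [sq_nonneg (a * x - d * b * y)])
  have hpos : 0 < a * y + b * x := by positivity
  have hzero : a * y - b * x = 0 := by
    by_cases hu : p ∣ a * y - b * x
    · by_cases hv : p ∣ a * y + b * x
      · have : p ∣ 2 * (a * y) := by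
          convert! dvd_add hu hv using 1
          ring
        rcases hp.dvd_or_dvd this with h2 | h2
        · exact absurd h2 hp2
        · rcases hp.dvd_or_dvd h2 with h2 | h2 <;> have := Int.le_of_dvd (by assumption) h2 <;> omega
      · have := hp.pow_dvd_of_dvd_mul_right 2 hv hdvd
        refine Int.eq_zero_of_abs_lt_dvd this ?_
        have : 0 < a * y := by positivity
        have : 0 < b * x := by positivity
        rw [abs_lt]
        constructor <;> linarith
    · have := Int.le_of_dvd hpos (hp.pow_dvd_of_dvd_mul_left 2 hu hdvd)
      omega
  rw [hzero, zero_mul, eq_comm, mul_eq_zero, sub_eq_zero] at hprod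
  have := hprod.resolve_left (by positivity)
  exact ((pow_left_inj₀ hy.le hb.le two_ne_zero).mp this).symm

/-- A prime of which a suitable multiple is a value of `x² + 216y²` has its square represented by
the same form. -/
theorem exists_sq_add_mul_sq_eq_sq {p : ℕ} (hp : p.Prime) {j x y : ℤ}
    (hj : j ∈ ({1, 4, 8} : Set ℤ)) (hxy : Int.gcd x y = 1) (h : x ^ 2 + 216 * y ^ 2 = j * p) :
    27 ≤ p ∧ ∃ X Y : ℤ, Y ≠ 0 ∧ X ^ 2 + 216 * Y ^ 2 = p ^ 2 := by
  have hp1 := hp.two_le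
  have hj' : j = 1 ∨ j = 4 ∨ j = 8 := hj
  have hy : y ≠ 0 := by
    rintro rfl
    rw [Int.gcd_zero_right] at hxy
    have : x ^ 2 = 1 := by rw [← Int.natAbs_sq, hxy]; rfl
    rcases hj' with rfl | rfl | rfl <;> omega
  have hx : x ≠ 0 := by
    rintro rfl
    rw [Int.gcd_zero_left] at hxy
    have : y ^ 2 = 1 := by rw [← Int.natAbs_sq, hxy]; rfl
    have : p = 216 ∨ p = 54 ∨ p = 27 := by rcases hj' with rfl | rfl | rfl <;> omega
    rcases this with rfl | rfl | rfl <;> norm_num at hp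
  have hy0 : 0 < y ^ 2 := by positivity
  have hx0 : 0 < x ^ 2 := by positivity
  refine ⟨by rcases hj' with rfl | rfl | rfl <;> omega, ?_⟩
  rcases hj' with rfl | rfl | rfl
  · refine ⟨x ^ 2 - 216 * y ^ 2, 2 * x * y, by positivity, ?_⟩
    rw [one_mul] at h
    rw [← h]
    ring
  · obtain ⟨u, rfl⟩ : 2 ∣ x := Int.prime_two.dvd_of_dvd_pow (n := 2) (by omega)
    refine ⟨u ^ 2 - 54 * y ^ 2, u * y, mul_ne_zero (by rintro rfl; simp at hx) hy, ?_⟩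
    have : u ^ 2 + 54 * y ^ 2 = p := by linarith
    rw [← this]
    ring
  · obtain ⟨u, rfl⟩ : 2 ∣ x := Int.prime_two.dvd_of_dvd_pow (n := 2) (by omega)
    obtain ⟨w, rfl⟩ : 2 ∣ u := Int.prime_two.dvd_of_dvd_pow (n := 2) (by rw [mul_pow] at h; omega)
    refine ⟨2 * w ^ 2 - 27 * y ^ 2, w * y, mul_ne_zero (by rintro rfl; simp at hx) hy, ?_⟩
    have : 2 * w ^ 2 + 27 * y ^ 2 = p := by linarith
    rw [← this]
    ring

theorem odd_b3_of_sq_eq {p X Y : ℤ} {n m : ℕ} (hp : Prime p) (hp0 : 0 < p) (hn : n = 2 * m)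
    (hm : p ^ 2 = 24 * m + 1) (hY : Y ≠ 0) (h : X ^ 2 + 216 * Y ^ 2 = p ^ 2) :
    Odd (b3 n) := by
  classical
  have hX : X ≠ 0 := by
    rintro rfl
    omega
  have hp2 : ¬ p ∣ 2 := by
    intro h2
    have := Int.le_of_dvd two_pos h2
    interval_cases p
    · exact hp.not_isUnit isUnit_one
    · omega
  rw [← ZMod.natCast_eq_one_iff_odd, b3_eq, hn]
  have h₁ := congrArg (coeff m) evenPart_mk_card_restricted
  rw [evenPart, coeff_mk, coeff_mk] at h₁
  rw [h₁, coeff_mul, sum_eq_single_of_mem (0, m)]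
  · simp [squareSeries, coeff_pentagonalSeries_zmod_two, isSquare_of_sq_eq hm]
  · simp
  · rintro ⟨j, i⟩ hij hne
    rw [HasAntidiagonal.mem_antidiagonal] at hij
    simp only at hij
    simp only [squareSeries, coeff_mk, coeff_pentagonalSeries_zmod_two, ite_zero_mul_ite_zero]
    refine if_neg ?_
    rintro ⟨rfl | ⟨⟨k, rfl⟩, h3⟩, a, ha⟩
    · exact hne (by simpa using hij)
    · apply h3
      have hk : 0 < k := by
        rcases Nat.eq_zero_or_pos k with rfl | hk
        · simp at h3
        · exact hk
      have ha0 : 0 < a := Nat.pos_of_ne_zero (by rintro rfl; simp at ha)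
      have hsum : (a : ℤ) ^ 2 + 24 * (k : ℤ) ^ 2 = p ^ 2 := by
        zify at hij ha
        rw [hm]
        linarith
      have := eq_of_sq_add_mul_sq_eq (x := |X|) (y := 3 * |Y|) hp hp2 hp0 (by norm_num)
        (by exact_mod_cast ha0) (by exact_mod_cast hk) (by positivity) (by positivity) hsum
        (by rw [mul_pow, sq_abs, sq_abs]; linarith)
      exact Dvd.dvd.mul_right (by omega) k

theorem stmt14 (p : ℕ) (hp : p.Prime)
    (hP : ∃ j ∈ ({1, 4, 8} : Set ℤ), ∃ x y : ℤ,
      Int.gcd x y = 1 ∧ x ^ 2 + 216 * y ^ 2 = j * p) :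
    Odd (b3 ((p ^ 2 - 1) / 12)) := by
  obtain ⟨j, hj, x, y, hxy, h⟩ := hP
  obtain ⟨hp27, X, Y, hY, hXY⟩ := exists_sq_add_mul_sq_eq_sq hp hj hxy h
  have hmod : (p : ℤ) ^ 2 % 24 = 1 := by
    apply sq_emod_twenty_four
    · have := hp.eq_one_or_self_of_dvd 2
      omega
    · have := hp.eq_one_or_self_of_dvd 3
      omega
  have hmod' : p ^ 2 % 24 = 1 := by exact_mod_cast hmod
  refine odd_b3_of_sq_eq (m := (p ^ 2 - 1) / 24) (Nat.prime_iff_prime_int.mp hp)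
    (by exact_mod_cast hp.pos) (by omega) ?_ hY hXY
  have : p ^ 2 = 24 * ((p ^ 2 - 1) / 24) + 1 := by omega
  exact_mod_cast this
end

section
/- Let S₁ and S₂ be sets of positive integers forming an Euler pair, i.e., for every n ≥ 0 the number of partitions of n into distinct parts from S₁ equals the number of partitions of n with parts from S₂. Then for every n ≥ 0, qₑ(S₂;n) − q₀(S₂;n) = pₑ(S₁;n) − p₀(S₁;n), where qₑ(S₂;n) (resp. q₀(S₂;n)) is the number of partitions of n into distinct parts from S₂ with an even (resp. odd) number of parts, and pₑ(S₁;n) (resp. p₀(S₁;n)) is the number of partitions of n with parts from S₁ with an even (resp. odd) number of parts. -/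
/-- Number of partitions of `n` with all parts in `S`. -/
noncomputable def pIn (S : Set ℕ) (n : ℕ) : ℕ :=
  Nat.card {p : Nat.Partition n // ∀ i ∈ p.parts, i ∈ S}

/-- Number of partitions of `n` into distinct parts, all in `S`. -/
noncomputable def qIn (S : Set ℕ) (n : ℕ) : ℕ :=
  Nat.card {p : Nat.Partition n // p.parts.Nodup ∧ ∀ i ∈ p.parts, i ∈ S}

/-- Number of partitions of `n` with all parts in `S` and an even number of parts. -/
noncomputable def pInE (S : Set ℕ) (n : ℕ) : ℕ :=
  Nat.card {p : Nat.Partition n //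
    (∀ i ∈ p.parts, i ∈ S) ∧ Even (Multiset.card p.parts)}

/-- Number of partitions of `n` with all parts in `S` and an odd number of parts. -/
noncomputable def pInO (S : Set ℕ) (n : ℕ) : ℕ :=
  Nat.card {p : Nat.Partition n //
    (∀ i ∈ p.parts, i ∈ S) ∧ Odd (Multiset.card p.parts)}

/-- Number of partitions of `n` into distinct parts in `S`, with an even number of parts. -/
noncomputable def qInE (S : Set ℕ) (n : ℕ) : ℕ :=
  Nat.card {p : Nat.Partition n //
    p.parts.Nodup ∧ (∀ i ∈ p.parts, i ∈ S) ∧ Even (Multiset.card p.parts)}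

/-- Number of partitions of `n` into distinct parts in `S`, with an odd number of parts. -/
noncomputable def qInO (S : Set ℕ) (n : ℕ) : ℕ :=
  Nat.card {p : Nat.Partition n //
    p.parts.Nodup ∧ (∀ i ∈ p.parts, i ∈ S) ∧ Odd (Multiset.card p.parts)}

open PowerSeries in
open scoped PowerSeries.WithPiTopology in
/-- The factors `∑ j, (εXⁱ)ʲ` and `1 - εXⁱ` attached to a part `i` are inverse to each other. -/
theorem genFun_mul_genFun_distinct {R : Type*} [CommRing R] (S : Set ℕ) [DecidablePred (· ∈ S)]
    (ε : R) :
    Nat.Partition.genFun (fun i c ↦ if i ∈ S then ε ^ c else 0) *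
      Nat.Partition.genFun (fun i c ↦ if i ∈ S ∧ c < 2 then (-ε) ^ c else 0) = 1 := by
  let _ : TopologicalSpace R := ⊥
  have : DiscreteTopology R := ⟨rfl⟩
  refine ((Nat.Partition.hasProd_genFun _).mul (Nat.Partition.hasProd_genFun _)).unique ?_
  convert hasProd_one with i
  by_cases hi : i + 1 ∈ S
  · have hconst : constantCoeff (ε • (X : R⟦X⟧) ^ (i + 1)) = 0 := by
      simp [smul_eq_C_mul]
    have hgeom : 1 + ∑' j, ε ^ (j + 1) • (X : R⟦X⟧) ^ ((i + 1) * (j + 1)) =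
        ∑' j, (ε • (X : R⟦X⟧) ^ (i + 1)) ^ j := by
      have hsum := WithPiTopology.summable_pow_of_constantCoeff_eq_zero hconst
      rw [hsum.tsum_eq_zero_add, pow_zero]
      simp_rw [smul_pow, pow_mul]
    have htwo : ∑' j, (if j + 1 < 2 then (-ε) ^ (j + 1) else 0) • (X : R⟦X⟧) ^
        ((i + 1) * (j + 1)) = -(ε • X ^ (i + 1)) := by
      rw [tsum_eq_single 0 fun j hj ↦ by simp [hj]]
      simp
    simp only [hi, if_true, true_and]
    rw [hgeom, htwo, ← sub_eq_add_neg,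
      WithPiTopology.tsum_pow_mul_one_sub_of_constantCoeff_eq_zero hconst]
  · simp [hi]

theorem Multiset.prod_toFinsupp_restricted {R : Type*} [CommSemiring R] (S : Set ℕ)
    [DecidablePred (· ∈ S)] (ε : R) (s : Multiset ℕ) :
    s.toFinsupp.prod (fun i c ↦ if i ∈ S then ε ^ c else 0) =
      if ∀ i ∈ s, i ∈ S then ε ^ s.card else 0 := by
  rw [Finsupp.prod, Finset.prod_ite_zero]
  simp [Finset.prod_pow_eq_pow_sum]

theorem Multiset.prod_toFinsupp_distinct {R : Type*} [CommSemiring R] (S : Set ℕ)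
    [DecidablePred (· ∈ S)] (ε : R) (s : Multiset ℕ) :
    s.toFinsupp.prod (fun i c ↦ if i ∈ S ∧ c < 2 then ε ^ c else 0) =
      if s.Nodup ∧ ∀ i ∈ s, i ∈ S then ε ^ s.card else 0 := by
  rw [Finsupp.prod, Finset.prod_ite_zero]
  have : (∀ i ∈ s.toFinsupp.support, i ∈ S ∧ s.toFinsupp i < 2) ↔
      s.Nodup ∧ ∀ i ∈ s, i ∈ S := by
    rw [Multiset.nodup_iff_count_le_one]
    simp only [Multiset.toFinsupp_support, Multiset.mem_toFinset, Multiset.toFinsupp_apply]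
    refine ⟨fun h ↦ ⟨fun a ↦ ?_, fun i hi ↦ (h i hi).1⟩, fun h i hi ↦
      ⟨h.2 i hi, Nat.lt_succ_of_le (h.1 i)⟩⟩
    by_cases ha : a ∈ s
    · exact Nat.le_of_lt_succ (h a ha).2
    · simp [Multiset.count_eq_zero_of_notMem ha]
  simp only [this]
  simp [Finset.prod_pow_eq_pow_sum]

theorem sum_ite_one_eq_natCard {α : Type*} [Fintype α] (p : α → Prop) [DecidablePred p] :
    ∑ a, (if p a then 1 else 0 : ℤ) = Nat.card {a // p a} := by
  simp [Fintype.card_subtype]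

theorem sum_ite_neg_one_pow {α : Type*} [Fintype α] (p : α → Prop) [DecidablePred p] (f : α → ℕ) :
    ∑ a, (if p a then (-1) ^ f a else 0 : ℤ) =
      Nat.card {a // p a ∧ Even (f a)} - Nat.card {a // p a ∧ Odd (f a)} := by
  rw [← sum_ite_one_eq_natCard, ← sum_ite_one_eq_natCard, ← Finset.sum_sub_distrib]
  refine Finset.sum_congr rfl fun a _ ↦ ?_
  rcases Nat.even_or_odd (f a) with h | h
  · simp [h.neg_one_pow, h, Nat.not_odd_iff_even.2 h]
  · by_cases hp : p a <;> simp [h.neg_one_pow, h, hp, Nat.not_even_iff_odd.2 h]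

theorem stmt15 (S₁ S₂ : Set ℕ) (hS₁ : ∀ s ∈ S₁, 0 < s) (hS₂ : ∀ s ∈ S₂, 0 < s)
    (hEuler : ∀ n : ℕ, qIn S₁ n = pIn S₂ n) (n : ℕ) :
    (qInE S₂ n : ℤ) - (qInO S₂ n : ℤ) = (pInE S₁ n : ℤ) - (pInO S₁ n : ℤ) := by
  classical
  have hgen : Nat.Partition.genFun (fun i c ↦ if i ∈ S₁ ∧ c < 2 then (1 : ℤ) ^ c else 0) =
      Nat.Partition.genFun (fun i c ↦ if i ∈ S₂ then (1 : ℤ) ^ c else 0) := by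
    ext m
    simp_rw [Nat.Partition.coeff_genFun, Multiset.prod_toFinsupp_distinct,
      Multiset.prod_toFinsupp_restricted, one_pow, sum_ite_one_eq_natCard]
    exact_mod_cast hEuler m
  have hinv₁ := genFun_mul_genFun_distinct S₁ (-1 : ℤ)
  have hinv₂ := genFun_mul_genFun_distinct S₂ (1 : ℤ)
  rw [neg_neg, hgen] at hinv₁
  have h := congrArg (PowerSeries.coeff n) (left_inv_eq_right_inv hinv₁ hinv₂)
  simp_rw [Nat.Partition.coeff_genFun, Multiset.prod_toFinsupp_distinct,
    Multiset.prod_toFinsupp_restricted, sum_ite_neg_one_pow, and_assoc] at h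
  exact h.symm
end

section
/- Let S₁ and S₂ be sets of positive integers forming an Euler pair such that every element of S₂ is odd. Then for every n ≥ 0, (−1)ⁿ · q(S₂;n) = pₑ(S₁;n) − p₀(S₁;n), where q(S₂;n) is the number of partitions of n into distinct parts from S₂, and pₑ(S₁;n) (resp. p₀(S₁;n)) is the number of partitions of n with parts from S₁ with an even (resp. odd) number of parts. -/
open PowerSeries PowerSeries.WithPiTopology in
open scoped Classical in
/-- The generating function of partitions with parts in `S`, weighted by `z ^ #parts`, is inverse to
that of partitions into distinct parts in `S`, weighted by `(-z) ^ #parts`. -/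
theorem genFun_parts_mul_genFun_distinct_parts {R : Type*} [CommRing R] (S : Set ℕ) (z : R) :
    Nat.Partition.genFun (fun i c ↦ if i ∈ S then z ^ c else 0) *
      Nat.Partition.genFun (fun i c ↦ if i ∈ S ∧ c = 1 then -z else 0) = 1 := by
  let _ : TopologicalSpace R := ⊥
  have _ : DiscreteTopology R := ⟨rfl⟩
  rw [Nat.Partition.genFun_eq_tprod, Nat.Partition.genFun_eq_tprod,
    ← (Nat.Partition.multipliable_genFun fun i c ↦ if i ∈ S then z ^ c else 0).tprod_mul
      (Nat.Partition.multipliable_genFun fun i c ↦ if i ∈ S ∧ c = 1 then -z else 0)]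
  refine (tprod_congr fun i ↦ ?_).trans tprod_one
  by_cases hi : i + 1 ∈ S
  · have hy : constantCoeff (z • (X : R⟦X⟧) ^ (i + 1)) = 0 := by simp
    have hE : (1 : R⟦X⟧) + ∑' j, (if i + 1 ∈ S then z ^ (j + 1) else 0) •
        (X : R⟦X⟧) ^ ((i + 1) * (j + 1)) = ∑' j, (z • (X : R⟦X⟧) ^ (i + 1)) ^ j := by
      rw [(summable_pow_of_constantCoeff_eq_zero hy).tsum_eq_zero_add]
      simp [hi, smul_pow, pow_mul]
    have hD : (1 : R⟦X⟧) + ∑' j, (if i + 1 ∈ S ∧ j + 1 = 1 then -z else 0) •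
        (X : R⟦X⟧) ^ ((i + 1) * (j + 1)) = 1 - z • (X : R⟦X⟧) ^ (i + 1) := by
      rw [tsum_eq_single 0 (by intro j hj; simp [hj])]
      simp [hi, sub_eq_add_neg]
    rw [hE, hD, tsum_pow_mul_one_sub_of_constantCoeff_eq_zero hy]
  · simp [hi]

open scoped Classical in
theorem coeff_genFun_parts {R : Type*} [CommSemiring R] (S : Set ℕ) (z : R) (n : ℕ) :
    (Nat.Partition.genFun (fun i c ↦ if i ∈ S then z ^ c else 0)).coeff n =
      ∑ p : Nat.Partition n, if ∀ i ∈ p.parts, i ∈ S then z ^ p.parts.card else 0 := by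
  rw [Nat.Partition.coeff_genFun]
  refine Finset.sum_congr rfl fun p _ ↦ ?_
  rw [Finsupp.prod, Finset.prod_ite_zero, Finset.prod_pow_eq_pow_sum]
  simp

open scoped Classical in
theorem coeff_genFun_distinct_parts {R : Type*} [CommSemiring R] (S : Set ℕ) (z : R) (n : ℕ) :
    (Nat.Partition.genFun (fun i c ↦ if i ∈ S ∧ c = 1 then z else 0)).coeff n =
      ∑ p : Nat.Partition n,
        if p.parts.Nodup ∧ ∀ i ∈ p.parts, i ∈ S then z ^ p.parts.card else 0 := by
  rw [Nat.Partition.coeff_genFun]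
  refine Finset.sum_congr rfl fun p _ ↦ ?_
  rw [Finsupp.prod, Finset.prod_ite_zero, Finset.prod_const]
  have hiff : (∀ i ∈ p.parts.toFinsupp.support, i ∈ S ∧ p.parts.toFinsupp i = 1) ↔
      p.parts.Nodup ∧ ∀ i ∈ p.parts, i ∈ S := by
    simp only [Multiset.toFinsupp_support, Multiset.mem_toFinset, Multiset.toFinsupp_apply,
      Multiset.nodup_iff_count_eq_one]
    exact ⟨fun h ↦ ⟨fun i hi ↦ (h i hi).2, fun i hi ↦ (h i hi).1⟩,
      fun h i hi ↦ ⟨h.2 i hi, h.1 i hi⟩⟩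
  simp only [hiff]
  refine ite_congr rfl (fun h ↦ ?_) fun _ ↦ rfl
  rw [Multiset.toFinsupp_support, Multiset.toFinset_card_of_nodup h.1]

theorem Multiset.odd_sum_iff_odd_card {s : Multiset ℕ} (h : ∀ i ∈ s, Odd i) :
    Odd s.sum ↔ Odd s.card := by
  induction s using Multiset.induction with
  | empty => simp
  | cons a s ih =>
    have ha := h a (Multiset.mem_cons_self a s)
    have hs := ih fun i hi ↦ h i (Multiset.mem_cons_of_mem hi)
    rw [Multiset.sum_cons, Multiset.card_cons]
    grind [Nat.odd_add]

open scoped Classical in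
theorem natCast_card_subtype {α : Type*} [Fintype α] (P : α → Prop) :
    (Nat.card {a // P a} : ℤ) = ∑ a, if P a then 1 else 0 := by
  rw [Nat.card_eq_fintype_card, Fintype.card_subtype, Finset.sum_boole]

theorem stmt16 (S₁ S₂ : Set ℕ) (hS₁ : ∀ s ∈ S₁, 0 < s) (hS₂ : ∀ s ∈ S₂, Odd s)
    (hEuler : ∀ n : ℕ, qIn S₁ n = pIn S₂ n) (n : ℕ) :
    (-1 : ℤ) ^ n * (qIn S₂ n : ℤ) = (pInE S₁ n : ℤ) - (pInO S₁ n : ℤ) := by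
  classical
  let E (S : Set ℕ) (z : ℤ) := Nat.Partition.genFun fun i c ↦ if i ∈ S then z ^ c else 0
  let D (S : Set ℕ) (z : ℤ) := Nat.Partition.genFun fun i c ↦ if i ∈ S ∧ c = 1 then z else 0
  have hED (S : Set ℕ) (z : ℤ) : E S z * D S (-z) = 1 :=
    genFun_parts_mul_genFun_distinct_parts S z
  have hDE : D S₁ 1 = E S₂ 1 := by
    ext m
    have h : (qIn S₁ m : ℤ) = pIn S₂ m := by rw [hEuler]
    rw [qIn, pIn, natCast_card_subtype, natCast_card_subtype] at h
    simp only [D, E, coeff_genFun_distinct_parts, coeff_genFun_parts]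
    simp only [one_pow]
    convert! h
  have key : D S₂ (-1) = E S₁ (-1) := by
    have h₁ := hED S₁ (-1)
    rw [neg_neg, hDE] at h₁
    exact (left_inv_eq_right_inv h₁ (hED S₂ 1)).symm
  have hn := congrArg (PowerSeries.coeff n) key
  simp only [D, E, coeff_genFun_distinct_parts, coeff_genFun_parts] at hn
  rw [qIn, pInE, pInO, natCast_card_subtype, natCast_card_subtype, natCast_card_subtype,
    ← Finset.sum_sub_distrib, Finset.mul_sum]
  refine Eq.trans (Finset.sum_congr rfl fun p _ ↦ ?_)
    (hn.trans (Finset.sum_congr rfl fun p _ ↦ ?_))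
  · split_ifs with h
    · have hodd := Multiset.odd_sum_iff_odd_card fun i hi ↦ hS₂ i (h.2 i hi)
      rw [p.parts_sum] at hodd
      rcases Nat.even_or_odd n with hc | hc
      · have hp : Even p.parts.card := by rwa [← Nat.not_odd_iff_even, ← hodd, Nat.not_odd_iff_even]
        simp [hc.neg_one_pow, hp.neg_one_pow]
      · simp [hc.neg_one_pow, (hodd.mp hc).neg_one_pow]
    · simp
  · by_cases h : ∀ i ∈ p.parts, i ∈ S₁
    · rcases Nat.even_or_odd p.parts.card with hc | hc
      · rw [if_pos h, if_pos ⟨h, hc⟩, if_neg fun h' ↦ Nat.not_odd_iff_even.mpr hc h'.2,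
          hc.neg_one_pow, sub_zero]
      · rw [if_pos h, if_neg fun h' ↦ Nat.not_even_iff_odd.mpr hc h'.2, if_pos ⟨h, hc⟩,
          hc.neg_one_pow, zero_sub]
    · rw [if_neg h, if_neg fun h' ↦ h h'.1, if_neg fun h' ↦ h h'.1, sub_zero]
end

section
/- Let r be an odd integer with r ≥ 3. For every n ≥ 0, the number of partitions of n in which every part occurs at most r − 1 times is congruent modulo 2 to the number of partitions of n into distinct odd parts none of which is divisible by r. -/
namespace Nat.Partition

open PowerSeries PowerSeries.WithPiTopology Finset

/-- The generating function of partitions into distinct parts satisfying `p` is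
`∏ (1 + X ^ i)` over the `i` satisfying `p`. -/
theorem hasProd_powerSeriesMk_card_nodup_restricted (R : Type*) [TopologicalSpace R] [T2Space R]
    [CommSemiring R] (p : ℕ → Prop) [DecidablePred p] :
    HasProd (fun i ↦ if p (i + 1) then 1 + (X : R⟦X⟧) ^ (i + 1) else 1)
      (PowerSeries.mk fun n ↦
        (#{q : n.Partition | q.parts.Nodup ∧ ∀ i ∈ q.parts, p i} : R)) := by
  convert! hasProd_genFun (fun i c ↦ if c ≤ 1 ∧ p i then (1 : R) else 0) using 1
  · ext1 i
    rw [tsum_eq_single 0 (by intro j hj; simp [hj])]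
    by_cases h : p (i + 1) <;> simp [h]
  · simp_rw [genFun, card_filter, Finsupp.prod, prod_boole]
    ext n
    simp only [coeff_mk, Nat.cast_sum, Nat.cast_ite, Nat.cast_one, Nat.cast_zero]
    refine sum_congr rfl fun q _ ↦ if_congr ?_ rfl rfl
    simp only [Multiset.toFinsupp_support, Multiset.mem_toFinset, Multiset.toFinsupp_apply,
      Multiset.nodup_iff_count_le_one]
    refine ⟨fun h i hi ↦ ⟨h.1 i, h.2 i hi⟩, fun h ↦ ⟨fun i ↦ ?_, fun i hi ↦ (h i hi).2⟩⟩
    by_cases hi : i ∈ q.parts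
    · exact (h i hi).1
    · simp [Multiset.count_eq_zero_of_notMem hi]

/-- If `p` is invariant under doubling, then modulo 2 the partitions into parts satisfying `p` are
equinumerous with the partitions into distinct odd parts satisfying `p`. -/
theorem card_restricted_modEq_card_nodup_odd (p : ℕ → Prop) [DecidablePred p]
    (hp : ∀ i, p (2 * i) ↔ p i) (n : ℕ) :
    #(restricted n p) ≡
      #{q : n.Partition | q.parts.Nodup ∧ ∀ i ∈ q.parts, Odd i ∧ p i} [MOD 2] := by
  let _ : TopologicalSpace (ZMod 2) := ⊥
  have _ : DiscreteTopology (ZMod 2) := ⟨rfl⟩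
  have : CharP (ZMod 2)⟦X⟧ 2 := charP_of_injective_algebraMap (R := ZMod 2) C_injective 2
  have hA := hasProd_powerSeriesMk_card_restricted (ZMod 2) p
  have hE := hasProd_powerSeriesMk_card_nodup_restricted (ZMod 2) p
  have hD := hasProd_powerSeriesMk_card_nodup_restricted (ZMod 2) (fun i ↦ Odd i ∧ p i)
  set A : (ZMod 2)⟦X⟧ := PowerSeries.mk fun n ↦ (#(restricted n p) : ZMod 2)
  set E : (ZMod 2)⟦X⟧ := PowerSeries.mk fun n ↦
    (#{q : n.Partition | q.parts.Nodup ∧ ∀ i ∈ q.parts, p i} : ZMod 2)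
  set D : (ZMod 2)⟦X⟧ := PowerSeries.mk fun n ↦
    (#{q : n.Partition | q.parts.Nodup ∧ ∀ i ∈ q.parts, Odd i ∧ p i} : ZMod 2)
  have hAE : A * E = 1 := by
    refine (hA.mul hE).unique ?_
    convert! hasProd_one using 1
    ext1 i
    split_ifs
    · simp_rw [pow_mul, ← CharTwo.sub_eq_add (1 : (ZMod 2)⟦X⟧)]
      exact tsum_pow_mul_one_sub_of_constantCoeff_eq_zero (by simp)
    · simp
  have hEE : HasProd (fun i ↦ if Even (i + 1) ∧ p (i + 1) then 1 + (X : (ZMod 2)⟦X⟧) ^ (i + 1)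
      else 1) (E * E) := by
    have hinj : Function.Injective fun i : ℕ ↦ 2 * i + 1 := fun a b h ↦ by grind
    rw [← hinj.hasProd_iff]
    · convert! hE.mul hE using 1
      ext1 i
      have h2 : 2 * i + 1 + 1 = 2 * (i + 1) := by ring
      simp only [Function.comp_apply, h2, hp, even_two_mul, true_and]
      split_ifs
      · rw [← sq, CharTwo.add_sq, one_pow, ← pow_mul, mul_comm]
      · simp
    · intro i hi
      rw [if_neg]
      rintro ⟨⟨k, hk⟩, -⟩
      exact hi ⟨k - 1, by grind⟩
  have hDE : D * (E * E) = E := by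
    refine (hD.mul hEE).unique ?_
    convert! hE using 1
    ext1 i
    rcases Nat.even_or_odd (i + 1) with h | h
    · simp [h, Nat.not_odd_iff_even.mpr h]
    · simp [h, Nat.not_even_iff_odd.mpr h]
  have hAD : A = D := by
    linear_combination (-A ^ 2) * hDE + (D * A * E + D - A) * hAE
  rw [← ZMod.natCast_eq_natCast_iff]
  simpa [A, D] using congrArg (coeff n) hAD

end Nat.Partition

theorem stmt17 (r : ℕ) (hodd : Odd r) (hr : 3 ≤ r) (n : ℕ) :
    Nat.card {p : Nat.Partition n // ∀ i : ℕ, Multiset.count i p.parts ≤ r - 1} ≡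
    Nat.card {p : Nat.Partition n //
      p.parts.Nodup ∧ ∀ i ∈ p.parts, Odd i ∧ ¬ (r ∣ i)} [MOD 2] := by
  have h := Nat.Partition.card_restricted_modEq_card_nodup_odd (fun i ↦ ¬ r ∣ i)
    (fun i ↦ not_congr (Nat.Coprime.dvd_mul_left (Nat.coprime_two_right.mpr hodd))) n
  rw [Nat.Partition.card_restricted_eq_card_countRestricted n (by omega)] at h
  classical
  rw [Nat.card_eq_fintype_card, Nat.card_eq_fintype_card, Fintype.card_subtype,
    Fintype.card_subtype]
  convert! h using 2
  ext q
  simp only [Nat.Partition.countRestricted, Finset.mem_filter, Finset.mem_univ,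
    true_and]
  refine ⟨fun h i _ ↦ by have := h i; omega, fun h i ↦ ?_⟩
  by_cases hi : i ∈ q.parts
  · have := h i hi
    omega
  · simp [Multiset.count_eq_zero_of_notMem hi]
end

section
/- Let r ≥ 2 be an integer and let S₁ be a set of positive integers with rS₁ ⊆ S₁. For every n ≥ 0, the number of partitions of n with parts from S₁ in which each part occurs at most r − 1 times is congruent modulo 2 to the number of pairs (μ, ν), where μ is a partition into distinct parts all lying in rS₁, ν is a partition with all parts in S₁, and the sizes of μ and ν sum to n. -/
/-- The pairs `(μ, ν)` where `μ` is a partition into distinct parts from `rS`, `ν` is a partition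
into parts from `S`, and the sizes of `μ` and `ν` sum to `n`. -/
def IsOverpartitionPair (r : ℕ) (S : Set ℕ) (n : ℕ) (p : Multiset ℕ × Multiset ℕ) : Prop :=
  p.1.Nodup ∧ (∀ i ∈ p.1, ∃ s ∈ S, i = r * s) ∧ (∀ i ∈ p.2, i ∈ S) ∧ p.1.sum + p.2.sum = n

/-- The part `s ∈ S` can be toggled in `(μ, ν)`: either `r * s` is a part of `μ`, or `s` occurs at
least `r` times in `ν`. -/
def IsToggleable (r : ℕ) (S : Set ℕ) (p : Multiset ℕ × Multiset ℕ) (s : ℕ) : Prop :=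
  s ∈ S ∧ (r * s ∈ p.1 ∨ r ≤ p.2.count s)

/-- Trade a part `r * s` of the first component for `r` copies of `s` in the second one, or back. -/
def toggle (r s : ℕ) (p : Multiset ℕ × Multiset ℕ) : Multiset ℕ × Multiset ℕ :=
  if r * s ∈ p.1 then (p.1.erase (r * s), p.2 + Multiset.replicate r s)
  else (r * s ::ₘ p.1, p.2 - Multiset.replicate r s)

open Classical in
/-- Toggle the smallest toggleable part, if there is one. -/
noncomputable def toggleLeast (r : ℕ) (S : Set ℕ) (p : Multiset ℕ × Multiset ℕ) :
    Multiset ℕ × Multiset ℕ :=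
  if h : ∃ s, IsToggleable r S p s then toggle r (Nat.find h) p else p

section Toggle

variable {r n s : ℕ} {S : Set ℕ} {p : Multiset ℕ × Multiset ℕ}

theorem IsOverpartitionPair.toggle (hp : IsOverpartitionPair r S n p) (hs : IsToggleable r S p s) :
    IsOverpartitionPair r S n (toggle r s p) := by
  obtain ⟨h1, h2, h3, h4⟩ := hp
  obtain ⟨hS, hs⟩ := hs
  unfold _root_.toggle
  split_ifs with h
  · refine ⟨h1.erase _, fun i hi => h2 i (Multiset.mem_of_mem_erase hi), fun i hi => ?_, ?_⟩
    · rcases Multiset.mem_add.1 hi with hi | hi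
      · exact h3 i hi
      · exact Multiset.eq_of_mem_replicate hi ▸ hS
    · have := Multiset.sum_erase h
      simp only [Multiset.sum_add, Multiset.sum_replicate, smul_eq_mul]
      omega
  · have hle := Multiset.le_count_iff_replicate_le.1 (hs.resolve_left h)
    refine ⟨Multiset.nodup_cons.2 ⟨h, h1⟩, fun i hi => ?_, fun i hi =>
      h3 i (Multiset.mem_of_le tsub_le_self hi), ?_⟩
    · rcases Multiset.mem_cons.1 hi with rfl | hi
      · exact ⟨s, hS, rfl⟩
      · exact h2 i hi
    · have := congrArg Multiset.sum (tsub_add_cancel_of_le hle)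
      simp only [Multiset.sum_add, Multiset.sum_replicate, smul_eq_mul] at this
      simp only [Multiset.sum_cons]
      omega

theorem toggle_toggle (hp : p.1.Nodup) (hs : IsToggleable r S p s) :
    toggle r s (toggle r s p) = p := by
  by_cases h : r * s ∈ p.1
  · have h' : r * s ∉ p.1.erase (r * s) := hp.notMem_erase
    simp [toggle, h, h', Multiset.cons_erase]
  · have hle := Multiset.le_count_iff_replicate_le.1 (hs.2.resolve_left h)
    simp [toggle, h, tsub_add_cancel_of_le hle]

theorem toggle_ne : toggle r s p ≠ p := by
  intro h
  have h' := congrArg (fun q => q.1.card) h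
  by_cases hm : r * s ∈ p.1
  · have := Multiset.card_erase_add_one hm
    simp only [toggle, hm, if_true] at h'
    omega
  · simp [toggle, hm] at h'

theorem isToggleable_toggle_iff (hr : r ≠ 0) (hs : IsToggleable r S p s) (t : ℕ) :
    IsToggleable r S (toggle r s p) t ↔ IsToggleable r S p t := by
  obtain rfl | hts := eq_or_ne t s
  · refine iff_of_true ⟨hs.1, ?_⟩ hs
    by_cases h : r * t ∈ p.1 <;> simp [toggle, h]
  · have hrt : r * t ≠ r * s := fun h => hts (Nat.eq_of_mul_eq_mul_left (by omega) h)
    by_cases h : r * s ∈ p.1 <;>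
      simp [IsToggleable, toggle, h, Multiset.mem_erase_of_ne hrt, hrt, Multiset.count_replicate,
        hts.symm]

theorem IsOverpartitionPair.toggleLeast (hp : IsOverpartitionPair r S n p) :
    IsOverpartitionPair r S n (toggleLeast r S p) := by
  classical
  unfold _root_.toggleLeast
  split_ifs with h
  · exact hp.toggle (Nat.find_spec h)
  · exact hp

theorem toggleLeast_toggleLeast (hr : r ≠ 0) (hp : p.1.Nodup) :
    toggleLeast r S (toggleLeast r S p) = p := by
  classical
  by_cases h : ∃ s, IsToggleable r S p s
  · have hiff := isToggleable_toggle_iff hr (Nat.find_spec h)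
    have h' : ∃ s, IsToggleable r S (toggle r (Nat.find h) p) s := by simpa only [hiff] using h
    have hfind : Nat.find h' = Nat.find h := Nat.find_congr' fun {_} => hiff _
    have hT : toggleLeast r S p = toggle r (Nat.find h) p := dif_pos h
    rw [hT, toggleLeast, dif_pos h', hfind, toggle_toggle hp (Nat.find_spec h)]
  · simp [toggleLeast, h]

theorem toggleLeast_eq_self_iff :
    toggleLeast r S p = p ↔ ∀ s, ¬ IsToggleable r S p s := by
  classical
  unfold toggleLeast
  split_ifs with h
  · simp only [toggle_ne, false_iff, not_forall, not_not]
    exact h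
  · simpa using h

end Toggle

theorem finite_isOverpartitionPair {r : ℕ} (hr : 0 < r) {S : Set ℕ} (hS : ∀ s ∈ S, 0 < s) (n : ℕ) :
    {p | IsOverpartitionPair r S n p}.Finite := by
  have hfin : (⋃ k ∈ Set.Iic n, Set.range (Nat.Partition.parts (n := k))).Finite :=
    (Set.finite_Iic n).biUnion fun k _ => Set.finite_range _
  refine (hfin.prod hfin).subset fun p hp => ?_
  obtain ⟨-, h2, h3, h4⟩ := hp
  simp only [Set.mem_prod, Set.mem_iUnion, Set.mem_range, Set.mem_Iic]
  refine ⟨⟨p.1.sum, by omega, ⟨p.1, fun {i} hi => ?_, rfl⟩, rfl⟩,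
    ⟨p.2.sum, by omega, ⟨p.2, fun {i} hi => hS i (h3 i hi), rfl⟩, rfl⟩⟩
  obtain ⟨s, hs, rfl⟩ := h2 i hi
  exact Nat.mul_pos hr (hS s hs)

/-- The partitions of `n` with parts in `S`, each occurring fewer than `r` times, are the pairs
without a toggleable part. -/
def partitionEquivNotToggleable {r : ℕ} (hr : 0 < r) {S : Set ℕ} (hS : ∀ s ∈ S, 0 < s) (n : ℕ) :
    {p : Nat.Partition n // (∀ i ∈ p.parts, i ∈ S) ∧ ∀ i : ℕ, Multiset.count i p.parts ≤ r - 1} ≃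
    {p // IsOverpartitionPair r S n p ∧ ∀ s, ¬ IsToggleable r S p s} where
  toFun p := ⟨(0, p.1.parts), ⟨by simp, by simp, p.2.1, by simp [p.1.parts_sum]⟩, fun s hs => by
    have := p.2.2 s
    have := hs.2.resolve_left (Multiset.notMem_zero _)
    dsimp only at this
    omega⟩
  invFun p :=
    have h0 : p.1.1 = 0 := Multiset.eq_zero_of_forall_notMem fun i hi => by
      obtain ⟨s, hs, rfl⟩ := p.2.1.2.1 i hi
      exact p.2.2 s ⟨hs, .inl hi⟩
    ⟨⟨p.1.2, fun {i} hi => hS i (p.2.1.2.2.1 i hi), by simpa [h0] using p.2.1.2.2.2⟩,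
      p.2.1.2.2.1, fun i => by
        by_cases hi : i ∈ p.1.2
        · have : ¬ r ≤ p.1.2.count i := fun h => p.2.2 i ⟨p.2.1.2.2.1 i hi, .inr h⟩
          dsimp only
          omega
        · simp [Multiset.count_eq_zero_of_notMem hi]⟩
  left_inv _ := rfl
  right_inv p := Subtype.ext <| Prod.ext
    (Multiset.eq_zero_of_forall_notMem fun i hi => by
      obtain ⟨s, hs, rfl⟩ := p.2.1.2.1 i hi
      exact p.2.2 s ⟨hs, .inl hi⟩).symm rfl

theorem stmt18 (r : ℕ) (hr : 2 ≤ r) (S₁ : Set ℕ)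
    (hpos : ∀ s ∈ S₁, 0 < s) (hclosed : ∀ s ∈ S₁, r * s ∈ S₁) (n : ℕ) :
    Nat.card {p : Nat.Partition n //
      (∀ i ∈ p.parts, i ∈ S₁) ∧ ∀ i : ℕ, Multiset.count i p.parts ≤ r - 1} ≡
    Nat.card {μν : Multiset ℕ × Multiset ℕ //
      μν.1.Nodup ∧ (∀ i ∈ μν.1, ∃ s ∈ S₁, i = r * s) ∧
      (∀ i ∈ μν.2, i ∈ S₁) ∧ μν.1.sum + μν.2.sum = n} [MOD 2] := by
  classical
  change _ ≡ Nat.card {p // IsOverpartitionPair r S₁ n p} [MOD 2]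
  have hr0 : 0 < r := by omega
  have : Fintype {p // IsOverpartitionPair r S₁ n p} :=
    (finite_isOverpartitionPair hr0 hpos n).fintype
  let f : Function.End {p // IsOverpartitionPair r S₁ n p} :=
    fun p => ⟨toggleLeast r S₁ p.1, p.2.toggleLeast⟩
  have hf : f ^ 2 ^ 1 = 1 := by
    funext p
    exact Subtype.ext (toggleLeast_toggleLeast hr0.ne' p.2.1)
  have hfix : Nat.card (Function.fixedPoints f) =
      Nat.card {p // IsOverpartitionPair r S₁ n p ∧ ∀ s, ¬ IsToggleable r S₁ p s} :=
    Nat.card_congr <| (Equiv.subtypeEquivRight fun p => by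
      change f p = p ↔ _
      rw [Subtype.ext_iff]
      exact toggleLeast_eq_self_iff).trans
        (Equiv.subtypeSubtypeEquivSubtypeInter _ fun p => ∀ s, ¬ IsToggleable r S₁ p s)
  rw [Nat.card_congr (partitionEquivNotToggleable hr0 hpos n), ← hfix, Nat.card_eq_fintype_card,
    Nat.card_eq_fintype_card]
  exact (Equiv.Perm.card_fixedPoints_modEq hf).symm
end

section
/- For every n ≥ 0, the number of 3-regular partitions of n is congruent modulo 2 to the number of partitions of n into distinct parts congruent to ±1 modulo 6. -/
namespace PartitionParity

/-- Either `2 * h` is a part, or `h` is a part at least twice. -/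
def Active (s : Multiset ℕ) (h : ℕ) : Prop := 0 < s.count (2 * h) ∨ 2 ≤ s.count h

instance (s : Multiset ℕ) : DecidablePred (Active s) :=
  fun _ ↦ inferInstanceAs (Decidable (_ ∨ _))

/-- Split one part `2 * h` into two parts `h` if possible, and otherwise merge two parts `h`. -/
def toggle (s : Multiset ℕ) (h : ℕ) : Multiset ℕ :=
  if 2 * h ∈ s then h ::ₘ h ::ₘ s.erase (2 * h) else (2 * h) ::ₘ (s.erase h).erase h

/-- `h` is the largest active number, and it is positive. -/
structure IsTop (s : Multiset ℕ) (h : ℕ) : Prop where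
  pos : 0 < h
  active : Active s h
  not_active : ∀ k, h < k → ¬ Active s k

theorem count_erase_eq_ite (s : Multiset ℕ) (a j : ℕ) :
    (s.erase a).count j = if j = a then s.count j - 1 else s.count j := by
  split_ifs with h
  · rw [h, Multiset.count_erase_self]
  · exact Multiset.count_erase_of_ne h s

theorem count_toggle {s : Multiset ℕ} {h : ℕ} (hh : 0 < h) (j : ℕ) :
    (toggle s h).count j =
      if 0 < s.count (2 * h) then
        (if j = h then s.count j + 2 else if j = 2 * h then s.count j - 1 else s.count j)
      else
        (if j = h then s.count j - 2 else if j = 2 * h then s.count j + 1 else s.count j) := by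
  unfold toggle
  simp only [Multiset.count_pos]
  split_ifs <;> simp only [Multiset.count_cons, count_erase_eq_ite] <;> grind

theorem IsTop.toggle {s : Multiset ℕ} {h : ℕ} (H : IsTop s h) : IsTop (toggle s h) h := by
  obtain ⟨hpos, hact, hmax⟩ := H
  refine ⟨hpos, ?_, fun k hk ↦ ?_⟩
  · simp only [Active, count_toggle hpos] at hact ⊢
    grind
  · have h1 := hmax k hk
    have h2 := hmax (2 * h) (by omega)
    simp only [Active, count_toggle hpos] at h1 h2 ⊢
    grind

theorem IsTop.toggle_toggle {s : Multiset ℕ} {h : ℕ} (H : IsTop s h) :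
    PartitionParity.toggle (PartitionParity.toggle s h) h = s := by
  obtain ⟨hpos, hact, hmax⟩ := H
  have h2 := hmax (2 * h) (by omega)
  ext j
  simp only [Active, count_toggle hpos] at hact h2 ⊢
  grind

theorem IsTop.toggle_ne {s : Multiset ℕ} {h : ℕ} (H : IsTop s h) :
    PartitionParity.toggle s h ≠ s := by
  intro e
  have := congrArg (Multiset.count h) e
  have hact := H.active
  simp only [Active, count_toggle H.pos] at this hact
  grind

theorem IsTop.sum_toggle {s : Multiset ℕ} {h : ℕ} (H : IsTop s h) :
    (PartitionParity.toggle s h).sum = s.sum := by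
  unfold PartitionParity.toggle
  split_ifs with hm
  · have := Multiset.sum_erase hm
    simp only [Multiset.sum_cons]
    omega
  · have hact : 2 ≤ s.count h := by
      have := H.active
      rw [Active, Multiset.count_pos] at this
      tauto
    have h1 : h ∈ s := Multiset.count_pos.1 (by omega)
    have h2 : h ∈ s.erase h := Multiset.count_pos.1 (by rw [Multiset.count_erase_self]; omega)
    have e1 := Multiset.sum_erase h1
    have e2 := Multiset.sum_erase h2
    simp only [Multiset.sum_cons]
    omega

theorem mem_toggle {s : Multiset ℕ} {h i : ℕ} (hi : i ∈ toggle s h) :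
    i ∈ s ∨ (i = h ∧ 2 * h ∈ s) ∨ i = 2 * h := by
  unfold toggle at hi
  split_ifs at hi with hm <;> simp only [Multiset.mem_cons] at hi
  · rcases hi with hi | hi | hi
    · exact .inr (.inl ⟨hi, hm⟩)
    · exact .inr (.inl ⟨hi, hm⟩)
    · exact .inl (Multiset.mem_of_mem_erase hi)
  · rcases hi with hi | hi
    · exact .inr (.inr hi)
    · exact .inl (Multiset.mem_of_mem_erase (Multiset.mem_of_mem_erase hi))

theorem IsTop.mem_or_mem {s : Multiset ℕ} {h : ℕ} (H : IsTop s h) : 2 * h ∈ s ∨ h ∈ s := by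
  refine H.active.imp Multiset.count_pos.1 fun h' ↦ Multiset.count_pos.1 (by omega)

theorem IsTop.not_three_dvd {s : Multiset ℕ} {h : ℕ} (H : IsTop s h)
    (hs : ∀ i ∈ s, ¬ 3 ∣ i) : ∀ i ∈ PartitionParity.toggle s h, ¬ 3 ∣ i := by
  intro i hi
  have h1 := hs (2 * h)
  have h2 := hs h
  have := H.mem_or_mem
  rcases mem_toggle hi with hi | ⟨rfl, hi⟩ | rfl
  · exact hs i hi
  · have := h1 hi
    omega
  · grind

theorem IsTop.unique {s : Multiset ℕ} {h k : ℕ} (H : IsTop s h) (K : IsTop s k) : h = k := by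
  rcases lt_trichotomy h k with hk | hk | hk
  · exact absurd K.active (H.not_active k hk)
  · exact hk
  · exact absurd H.active (K.not_active h hk)

/-- The partition obtained by toggling at the largest active number. -/
def togglePartition {n : ℕ} (p : n.Partition) (h : ℕ) (H : IsTop p.parts h) : n.Partition where
  parts := toggle p.parts h
  parts_pos {i} hi := by
    have := H.pos
    rcases mem_toggle hi with hi | ⟨rfl, -⟩ | rfl
    · exact p.parts_pos hi
    · exact this
    · omega
  parts_sum := H.sum_toggle.trans p.parts_sum

theorem exists_isTop {n : ℕ} (p : n.Partition) (hp : ∃ h, Active p.parts h) :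
    ∃ h, IsTop p.parts h := by
  have key : ∀ h, Active p.parts h → 0 < h ∧ h ≤ n := by
    intro h hh
    rcases hh with hh | hh
    · have := Multiset.count_pos.1 hh
      have h1 := p.parts_pos this
      have h2 := p.le_of_mem_parts this
      omega
    · have : h ∈ p.parts := Multiset.count_pos.1 (by omega)
      exact ⟨p.parts_pos this, p.le_of_mem_parts this⟩
  obtain ⟨h, hh⟩ := hp
  have hact := Nat.findGreatest_spec (key h hh).2 hh
  exact ⟨_, (key _ hact).1, hact,
    fun k hk hk' ↦ Nat.findGreatest_is_greatest hk (key k hk').2 hk'⟩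

open Classical in
theorem even_card_active (n : ℕ) :
    Even (Finset.univ.filter fun p : n.Partition ↦
      (∀ i ∈ p.parts, ¬ 3 ∣ i) ∧ ∃ h, IsTop p.parts h).card := by
  rw [← ZMod.natCast_eq_zero_iff_even, Finset.card_eq_sum_ones, Nat.cast_sum]
  have mem {p : n.Partition} (hp : p ∈ Finset.univ.filter fun p : n.Partition ↦
      (∀ i ∈ p.parts, ¬ 3 ∣ i) ∧ ∃ h, IsTop p.parts h) := (Finset.mem_filter.1 hp).2
  refine Finset.sum_involution
    (fun p hp ↦ togglePartition p _ (mem hp).2.choose_spec) ?_ ?_ ?_ ?_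
  · intro p hp
    decide
  · intro p hp _ e
    exact (mem hp).2.choose_spec.toggle_ne (congrArg Nat.Partition.parts e)
  · intro p hp
    have H := (mem hp).2.choose_spec
    exact Finset.mem_filter.2 ⟨Finset.mem_univ _, H.not_three_dvd (mem hp).1, _, H.toggle⟩
  · intro p hp
    have H := (mem hp).2.choose_spec
    apply Nat.Partition.ext
    generalize_proofs _ _ h2
    have e := h2.choose_spec.unique H.toggle
    exact (congrArg (toggle _) e).trans H.toggle_toggle

theorem not_active_iff {n : ℕ} (p : n.Partition) :
    ((∀ i ∈ p.parts, ¬ 3 ∣ i) ∧ ¬ ∃ h, IsTop p.parts h) ↔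
      p.parts.Nodup ∧ ∀ i ∈ p.parts, i % 6 = 1 ∨ i % 6 = 5 := by
  have hex : (∃ h, IsTop p.parts h) ↔ ∃ h, Active p.parts h :=
    ⟨fun ⟨h, H⟩ ↦ ⟨h, H.active⟩, exists_isTop p⟩
  rw [hex, Multiset.nodup_iff_count_le_one]
  simp only [Active, Multiset.count_pos, not_exists, not_or, not_le]
  constructor
  · rintro ⟨h3, h⟩
    refine ⟨fun i ↦ Nat.le_of_lt_succ (h i).2, fun i hi ↦ ?_⟩
    have h1 := h3 i hi
    have h2 : i % 2 ≠ 0 := fun h0 ↦ (h (i / 2)).1 (by rwa [Nat.mul_div_cancel' (by omega)])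
    omega
  · rintro ⟨h1, h2⟩
    refine ⟨fun i hi ↦ ?_, fun i ↦ ⟨fun hi ↦ ?_, Nat.lt_succ_of_le (h1 i)⟩⟩ <;>
    · have := h2 _ hi
      omega

end PartitionParity

open PartitionParity in
theorem stmt19 (n : ℕ) :
    b3 n ≡ Nat.card {p : Nat.Partition n //
      p.parts.Nodup ∧ ∀ i ∈ p.parts, i % 6 = 1 ∨ i % 6 = 5} [MOD 2] := by
  classical
  simp only [b3, ← not_active_iff, Nat.card_eq_fintype_card, Fintype.card_subtype]
  have hsplit := Finset.card_filter_add_card_filter_not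
    (s := Finset.univ.filter fun p : n.Partition ↦ ∀ i ∈ p.parts, ¬ 3 ∣ i)
    (fun p ↦ ∃ h, IsTop p.parts h)
  simp only [Finset.filter_filter] at hsplit
  obtain ⟨k, hk⟩ := even_card_active n
  rw [Nat.ModEq, ← hsplit, hk]
  omega
end
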